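/- Let p ∈ [1,∞) and q⃗ = (q₁,q₂,q₃) with q_j > 1 for each j and 2/p + 1/q̄ = 1, where 1/q̄ := 1/q₁+1/q₂+1/q₃. If (u,Π) is a suitable weak solution of the 3D Navier-Stokes equations on Q(ϱ) for some ϱ > 0 and ‖u‖_{L^p_t L^{q⃗}_x(Q(ϱ))} < ∞, then (0,0) is a regular point of u. -/

import Mathlib

open MeasureTheory ENNReal Set Metric Filter

noncomputable section

/-- Euclidean 3-space. -/
abbrev E3 : Type := EuclideanSpace ℝ (Fin 3)

/-- The point (x₁,x₂,x₃) of ℝ³. -/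
def pt3 (x1 x2 x3 : ℝ) : E3 := (WithLp.equiv 2 (Fin 3 → ℝ)).symm ![x1, x2, x3]

/-- Anisotropic Lebesgue (quasi-)norm `‖f‖_{L^{q⃗}(Ω)}` with finite exponents:
iterated L^{q₁}, L^{q₂}, L^{q₃} norms in x₁, x₂, x₃ of f extended by 0 outside Ω. -/
def anisoNorm (q1 q2 q3 : ℝ) (Ω : Set E3) (f : E3 → ℝ) : ℝ≥0∞ :=
  (∫⁻ x3 : ℝ, (∫⁻ x2 : ℝ, (∫⁻ x1 : ℝ,
      (ENNReal.ofReal |Ω.indicator f (pt3 x1 x2 x3)|) ^ q1) ^ (q2 / q1)) ^ (q3 / q2)) ^ (1 / q3)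

/-- Mixed norm `‖f‖_{L^p_t L^{q⃗}_x(Q(r))}`, time exponent `p ∈ [1,∞]`,
where `Q(r) = B(r) × (−r²,0)`. -/
def mixedNorm (p : ℝ≥0∞) (q1 q2 q3 r : ℝ) (f : E3 → ℝ → ℝ) : ℝ≥0∞ :=
  if p = ∞ then
    essSup (fun t => anisoNorm q1 q2 q3 (ball (0 : E3) r) (fun x => f x t))
      (volume.restrict (Ioo (-(r^2)) 0))
  else
    (∫⁻ t in Ioo (-(r^2)) 0,
        (anisoNorm q1 q2 q3 (ball (0 : E3) r) (fun x => f x t)) ^ p.toReal) ^ (1 / p.toReal)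

/-- Partial derivative in the i-th coordinate direction. -/
def pd (i : Fin 3) (f : E3 → ℝ) (x : E3) : ℝ := fderiv ℝ f x (EuclideanSpace.single i 1)

/-- Laplacian. -/
def lap (f : E3 → ℝ) (x : E3) : ℝ := ∑ i : Fin 3, pd i (fun y => pd i f y) x

/-- Scalar test functions compactly supported in `Q(R) = B(R) × (−R²,0)`. -/
def IsTest (R : ℝ) (φ : E3 → ℝ → ℝ) : Prop :=
  ContDiff ℝ (⊤ : ℕ∞) (fun z : E3 × ℝ => φ z.1 z.2) ∧
  HasCompactSupport (fun z : E3 × ℝ => φ z.1 z.2) ∧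
  tsupport (fun z : E3 × ℝ => φ z.1 z.2) ⊆ (ball (0 : E3) R) ×ˢ (Ioo (-(R^2)) 0)

/-- Vector test functions compactly supported in `Q(R) = B(R) × (−R²,0)`. -/
def IsTestV (R : ℝ) (w : E3 → ℝ → E3) : Prop :=
  ContDiff ℝ (⊤ : ℕ∞) (fun z : E3 × ℝ => w z.1 z.2) ∧
  HasCompactSupport (fun z : E3 × ℝ => w z.1 z.2) ∧
  tsupport (fun z : E3 × ℝ => w z.1 z.2) ⊆ (ball (0 : E3) R) ×ˢ (Ioo (-(R^2)) 0)

/-- A suitable weak solution `(u, P)` of the 3D Navier–Stokes equations on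
`Q(R) = B(R) × (−R²,0)`: `u ∈ L^∞_t L²_x` with a distributional spatial gradient
`gu ∈ L²(Q(R))`, pressure `P ∈ L^{3/2}(Q(R))`, the equations hold in the sense of
distributions, and the local energy inequality holds. -/
structure SuitableWeakSolution (R : ℝ) (u : E3 → ℝ → E3) (P : E3 → ℝ → ℝ) where
  /-- the distributional spatial gradient: `gu x t i j = ∂ⱼuᵢ(x,t)` -/
  gu : E3 → ℝ → Fin 3 → Fin 3 → ℝ
  meas_u : Measurable (Function.uncurry u)
  meas_gu : Measurable (Function.uncurry gu)
  meas_press : Measurable (Function.uncurry P)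
  /-- `u ∈ L^∞(−R²,0; L²(B(R)))` -/
  bdd_L2 : essSup (fun t => ∫⁻ x in ball (0 : E3) R, ((‖u x t‖₊ : ℝ≥0∞)) ^ 2)
      (volume.restrict (Ioo (-(R^2)) 0)) < ∞
  /-- `∇u ∈ L²(Q(R))` -/
  grad_L2 : (∫⁻ t in Ioo (-(R^2)) 0, ∫⁻ x in ball (0 : E3) R,
      ENNReal.ofReal (∑ i : Fin 3, ∑ j : Fin 3, (gu x t i j) ^ 2)) < ∞
  /-- `P ∈ L^{3/2}(Q(R))` -/
  press_L32 : (∫⁻ t in Ioo (-(R^2)) 0, ∫⁻ x in ball (0 : E3) R,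
      (ENNReal.ofReal |P x t|) ^ (3/2 : ℝ)) < ∞
  /-- `gu` is the distributional spatial gradient of `u` on `Q(R)` -/
  is_grad : ∀ φ : E3 → ℝ → ℝ, IsTest R φ → ∀ i j : Fin 3,
      (∫ t in Ioo (-(R^2)) 0, ∫ x in ball (0 : E3) R, u x t i * pd j (fun y => φ y t) x)
        = - ∫ t in Ioo (-(R^2)) 0, ∫ x in ball (0 : E3) R, gu x t i j * φ x t
  /-- `∂ₜu − Δu + (u·∇)u + ∇P = 0` in the sense of distributions on `Q(R)` -/
  weak_NS : ∀ w : E3 → ℝ → E3, IsTestV R w →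
      (∫ t in Ioo (-(R^2)) 0, ∫ x in ball (0 : E3) R,
        (-(∑ i : Fin 3, u x t i * deriv (fun s => w x s i) t)
          - (∑ i : Fin 3, u x t i * lap (fun y => w y t i) x)
          - (∑ i : Fin 3, ∑ j : Fin 3, u x t i * u x t j * pd i (fun y => w y t j) x)
          - P x t * (∑ j : Fin 3, pd j (fun y => w y t j) x))) = 0
  /-- `div u = 0` in the sense of distributions on `Q(R)` -/
  weak_div : ∀ ψ : E3 → ℝ → ℝ, IsTest R ψ →
      (∫ t in Ioo (-(R^2)) 0, ∫ x in ball (0 : E3) R,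
        ∑ i : Fin 3, u x t i * pd i (fun y => ψ y t) x) = 0
  /-- the local energy inequality -/
  local_energy : ∀ φ : E3 → ℝ → ℝ, IsTest R φ → (∀ x t, 0 ≤ φ x t) →
      ∀ᵐ t ∂(volume.restrict (Ioo (-(R^2)) 0)),
        (∫ x in ball (0 : E3) R, ‖u x t‖ ^ 2 * φ x t)
          + 2 * ∫ s in Ioo (-(R^2)) t, ∫ x in ball (0 : E3) R,
              (∑ i : Fin 3, ∑ j : Fin 3, (gu x s i j) ^ 2) * φ x s
        ≤ (∫ s in Ioo (-(R^2)) t, ∫ x in ball (0 : E3) R,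
              ‖u x s‖ ^ 2 * (deriv (fun τ => φ x τ) s + lap (fun y => φ y s) x))
          + ∫ s in Ioo (-(R^2)) t, ∫ x in ball (0 : E3) R,
              (∑ i : Fin 3, u x s i * pd i (fun y => φ y s) x) * (‖u x s‖ ^ 2 + 2 * P x s)

/-- `(0,0)` is a regular point of `u`: `u` is essentially bounded on some `Q(r)`, `r > 0`. -/
def RegularPoint (u : E3 → ℝ → E3) : Prop :=
  ∃ r > (0 : ℝ), ∃ M : ℝ,
    ∀ᵐ z : E3 × ℝ ∂(volume.restrict ((ball (0 : E3) r) ×ˢ (Ioo (-(r^2)) 0))),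
      ‖u z.1 z.2‖ ≤ M

namespace ANS

lemma lint_rpow {c : ℝ} (hc : -1 < c) {Y : ℝ} (hY : 0 ≤ Y) :
    ∫⁻ x in Ioo 0 Y, ENNReal.ofReal x ^ c = ENNReal.ofReal (Y ^ (c+1) / (c+1)) := by
  have h1 : ∫⁻ x in Ioo 0 Y, ENNReal.ofReal x ^ c = ∫⁻ x in Ioo 0 Y, ENNReal.ofReal (x ^ c) := by
    refine setLIntegral_congr_fun measurableSet_Ioo fun x hx => ?_
    rw [ENNReal.ofReal_rpow_of_pos hx.1]
  have hInt9 : IntervalIntegrable (fun x : ℝ => x ^ c) volume 0 Y :=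
    intervalIntegral.intervalIntegrable_rpow' hc
  have hInt92 : IntegrableOn (fun x : ℝ => x ^ c) (Ioo 0 Y) :=
    ((intervalIntegrable_iff_integrableOn_Ioc_of_le hY).1 hInt9).mono_set Ioo_subset_Ioc_self
  rw [h1, ← ofReal_integral_eq_lintegral_ofReal hInt92, ← integral_Ioc_eq_integral_Ioo,
    ← intervalIntegral.integral_of_le hY, integral_rpow (Or.inl hc)]
  · rw [Real.zero_rpow (by linarith), sub_zero]
  · refine (ae_restrict_iff' measurableSet_Ioo).2 (Eventually.of_forall fun x hx => ?_)
    exact Real.rpow_nonneg hx.1.le _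

/-- Riesz kernel -/
def rk (l : ℝ) (x : ℝ) : ℝ≥0∞ := ENNReal.ofReal |x| ^ (-l)

lemma measurable_rk (l : ℝ) : Measurable (rk l) := by unfold rk; fun_prop

lemma rk_neg (l x : ℝ) : rk l (-x) = rk l x := by simp [rk]

lemma hls_set {l : ℝ} (hl0 : 0 < l) (hl1 : l < 1) (t : ℝ) (A : Set ℝ) :
    ∫⁻ s in A, rk l (t - s) ≤ (ENNReal.ofReal (2 / (1-l)) + 1) * (volume A) ^ (1 - l) := by
  rcases eq_or_ne (volume A) 0 with h0 | h0
  · rw [Measure.restrict_eq_zero.2 h0]; simp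
  rcases eq_or_ne (volume A) ∞ with h1 | h1
  · rw [h1, ENNReal.top_rpow_of_pos (by linarith), ENNReal.mul_top (by simp)]; exact le_top
  set w := (volume A).toReal with hw
  have hwp : 0 < w := ENNReal.toReal_pos h0 h1
  have hwA : volume A = ENNReal.ofReal w := (ENNReal.ofReal_toReal h1).symm
  have key : ∀ s, rk l (t - s) ≤ (Ioo (t-w) t).indicator (fun s => rk l (t-s)) s
      + (Ioo t (t+w)).indicator (fun s => rk l (t-s)) s + ({t} : Set ℝ).indicator (fun s => ∞) s
      + ENNReal.ofReal w ^ (-l) := by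
    intro s
    by_cases h : |t - s| < w
    · rcases lt_trichotomy s t with h2 | h2 | h2
      · have : s ∈ Ioo (t-w) t := ⟨by linarith [(abs_lt.1 h).2], h2⟩
        rw [indicator_of_mem this, add_assoc, add_assoc]; exact le_self_add
      · subst h2; simp
      · have : s ∈ Ioo t (t+w) := ⟨h2, by linarith [(abs_lt.1 h).1]⟩
        rw [indicator_of_mem this, add_comm (indicator _ _ _), add_assoc, add_assoc]
        exact le_self_add
    · refine le_trans ?_ le_add_self
      unfold rk
      push Not at h
      rw [ENNReal.rpow_neg, ENNReal.rpow_neg]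
      gcongr
  have e1 : ∫⁻ s in Ioo (t-w) t, rk l (t - s) = ENNReal.ofReal (w ^ (1-l) / (1-l)) := by
    have := lint_rpow (c := -l) (by linarith) hwp.le
    rw [show -l + 1 = 1 - l by ring] at this
    rw [← this, ← lintegral_indicator measurableSet_Ioo, ← lintegral_indicator measurableSet_Ioo,
      ← lintegral_sub_left_eq_self _ t]
    congr 1; ext s
    by_cases hs : s ∈ Ioo 0 w
    · rw [indicator_of_mem hs, indicator_of_mem (by constructor <;> linarith [hs.1, hs.2])]
      simp [rk, abs_of_pos hs.1]
    · rw [indicator_of_notMem hs, indicator_of_notMem]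
      intro h; exact hs (by constructor <;> linarith [h.1, h.2])
  have e2 : ∫⁻ s in Ioo t (t+w), rk l (t - s) = ENNReal.ofReal (w ^ (1-l) / (1-l)) := by
    have := lint_rpow (c := -l) (by linarith) hwp.le
    rw [show -l + 1 = 1 - l by ring] at this
    rw [← this, ← lintegral_indicator measurableSet_Ioo, ← lintegral_indicator measurableSet_Ioo,
      ← lintegral_add_left_eq_self _ t]
    congr 1; ext s
    by_cases hs : s ∈ Ioo 0 w
    · rw [indicator_of_mem hs, indicator_of_mem (by constructor <;> linarith [hs.1, hs.2])]
      simp [rk, abs_of_pos hs.1]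
    · rw [indicator_of_notMem hs, indicator_of_notMem]
      intro h; exact hs (by constructor <;> linarith [h.1, h.2])
  have m1 : Measurable fun s => rk l (t - s) := (measurable_rk l).comp (measurable_const.sub measurable_id)
  calc ∫⁻ s in A, rk l (t - s)
      ≤ ∫⁻ s in A, ((Ioo (t-w) t).indicator (fun s => rk l (t-s)) s
      + (Ioo t (t+w)).indicator (fun s => rk l (t-s)) s + ({t} : Set ℝ).indicator (fun s => ∞) s
      + ENNReal.ofReal w ^ (-l)) := lintegral_mono key
    _ = (∫⁻ s in A, (Ioo (t-w) t).indicator (fun s => rk l (t-s)) s)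
      + (∫⁻ s in A, (Ioo t (t+w)).indicator (fun s => rk l (t-s)) s)
      + (∫⁻ s in A, ({t} : Set ℝ).indicator (fun s => ∞) s)
      + ENNReal.ofReal w ^ (-l) * volume A := by
        rw [lintegral_add_right _ measurable_const, lintegral_add_right _
          (measurable_const.indicator (measurableSet_singleton t)),
          lintegral_add_right _ (m1.indicator measurableSet_Ioo)]
        simp
    _ ≤ (∫⁻ s, (Ioo (t-w) t).indicator (fun s => rk l (t-s)) s)
      + (∫⁻ s, (Ioo t (t+w)).indicator (fun s => rk l (t-s)) s)
      + (∫⁻ s, ({t} : Set ℝ).indicator (fun s => ∞) s)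
      + ENNReal.ofReal w ^ (-l) * volume A := by
        gcongr <;> exact Measure.restrict_le_self
    _ = _ := by
        rw [lintegral_indicator measurableSet_Ioo, lintegral_indicator measurableSet_Ioo,
          lintegral_indicator (measurableSet_singleton t), e1, e2, hwA]
        simp only [lintegral_const, Measure.restrict_apply MeasurableSet.univ]
        simp only [univ_inter, Real.volume_singleton, mul_zero, add_zero]
        rw [ENNReal.ofReal_rpow_of_pos hwp, ENNReal.ofReal_rpow_of_pos hwp,
          ← ENNReal.ofReal_mul (by positivity), add_mul, one_mul,
          ← ENNReal.ofReal_mul (by have : 0 < 1 - l := by linarith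
                                   positivity), ← ENNReal.ofReal_add]
        · congr 2
          · ring
          · nth_rewrite 2 [← Real.rpow_one w]
            rw [← Real.rpow_add hwp]; congr 1; ring
        all_goals
          have : 0 < 1 - l := by linarith
          positivity


lemma hls_half {l a b : ℝ} (hl0 : 0 < l) (hl1 : l < 1) (ha : 1 < a) (hb : 1 < b)
    (hab : 1/a + 1/b + l = 2) : ∃ C : ℝ≥0∞, C ≠ ∞ ∧ ∀ v w : ℝ → ℝ≥0∞, Measurable v → Measurable w →
    ∫⁻ y in Ioi (0:ℝ), w y * ENNReal.ofReal y ^ (b-1) ≤ 1 →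
    ∫⁻ x in Ioi (0:ℝ), v x * ∫⁻ y in Ioo 0 (x ^ (a/b)), w y ^ (1-l)
      ≤ C * ∫⁻ x in Ioi (0:ℝ), v x * ENNReal.ofReal x ^ (a-1) := by
  have hbl : b * (1 - l) < 1 := by
    have h1 : 1/a < 1 := by rw [div_lt_one (by linarith)]; exact ha
    have h2 : 1 - l < 1/b := by linarith
    calc b * (1-l) < b * (1/b) := by gcongr
      _ = 1 := by field_simp
  set m := (b-1)*(1-l) with hm
  have hlm : m < l := by rw [hm]; nlinarith
  have hm0 : 0 < m := by rw [hm]; apply _root_.mul_pos <;> linarith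
  have hml : -1 < -m / l := by rw [lt_div_iff₀ hl0]; linarith
  refine ⟨ENNReal.ofReal (1 / (-m/l + 1)) ^ l, by simp [hl0.le], ?_⟩
  intro v w hv hw hw1
  rw [← lintegral_const_mul _ (by fun_prop)]
  refine setLIntegral_mono' measurableSet_Ioi fun x hx => ?_
  have hx : 0 < x := hx
  have hY : 0 < x ^ (a/b) := Real.rpow_pos_of_pos hx _
  have hold := ENNReal.lintegral_mul_le_Lp_mul_Lq (volume.restrict (Ioo 0 (x ^ (a/b))))
    (p := 1/(1-l)) (q := 1/l) (by
      rw [Real.holderConjugate_iff]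
      refine ⟨by rw [lt_div_iff₀] <;> linarith, by simp⟩)
    (f := fun y => w y ^ (1-l) * ENNReal.ofReal y ^ m) (g := fun y => ENNReal.ofReal y ^ (-m))
    (by fun_prop) (by fun_prop)
  have e0 : ∫⁻ y in Ioo 0 (x ^ (a/b)), w y ^ (1-l) = ∫⁻ y in Ioo 0 (x ^ (a/b)),
      ((fun y => w y ^ (1-l) * ENNReal.ofReal y ^ m) * (fun y => ENNReal.ofReal y ^ (-m))) y := by
    refine setLIntegral_congr_fun measurableSet_Ioo fun y hy => ?_
    have : ENNReal.ofReal y ≠ 0 := by simpa using hy.1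
    simp only [Pi.mul_apply]
    rw [mul_assoc, ← ENNReal.rpow_add _ _ this (by simp)]; simp
  have e1 : ∫⁻ y in Ioo 0 (x ^ (a/b)), (w y ^ (1-l) * ENNReal.ofReal y ^ m) ^ (1/(1-l)) ≤ 1 := by
    refine le_trans ?_ hw1
    refine le_trans (lintegral_mono_set (Ioo_subset_Ioi_self)) (le_of_eq ?_)
    congr 1; ext y
    rw [ENNReal.mul_rpow_of_nonneg _ _ (by have : 0 < 1 - l := by linarith
                                           positivity),
      ← ENNReal.rpow_mul, ← ENNReal.rpow_mul, hm]
    have : 1 - l ≠ 0 := by linarith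
    field_simp
    simp
  have e2 : ∫⁻ y in Ioo 0 (x ^ (a/b)), (ENNReal.ofReal y ^ (-m)) ^ (1/l)
      = ENNReal.ofReal ((x ^ (a/b)) ^ (-m/l+1) / (-m/l+1)) := by
    rw [← lint_rpow hml hY.le]
    congr 1; ext y; rw [← ENNReal.rpow_mul]; congr 1; ring
  rw [e0]
  rw [e2] at hold
  calc _ ≤ v x * (1 ^ (1 / (1/(1-l))) * ENNReal.ofReal ((x ^ (a/b)) ^ (-m/l+1) / (-m/l+1)) ^ (1/(1/l))) := by
        gcongr
        refine hold.trans ?_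
        gcongr
    _ = _ := by
        rw [ENNReal.one_rpow, one_mul, one_div_one_div, div_eq_mul_one_div, mul_comm (_ ^ _) (1/ _),
          ENNReal.ofReal_mul (by have : 0 < -m/l+1 := by linarith
                                 positivity), ENNReal.mul_rpow_of_nonneg _ _ hl0.le]
        rw [← Real.rpow_mul hx.le, ENNReal.ofReal_rpow_of_pos (Real.rpow_pos_of_pos hx _),
          ← Real.rpow_mul hx.le, ENNReal.ofReal_rpow_of_pos hx]
        have : a / b * (-m/l+1) * l = a - 1 := by
          have : a / b * (-m/l+1) * l = a/b * (l - m) := by field_simp; ring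
          rw [this, hm]
          have hl : l = 2 - 1/a - 1/b := by linarith
          rw [hl]; field_simp; ring
        rw [this]; ring

lemma layer (α : ℝ≥0∞) : ∫⁻ x in Ioi (0:ℝ), (if ENNReal.ofReal x < α then 1 else 0) = α := by
  have : ∀ x : ℝ, (if ENNReal.ofReal x < α then (1:ℝ≥0∞) else 0)
      = {x : ℝ | ENNReal.ofReal x < α}.indicator 1 x := by
    intro x; simp [indicator]
  simp_rw [this]
  have hms : MeasurableSet {x : ℝ | ENNReal.ofReal x < α} := measurableSet_lt (by fun_prop) measurable_const
  rw [lintegral_indicator_one hms, Measure.restrict_apply hms]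
  rcases eq_or_ne α ∞ with rfl | h
  · simp
  · have : {x : ℝ | ENNReal.ofReal x < α} ∩ Ioi 0 = Ioo 0 α.toReal := by
      ext x
      simp only [mem_inter_iff, mem_ofPred_eq, mem_Ioi, mem_Ioo]
      constructor
      · rintro ⟨h1, h2⟩; exact ⟨h2, (ENNReal.ofReal_lt_iff_lt_toReal h2.le h).1 h1⟩
      · rintro ⟨h1, h2⟩; exact ⟨(ENNReal.ofReal_lt_iff_lt_toReal h1.le h).2 h2, h1⟩
    rw [this]; simp [h]

lemma layer_pow {a : ℝ} (ha : 1 < a) (α : ℝ → ℝ≥0∞) (hα : Measurable α) :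
    ∫⁻ x in Ioi (0:ℝ), volume {t | ENNReal.ofReal x < α t} * ENNReal.ofReal x ^ (a-1)
      ≤ ∫⁻ t, α t ^ a := by
  have hmm : MeasurableSet {p : ℝ × ℝ | ENNReal.ofReal p.1 < α p.2} :=
    measurableSet_lt (by fun_prop) (by fun_prop)
  have : ∀ x : ℝ, volume {t | ENNReal.ofReal x < α t} * ENNReal.ofReal x ^ (a-1)
      = ∫⁻ t, (if ENNReal.ofReal x < α t then 1 else 0) * ENNReal.ofReal x ^ (a-1) := by
    intro x
    have hms : MeasurableSet {t | ENNReal.ofReal x < α t} := measurableSet_lt (by fun_prop) (by fun_prop)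
    rw [lintegral_mul_const _ (Measurable.ite hms measurable_const measurable_const)]
    congr 1
    rw [← lintegral_indicator_one hms]
    congr 1; ext t; simp [indicator]
  simp_rw [this]
  rw [lintegral_lintegral_swap (by
    refine Measurable.aemeasurable ?_
    exact (Measurable.ite hmm measurable_const measurable_const).mul (by fun_prop))]
  refine lintegral_mono fun t => ?_
  calc ∫⁻ x in Ioi (0:ℝ), (if ENNReal.ofReal x < α t then 1 else 0) * ENNReal.ofReal x ^ (a-1)
      ≤ ∫⁻ x in Ioi (0:ℝ), (if ENNReal.ofReal x < α t then 1 else 0) * α t ^ (a-1) := by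
        refine lintegral_mono fun x => ?_
        by_cases h : ENNReal.ofReal x < α t
        · simp only [h, if_true]; gcongr
        · simp [h]
    _ = α t ^ a := by
        rw [lintegral_mul_const _ (Measurable.ite (measurableSet_lt (by fun_prop) measurable_const) measurable_const measurable_const), layer]
        nth_rewrite 1 [← ENNReal.rpow_one (α t)]
        rw [← ENNReal.rpow_add_of_nonneg _ _ (by norm_num) (by linarith)]; congr 1; ring


lemma layer_int (β k : ℝ → ℝ≥0∞) (hβ : Measurable β) (hk : Measurable k) :
    ∫⁻ s, β s * k s = ∫⁻ y in Ioi (0:ℝ), ∫⁻ s in {s | ENNReal.ofReal y < β s}, k s := by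
  have hmm : MeasurableSet {p : ℝ × ℝ | ENNReal.ofReal p.1 < β p.2} :=
    measurableSet_lt (by fun_prop) (by fun_prop)
  have : ∀ y : ℝ, ∫⁻ s in {s | ENNReal.ofReal y < β s}, k s
      = ∫⁻ s, (if ENNReal.ofReal y < β s then 1 else 0) * k s := by
    intro y
    have hms : MeasurableSet {t | ENNReal.ofReal y < β t} := measurableSet_lt (by fun_prop) (by fun_prop)
    rw [← lintegral_indicator hms]
    congr 1; ext t; simp [indicator]
  simp_rw [this]
  rw [lintegral_lintegral_swap (by
    refine Measurable.aemeasurable ?_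
    exact (Measurable.ite hmm measurable_const measurable_const).mul (by fun_prop))]
  congr 1; ext s
  rw [lintegral_mul_const _ (Measurable.ite (measurableSet_lt (by fun_prop) measurable_const) measurable_const measurable_const), layer]

lemma hls_norm {l a b : ℝ} (hl0 : 0 < l) (hl1 : l < 1) (ha : 1 < a) (hb : 1 < b)
    (hab : 1/a + 1/b + l = 2) : ∃ C : ℝ≥0∞, C ≠ ∞ ∧ ∀ α β : ℝ → ℝ≥0∞, Measurable α → Measurable β →
    ∫⁻ t, α t ^ a ≤ 1 → ∫⁻ t, β t ^ b ≤ 1 → 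
    ∫⁻ t, α t * ∫⁻ s, rk l (t - s) * β s ≤ C := by
  obtain ⟨C1, hC1, h1⟩ := hls_half hl0 hl1 ha hb hab
  obtain ⟨C2, hC2, h2⟩ := hls_half hl0 hl1 hb ha (by linarith)
  set K : ℝ≥0∞ := ENNReal.ofReal (2 / (1-l)) + 1 with hK
  have hKt : K ≠ ∞ := by simp [hK]
  refine ⟨K * C1 + K * C2, by finiteness, ?_⟩
  intro α β hα hβ hα1 hβ1
  have mk : Measurable (fun p : ℝ × ℝ => rk l (p.1 - p.2)) := (measurable_rk l).comp (by fun_prop)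
  have mk' : Measurable (fun p : ℝ × ℝ => rk l (p.2 - p.1)) := (measurable_rk l).comp (by fun_prop)
  set v : ℝ → ℝ≥0∞ := fun x => volume {t | ENNReal.ofReal x < α t} with hv
  set w : ℝ → ℝ≥0∞ := fun x => volume {t | ENNReal.ofReal x < β t} with hw
  have mv : Measurable v := by
    have : Antitone v := fun x y hxy => measure_mono fun t ht => lt_of_le_of_lt (ENNReal.ofReal_le_ofReal hxy) ht
    exact this.measurable
  have mw : Measurable w := by
    have : Antitone w := fun x y hxy => measure_mono fun t ht => lt_of_le_of_lt (ENNReal.ofReal_le_ofReal hxy) ht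
    exact this.measurable
  have mg : Measurable fun t => ∫⁻ s, rk l (t - s) * β s :=
    Measurable.lintegral_prod_right' (f := fun p : ℝ × ℝ => rk l (p.1 - p.2) * β p.2) (by fun_prop)
  rw [layer_int α _ hα mg]
  have e1 : ∀ x, ∫⁻ t in {t | ENNReal.ofReal x < α t}, ∫⁻ s, rk l (t - s) * β s
      = ∫⁻ y in Ioi (0:ℝ), ∫⁻ s in {s | ENNReal.ofReal y < β s}, ∫⁻ t in {t | ENNReal.ofReal x < α t}, rk l (t-s) := by
    intro x
    rw [lintegral_lintegral_swap (by exact Measurable.aemeasurable (by fun_prop))]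
    rw [← layer_int β _ hβ (Measurable.lintegral_prod_right' (f := fun p : ℝ × ℝ => rk l (p.2 - p.1)) mk')]
    congr 1; ext s
    rw [lintegral_mul_const (f := fun t => rk l (t - s)) _ (mk.comp measurable_prodMk_right), mul_comm]
  simp_rw [e1]
  have J1 : ∀ x y, ∫⁻ s in {s | ENNReal.ofReal y < β s}, ∫⁻ t in {t | ENNReal.ofReal x < α t}, rk l (t-s)
      ≤ K * (w y * v x ^ (1-l)) := by
    intro x y
    calc _ ≤ ∫⁻ s in {s | ENNReal.ofReal y < β s}, K * v x ^ (1-l) := by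
          refine lintegral_mono fun s => ?_
          refine le_trans (le_of_eq ?_) (hls_set hl0 hl1 s _)
          congr 1; ext t; rw [← rk_neg]; congr 1; ring
      _ = _ := by
          rw [lintegral_const, Measure.restrict_apply MeasurableSet.univ, univ_inter]; ring
  have J2 : ∀ x y, ∫⁻ s in {s | ENNReal.ofReal y < β s}, ∫⁻ t in {t | ENNReal.ofReal x < α t}, rk l (t-s)
      ≤ K * (v x * w y ^ (1-l)) := by
    intro x y
    rw [lintegral_lintegral_swap mk'.aemeasurable]
    calc _ ≤ ∫⁻ t in {t | ENNReal.ofReal x < α t}, K * w y ^ (1-l) := by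
          refine lintegral_mono fun s => ?_
          exact (hls_set hl0 hl1 s _)
      _ = _ := by
          rw [lintegral_const, Measure.restrict_apply MeasurableSet.univ, univ_inter]; ring
  have hb0 : 0 < b := by linarith
  have ha0 : 0 < a := by linarith
  have mset : MeasurableSet {p : ℝ × ℝ | p.1 < p.2 ^ (b/a)} := measurableSet_lt (by fun_prop) (by fun_prop)
  have mind : Measurable fun p : ℝ × ℝ => {p : ℝ × ℝ | p.1 < p.2 ^ (b/a)}.indicator (fun p => w p.2 * v p.1 ^ (1-l)) p :=
    Measurable.indicator (by fun_prop) mset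
  calc _ ≤ ∫⁻ x in Ioi (0:ℝ), ((K * (v x * ∫⁻ y in Ioo 0 (x ^ (a/b)), w y ^ (1-l)))
        + K * ∫⁻ y in Ioi (0:ℝ), {p : ℝ × ℝ | p.1 < p.2 ^ (b/a)}.indicator (fun p => w p.2 * v p.1 ^ (1-l)) (x,y)) := by
        refine setLIntegral_mono' measurableSet_Ioi fun x hx => ?_
        have hx : 0 < x := hx
        rw [← lintegral_const_mul _ (by fun_prop), ← lintegral_const_mul _ (by fun_prop),
          ← lintegral_const_mul' _ _ hKt,
          ← lintegral_indicator measurableSet_Ioo,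
          ← lintegral_indicator (measurableSet_Ioi (a := (0:ℝ))),
          ← lintegral_indicator (measurableSet_Ioi (a := (0:ℝ))), ← lintegral_add_left]
        · have hne : ∀ᵐ y : ℝ, y ≠ x ^ (a/b) := by
            simp [ae_iff]
          refine lintegral_mono_ae ?_
          filter_upwards [hne] with y hy
          by_cases hy0 : y ∈ Ioi (0:ℝ)
          · rw [indicator_of_mem hy0, indicator_of_mem hy0]
            have hy0 : 0 < y := hy0
            rcases lt_or_gt_of_ne hy with h | h
            · rw [indicator_of_mem (show y ∈ Ioo 0 (x ^ (a/b)) from ⟨hy0, h⟩)]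
              exact (J2 x y).trans le_self_add
            · have : x < y ^ (b/a) := by
                have := Real.rpow_lt_rpow (by positivity) h (show 0 < b/a by positivity)
                rw [← Real.rpow_mul hx.le] at this
                rwa [show a/b*(b/a) = 1 by field_simp, Real.rpow_one] at this
              have h3 : (x,y) ∈ {p : ℝ × ℝ | p.1 < p.2 ^ (b/a)} := this
              rw [indicator_of_mem h3]
              exact (J1 x y).trans le_add_self
          · rw [indicator_of_notMem hy0]; exact zero_le
        · exact Measurable.indicator (by fun_prop) measurableSet_Ioo
    _ ≤ K * (C1 * 1) + K * (C2 * 1) := by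
        rw [lintegral_add_right _ (by
          refine Measurable.const_mul ?_ _
          exact Measurable.lintegral_prod_right' mind)]
        refine add_le_add ?_ ?_
        · rw [lintegral_const_mul' _ _ hKt]
          gcongr
          refine (h1 v w mv mw ((layer_pow hb β hβ).trans hβ1)).trans ?_
          gcongr
          exact (layer_pow ha α hα).trans hα1
        · rw [lintegral_const_mul' _ _ hKt]
          gcongr
          rw [lintegral_lintegral_swap mind.aemeasurable]
          have h3 := h2 w v mw mv ((layer_pow ha α hα).trans hα1)
          refine le_trans ?_ (h3.trans (by gcongr; exact (layer_pow hb β hβ).trans hβ1))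
          refine setLIntegral_mono' measurableSet_Ioi fun y hy => ?_
          rw [← lintegral_const_mul _ (by fun_prop), ← lintegral_indicator measurableSet_Ioo,
            ← lintegral_indicator (measurableSet_Ioi (a := (0:ℝ)))]
          refine lintegral_mono fun x => ?_
          by_cases hx0 : x ∈ Ioi (0:ℝ)
          · rw [indicator_of_mem hx0]
            by_cases hxy : x < y ^ (b/a)
            · rw [indicator_of_mem (show (x,y) ∈ {p : ℝ × ℝ | p.1 < p.2 ^ (b/a)} from hxy),
                indicator_of_mem (show x ∈ Ioo 0 (y ^ (b/a)) from ⟨hx0, hxy⟩)]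
            · rw [indicator_of_notMem (show (x,y) ∉ {p : ℝ × ℝ | p.1 < p.2 ^ (b/a)} from hxy)]
              exact zero_le
          · rw [indicator_of_notMem hx0]; exact zero_le
    _ = _ := by ring

lemma hls {l a b : ℝ} (hl0 : 0 < l) (hl1 : l < 1) (ha : 1 < a) (hb : 1 < b)
    (hab : 1/a + 1/b + l = 2) : ∃ C : ℝ≥0∞, C ≠ ∞ ∧ ∀ α β : ℝ → ℝ≥0∞, Measurable α → Measurable β →
    ∫⁻ t, α t ^ a ≠ ∞ → ∫⁻ t, β t ^ b ≠ ∞ → 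
    ∫⁻ t, α t * ∫⁻ s, rk l (t - s) * β s
      ≤ C * ((∫⁻ t, α t ^ a) ^ (1/a) * (∫⁻ t, β t ^ b) ^ (1/b)) := by
  obtain ⟨C, hC, h⟩ := hls_norm hl0 hl1 ha hb hab
  refine ⟨C, hC, fun α β hα hβ hαt hβt => ?_⟩
  have hb0 : 0 < b := by linarith
  have ha0 : 0 < a := by linarith
  have mk : Measurable (fun p : ℝ × ℝ => rk l (p.1 - p.2)) := (measurable_rk l).comp (by fun_prop)
  have mg : Measurable fun t => ∫⁻ s, rk l (t - s) * β s :=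
    Measurable.lintegral_prod_right' (f := fun p : ℝ × ℝ => rk l (p.1 - p.2) * β p.2) (by fun_prop)
  rcases eq_or_ne (∫⁻ t, α t ^ a) 0 with h0 | h0
  · rw [lintegral_eq_zero_iff (by fun_prop)] at h0
    have : ∫⁻ t, α t * ∫⁻ s, rk l (t - s) * β s = 0 := by
      rw [lintegral_eq_zero_iff (by fun_prop)]
      filter_upwards [h0] with t ht
      have : α t = 0 := by simpa [ha0, ha0.not_gt] using ht
      simp [this]
    rw [this]; exact zero_le
  rcases eq_or_ne (∫⁻ t, β t ^ b) 0 with h0' | h0'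
  · rw [lintegral_eq_zero_iff (by fun_prop)] at h0'
    have : ∀ t, ∫⁻ s, rk l (t - s) * β s = 0 := by
      intro t
      rw [lintegral_eq_zero_iff (by have := mk.comp (measurable_prodMk_left (x := t)); exact this.mul hβ)]
      filter_upwards [h0'] with t ht
      have : β t = 0 := by simpa [hb0, hb0.not_gt] using ht
      simp [this]
    simp [this]
  set A := (∫⁻ t, α t ^ a) ^ (1/a) with hA
  set B := (∫⁻ t, β t ^ b) ^ (1/b) with hB
  have hA0 : A ≠ 0 := by simp [hA, h0, hαt, ha0, ha0.not_gt]
  have hB0 : B ≠ 0 := by simp [hB, h0', hβt, hb0, hb0.not_gt]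
  have hAt : A ≠ ∞ := ENNReal.rpow_ne_top_of_nonneg (by positivity) hαt
  have hBt : B ≠ ∞ := ENNReal.rpow_ne_top_of_nonneg (by positivity) hβt
  have nrm : ∀ (c : ℝ) (f : ℝ → ℝ≥0∞), 0 < c → Measurable f → ∫⁻ t, f t ^ c ≠ 0 → ∫⁻ t, f t ^ c ≠ ∞ →
      ∫⁻ t, (f t * ((∫⁻ t, f t ^ c) ^ (1/c))⁻¹) ^ c ≤ 1 := by
    intro c f hc hf hf0 hft
    simp_rw [ENNReal.mul_rpow_of_nonneg _ _ hc.le]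
    rw [lintegral_mul_const _ (by fun_prop), ENNReal.inv_rpow, ← ENNReal.rpow_mul,
      one_div_mul_cancel hc.ne', ENNReal.rpow_one, ENNReal.mul_inv_cancel hf0 hft]
  have := h (fun t => α t * A⁻¹) (fun t => β t * B⁻¹) (by fun_prop) (by fun_prop)
    (nrm a α ha0 hα h0 hαt) (nrm b β hb0 hβ h0' hβt)
  have e : ∫⁻ t, α t * A⁻¹ * ∫⁻ s, rk l (t - s) * (β s * B⁻¹)
      = (∫⁻ t, α t * ∫⁻ s, rk l (t - s) * β s) * (A⁻¹ * B⁻¹) := by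
    rw [← lintegral_mul_const _ (by fun_prop)]
    congr 1; ext t
    have : ∫⁻ s, rk l (t - s) * (β s * B⁻¹) = (∫⁻ s, rk l (t - s) * β s) * B⁻¹ := by
      rw [← lintegral_mul_const' _ _ (by simp [hB0])]
      congr 1; ext s; ring
    rw [this]; ring
  rw [e, ← ENNReal.mul_inv (Or.inl hA0) (Or.inl hAt), ← div_eq_mul_inv,
    ENNReal.div_le_iff (by simp [hA0, hB0]) (by finiteness)] at this
  exact this

end ANS

namespace ANS

attribute [fun_prop] measurable_rk

lemma dual_bound {s s' : ℝ} (hs : s.HolderConjugate s') (I : Set ℝ) (hI : MeasurableSet I)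
    (hIf : volume I ≠ ∞) (F : ℝ → ℝ≥0∞) (hF : Measurable F) (c : ℝ≥0∞)
    (h : ∀ α : ℝ → ℝ≥0∞, Measurable α → ∫⁻ t, α t ^ s' ≠ ∞ →
      ∫⁻ t, α t * F t ≤ c * (∫⁻ t, α t ^ s') ^ (1/s')) :
    (∫⁻ t in I, F t ^ s) ^ (1/s) ≤ c := by
  have hs0 : 0 < s := hs.pos
  have hs1 : 1 < s := hs.lt
  have hs0' : 0 < s' := hs.symm.pos
  have key : ∀ K : ℕ, (∫⁻ t in I, (min (F t) K) ^ s) ^ (1/s) ≤ c := by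
    intro K
    set X := ∫⁻ t in I, (min (F t) K) ^ s with hX
    have hXf : X ≠ ∞ := by
      refine ne_of_lt (lt_of_le_of_lt (lintegral_mono (g := fun _ => (K:ℝ≥0∞) ^ s) fun t => ?_) ?_)
      · exact ENNReal.rpow_le_rpow (min_le_right _ _) hs0.le
      · rw [lintegral_const, Measure.restrict_apply MeasurableSet.univ, univ_inter]
        exact ENNReal.mul_lt_top (ENNReal.rpow_lt_top_of_nonneg hs0.le (by simp)) hIf.lt_top
    rcases eq_or_ne X 0 with h0 | h0
    · rw [h0, ENNReal.zero_rpow_of_pos (by positivity)]; exact zero_le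
    have e1 : ∫⁻ t, (I.indicator (fun t => (min (F t) K) ^ (s-1)) t) ^ s' = X := by
      rw [hX, ← lintegral_indicator hI]
      congr 1; ext t
      by_cases ht : t ∈ I
      · rw [indicator_of_mem ht, indicator_of_mem ht, ← ENNReal.rpow_mul, hs.sub_one_mul_conj]
      · rw [indicator_of_notMem ht, indicator_of_notMem ht, ENNReal.zero_rpow_of_pos hs0']
    have h1 := h (I.indicator fun t => (min (F t) K) ^ (s-1))
      (Measurable.indicator (by fun_prop) hI) (by rw [e1]; exact hXf)
    rw [e1] at h1
    have h2 : X ≤ c * X ^ (1/s') := by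
      refine le_trans ?_ h1
      rw [hX, ← lintegral_indicator hI]
      refine lintegral_mono fun t => ?_
      by_cases ht : t ∈ I
      · rw [indicator_of_mem ht, indicator_of_mem ht]
        calc (min (F t) K) ^ s = (min (F t) K) ^ (s-1) * (min (F t) K) := by
              nth_rewrite 3 [← ENNReal.rpow_one (min (F t) K)]
              rw [← ENNReal.rpow_add_of_nonneg _ _ (by linarith) (by norm_num)]; congr 1; ring
          _ ≤ _ := by gcongr; exact min_le_left _ _
      · rw [indicator_of_notMem ht]; exact zero_le
    have h3 : X = X ^ (1/s) * X ^ (1/s') := by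
      rw [← ENNReal.rpow_add _ _ h0 hXf]
      have := hs.inv_add_inv_eq_one
      simp only [one_div]; rw [this, ENNReal.rpow_one]
    nth_rewrite 1 [h3] at h2
    exact (ENNReal.mul_le_mul_iff_left (by simp [h0, hXf])
      (ENNReal.rpow_ne_top_of_nonneg (by positivity) hXf)).1 h2
  have hsup : ∫⁻ t in I, F t ^ s = ⨆ K : ℕ, ∫⁻ t in I, (min (F t) K) ^ s := by
    rw [← lintegral_iSup (fun K => by fun_prop)]
    · congr 1; ext t
      apply le_antisymm
      · rcases eq_or_ne (F t) ∞ with ht | ht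
        · simp only [ht, min_eq_right le_top]
          rw [ENNReal.top_rpow_of_pos hs0, top_le_iff, iSup_eq_top]
          intro b hb
          obtain ⟨n, hn⟩ := ENNReal.exists_nat_gt hb.ne
          refine ⟨n+1, hn.trans_le ?_⟩
          calc (n:ℝ≥0∞) ≤ ((n+1:ℕ):ℝ≥0∞) ^ (1:ℝ) := by rw [ENNReal.rpow_one]; gcongr; omega
            _ ≤ _ := ENNReal.rpow_le_rpow_of_exponent_le (by simp) hs1.le
        · obtain ⟨n, hn⟩ := ENNReal.exists_nat_gt ht
          refine le_iSup_of_le n ?_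
          rw [min_eq_left hn.le]
      · refine iSup_le fun K => ?_
        gcongr; exact min_le_left _ _
    · intro i j hij t
      simp only
      gcongr
  rw [hsup, one_div, ENNReal.rpow_inv_le_iff hs0]
  refine iSup_le fun K => ?_
  have := key K
  rwa [one_div, ENNReal.rpow_inv_le_iff hs0] at this

/-- trilinear form bound -/
lemma tri {p : ℝ} (hp : 2 < p) : ∃ C : ℝ≥0∞, C ≠ ∞ ∧ ∀ α n h : ℝ → ℝ≥0∞, Measurable α → Measurable n →
    Measurable h → ∫⁻ t, α t ^ (6/5:ℝ) ≠ ∞ → ∫⁻ t, n t ^ p ≠ ∞ → ∫⁻ t, h t ^ (6:ℝ) ≠ ∞ →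
    ∫⁻ t, α t * ∫⁻ s, rk (1-1/p) (t - s) * (n s * h s)
      ≤ C * ((∫⁻ t, α t ^ (6/5:ℝ)) ^ (1/(6/5:ℝ)) * ((∫⁻ t, n t ^ p) ^ (1/p) * (∫⁻ t, h t ^ (6:ℝ)) ^ (1/6:ℝ))) := by
  have hp0 : 0 < p := by linarith
  have hip : 1/p < 1/2 := by gcongr
  have hip0 : 0 < 1/p := by positivity
  set b := 1 / (1/p + 1/6) with hb
  have hb1 : 1/b = 1/p + 1/6 := by rw [hb, one_div_one_div]
  have hbgt : 1 < b := by rw [hb, lt_div_iff₀ (by positivity)]; linarith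
  obtain ⟨C, hC, h⟩ := hls (l := 1 - 1/p) (a := 6/5) (b := b) (by linarith) (by linarith) (by norm_num) hbgt
    (by rw [hb1]; ring)
  refine ⟨C, hC, fun α n h' hα hn hh hαt hnt hht => ?_⟩
  have hH := ENNReal.lintegral_Lp_mul_le_Lq_mul_Lr (p := b) (q := p) (r := 6) (by linarith)
    (by rw [hb, div_lt_iff₀ (by positivity)]; have : p * (1/p) = 1 := by field_simp
        nlinarith) hb1 volume hn.aemeasurable hh.aemeasurable
  have hfin : ∫⁻ t, (n t * h' t) ^ b ≠ ∞ := by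
    intro htop
    simp only [Pi.mul_apply] at hH
    rw [htop, ENNReal.top_rpow_of_pos (by positivity), top_le_iff] at hH
    exact ENNReal.mul_ne_top (ENNReal.rpow_ne_top_of_nonneg (by positivity) hnt)
      (ENNReal.rpow_ne_top_of_nonneg (by positivity) hht) hH
  refine (h α (fun s => n s * h' s) hα (by fun_prop) hαt hfin).trans ?_
  gcongr
  exact hH

lemma T_bound {p : ℝ} (hp : 2 < p) : ∃ C : ℝ≥0∞, C ≠ ∞ ∧ ∀ I : Set ℝ, MeasurableSet I → volume I ≠ ∞ →
    ∀ n : ℝ → ℝ≥0∞, Measurable n → (∀ t ∉ I, n t = 0) → ∫⁻ t, n t ^ p ≠ ∞ →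
    (∀ h : ℝ → ℝ≥0∞, Measurable h → ∫⁻ t in I, h t ^ (6:ℝ) ≠ ∞ →
      (∫⁻ t in I, (∫⁻ s, rk (1-1/p) (t-s) * (n s * h s)) ^ (6:ℝ)) ^ (1/6:ℝ)
        ≤ C * (∫⁻ t, n t ^ p) ^ (1/p) * (∫⁻ t in I, h t ^ (6:ℝ)) ^ (1/6:ℝ)) ∧
    (∀ γ : ℝ → ℝ≥0∞, Measurable γ → ∫⁻ t, γ t ^ (6/5:ℝ) ≠ ∞ →
      (∫⁻ t in I, (n t * ∫⁻ s, rk (1-1/p) (t-s) * γ s) ^ (6/5:ℝ)) ^ (1/(6/5):ℝ)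
        ≤ C * (∫⁻ t, n t ^ p) ^ (1/p) * (∫⁻ t, γ t ^ (6/5:ℝ)) ^ (1/(6/5):ℝ)) := by
  obtain ⟨C, hC, h⟩ := tri hp
  have hrk : Measurable fun z : ℝ × ℝ => rk (1-1/p) (z.1 - z.2) :=
    (measurable_rk _).comp (measurable_fst.sub measurable_snd)
  refine ⟨C, hC, fun I hI hIf n hn hn0 hnp => ⟨fun h' hh hhf => ?_, fun γ hγ hγf => ?_⟩⟩
  · have hind : ∫⁻ t, (I.indicator h' t) ^ (6:ℝ) = ∫⁻ t in I, h' t ^ (6:ℝ) := by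
      rw [← lintegral_indicator hI]
      congr 1; ext t
      by_cases ht : t ∈ I <;> simp [ht]
    refine dual_bound (s := 6) (s' := 6/5) (Real.holderConjugate_iff.2 ⟨by norm_num, by norm_num⟩)
      I hI hIf _ ?_ _ fun α hα hαf => ?_
    · exact Measurable.lintegral_prod_right' (f := fun z : ℝ × ℝ => rk (1-1/p) (z.1 - z.2) * (n z.2 * h' z.2))
        (by fun_prop)
    · have := h α n (I.indicator h') hα hn (hh.indicator hI) hαf hnp (by rw [hind]; exact hhf)
      rw [hind] at this
      have e : ∀ s, n s * I.indicator h' s = n s * h' s := by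
        intro s
        by_cases hs : s ∈ I <;> simp [hs, hn0]
      simp only [e] at this
      refine this.trans (le_of_eq ?_)
      ring
  · refine dual_bound (s := 6/5) (s' := 6) (Real.holderConjugate_iff.2 ⟨by norm_num, by norm_num⟩)
      I hI hIf _ ?_ _ fun α hα hαf => ?_
    · exact hn.mul (Measurable.lintegral_prod_right' (f := fun z : ℝ × ℝ => rk (1-1/p) (z.1 - z.2) * γ z.2)
        (by fun_prop))
    · have := h γ n α hγ hn hα hγf hnp hαf
      calc ∫⁻ t, α t * (n t * ∫⁻ s, rk (1-1/p) (t-s) * γ s)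
          = ∫⁻ t, ∫⁻ s, (α t * n t) * (rk (1-1/p) (t-s) * γ s) := by
            refine lintegral_congr fun t => ?_
            rw [lintegral_const_mul _ (by fun_prop)]; ring
        _ = ∫⁻ s, ∫⁻ t, (α t * n t) * (rk (1-1/p) (t-s) * γ s) := by
            rw [lintegral_lintegral_swap]
            apply Measurable.aemeasurable; simp only [Function.uncurry_def]; fun_prop
        _ = ∫⁻ s, γ s * ∫⁻ t, rk (1-1/p) (s-t) * (n t * α t) := by
            refine lintegral_congr fun s => ?_
            rw [← lintegral_const_mul _ (by fun_prop)]
            refine lintegral_congr fun t => ?_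
            rw [← rk_neg, neg_sub]; ring
        _ ≤ _ := this
        _ = _ := by ring
end ANS

namespace ANS

/-- iterates of the supersolution scheme -/
def Hit (l : ℝ) (n : ℝ → ℝ≥0∞) : ℕ → ℝ → ℝ≥0∞
  | 0 => fun _ => 0
  | (N+1) => fun t => 1 + ∫⁻ s, rk l (t-s) * (n s * Hit l n N s)

lemma Hit_meas (l : ℝ) (n : ℝ → ℝ≥0∞) (hn : Measurable n) (N : ℕ) : Measurable (Hit l n N) := by
  induction N with
  | zero => exact measurable_const
  | succ N ih =>
    exact measurable_const.add (Measurable.lintegral_prod_right'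
      (f := fun z : ℝ × ℝ => rk l (z.1 - z.2) * (n z.2 * Hit l n N z.2)) (by fun_prop))

lemma Hit_mono (l : ℝ) (n : ℝ → ℝ≥0∞) (N : ℕ) (t : ℝ) : Hit l n N t ≤ Hit l n (N+1) t := by
  induction N generalizing t with
  | zero => exact zero_le
  | succ N ih =>
    show 1 + _ ≤ 1 + _
    refine add_le_add le_rfl (lintegral_mono fun s => ?_)
    exact mul_le_mul_right (mul_le_mul_right (ih s) _) _

lemma time_iter {p : ℝ} (hp : 2 < p) : ∃ ε : ℝ≥0∞, ε ≠ 0 ∧ ∀ I : Set ℝ, MeasurableSet I → volume I ≠ ∞ →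
    ∀ n : ℝ → ℝ≥0∞, Measurable n → (∀ t ∉ I, n t = 0) → (∫⁻ t, n t ^ p) ^ (1/p) ≤ ε →
    (∃ H : ℝ → ℝ≥0∞, Measurable H ∧ ∫⁻ t in I, H t ^ (6:ℝ) ≠ ∞ ∧
      ∀ t, 1 + ∫⁻ s, rk (1-1/p) (t-s) * (n s * H s) ≤ H t) ∧
    (∀ γ : ℕ → ℝ → ℝ≥0∞, (∀ N, Measurable (γ N)) → (∀ N, ∀ t ∉ I, γ N t = 0) →
      ∫⁻ t, γ 0 t ^ (6/5:ℝ) ≠ ∞ →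
      (∀ N t, γ (N+1) t ≤ n t * ∫⁻ s, rk (1-1/p) (t-s) * γ N s) →
      Tendsto (fun N => ∫⁻ t, γ N t) atTop (nhds 0)) := by
  obtain ⟨C, hC, hT⟩ := T_bound hp
  have hp0 : 0 < p := by linarith
  refine ⟨(2 * (C + 1))⁻¹, by simp [hC, ENNReal.mul_eq_top], fun I hI hIf n hn hn0 hnp => ?_⟩
  have hsm : C * (∫⁻ t, n t ^ p) ^ (1/p) ≤ 2⁻¹ := by
    calc C * (∫⁻ t, n t ^ p) ^ (1/p) ≤ (C+1) * (2 * (C + 1))⁻¹ := by gcongr; exact le_self_add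
      _ = 2⁻¹ := by
        rw [ENNReal.mul_inv (by simp) (by simp), mul_comm, mul_assoc, ENNReal.inv_mul_cancel (by simp) (by simp [hC]), mul_one]
  have hnf : ∫⁻ t, n t ^ p ≠ ∞ := by
    intro h
    rw [h, ENNReal.top_rpow_of_pos (by positivity), top_le_iff, ENNReal.inv_eq_top] at hnp
    simp at hnp
  obtain ⟨h1, h2⟩ := hT I hI hIf n hn hn0 hnf
  constructor
  · set l := 1 - 1/p
    set H : ℕ → ℝ → ℝ≥0∞ := Hit l n with hH
    have hm := Hit_meas l n hn
    have hmono : Monotone H := monotone_nat_of_le_succ fun N t => Hit_mono l n N t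
    have hb : ∀ N, (∫⁻ t in I, H N t ^ (6:ℝ)) ^ (1/6:ℝ) ≤ 2 * (volume I) ^ (1/6:ℝ) := by
      intro N
      induction N with
      | zero => simp [hH, Hit]
      | succ N ih =>
        have hfin : ∫⁻ t in I, H N t ^ (6:ℝ) ≠ ∞ := by
          intro h
          rw [h, ENNReal.top_rpow_of_pos (by positivity), top_le_iff] at ih
          exact ENNReal.mul_ne_top (by simp) (ENNReal.rpow_ne_top_of_nonneg (by positivity) hIf) ih
        have h3 := ENNReal.lintegral_Lp_add_le (μ := volume.restrict I) (p := 6) (f := fun _ => 1)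
          (g := fun t => ∫⁻ s, rk l (t-s) * (n s * H N s)) (by fun_prop)
          (Measurable.aemeasurable (Measurable.lintegral_prod_right'
            (f := fun z : ℝ × ℝ => rk l (z.1 - z.2) * (n z.2 * Hit l n N z.2))
              (by have := hm N; fun_prop))) (by norm_num)
        refine h3.trans ?_
        simp only [one_rpow, lintegral_const, Measure.restrict_apply MeasurableSet.univ, univ_inter, one_mul]
        calc (volume I) ^ (1/6:ℝ) + _ ≤ (volume I) ^ (1/6:ℝ) + 2⁻¹ * (2 * (volume I) ^ (1/6:ℝ)) := by
              gcongr
              refine (h1 _ (hm N) hfin).trans ?_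
              gcongr
          _ = _ := by
            rw [← mul_assoc, ENNReal.inv_mul_cancel (by simp) (by simp), one_mul, two_mul]
    refine ⟨fun t => ⨆ N, H N t, Measurable.iSup hm, ?_, fun t => ?_⟩
    · have e : ∀ t, (⨆ N, H N t) ^ (6:ℝ) = ⨆ N, H N t ^ (6:ℝ) := fun t =>
        (ENNReal.orderIsoRpow 6 (by norm_num)).map_iSup _
      simp only [e]
      rw [lintegral_iSup (fun N => by have := hm N; fun_prop)]
      · refine ne_of_lt (lt_of_le_of_lt (b := (2 * (volume I) ^ (1/6:ℝ)) ^ (6:ℝ)) (iSup_le fun N => ?_) ?_)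
        · have := hb N
          rw [one_div, ENNReal.rpow_inv_le_iff (by norm_num)] at this
          rwa [one_div]
        · exact ENNReal.rpow_lt_top_of_nonneg (by norm_num) (ENNReal.mul_ne_top (by simp) (ENNReal.rpow_ne_top_of_nonneg (by positivity) hIf))
      · intro i j hij t
        exact ENNReal.rpow_le_rpow (hmono hij t) (by norm_num)
    · simp only [ENNReal.mul_iSup]
      rw [lintegral_iSup (fun N => by have := hm N; fun_prop), ENNReal.add_iSup]
      · exact iSup_le fun N => le_iSup (fun N => H N t) (N+1)
      · intro i j hij s
        exact mul_le_mul_right (mul_le_mul_right (hmono hij s) _) _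
  · intro γ hγ hγ0 hγf hrec
    set G : ℕ → ℝ≥0∞ := fun N => (∫⁻ t, γ N t ^ (6/5:ℝ)) ^ (1/(6/5):ℝ) with hG
    have hres : ∀ N, ∫⁻ t, γ N t ^ (6/5:ℝ) = ∫⁻ t in I, γ N t ^ (6/5:ℝ) := by
      intro N
      rw [← lintegral_indicator hI]
      congr 1; ext t
      by_cases ht : t ∈ I <;> simp [ht, hγ0]
    have hGf : G 0 ≠ ∞ := ENNReal.rpow_ne_top_of_nonneg (by positivity) hγf
    have hGb : ∀ N, G N ≤ 2⁻¹ ^ N * G 0 := by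
      intro N
      induction N with
      | zero => simp
      | succ N ih =>
        have hf : ∫⁻ t, γ N t ^ (6/5:ℝ) ≠ ∞ := by
          intro h
          simp only [hG] at ih hGf
          rw [h, ENNReal.top_rpow_of_pos (by positivity), top_le_iff] at ih
          exact ENNReal.mul_ne_top (ENNReal.pow_ne_top (by simp)) hGf ih
        calc G (N+1) = (∫⁻ t in I, γ (N+1) t ^ (6/5:ℝ)) ^ (1/(6/5):ℝ) := by simp only [hG]; rw [hres]
          _ ≤ (∫⁻ t in I, (n t * ∫⁻ s, rk (1-1/p) (t-s) * γ N s) ^ (6/5:ℝ)) ^ (1/(6/5):ℝ) := by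
            gcongr with t; exact hrec N t
          _ ≤ _ := h2 _ (hγ N) hf
          _ ≤ 2⁻¹ * (2⁻¹ ^ N * G 0) := by gcongr
          _ = _ := by rw [pow_succ]; ring
    have hle : ∀ N, ∫⁻ t, γ N t ≤ (2⁻¹ ^ N) * (G 0 * (volume I) ^ (1/6:ℝ)) := by
      intro N
      have h3 := ENNReal.lintegral_mul_le_Lp_mul_Lq (volume.restrict I) (p := 6/5) (q := 6)
        (Real.holderConjugate_iff.2 ⟨by norm_num, by norm_num⟩) (f := γ N) (g := fun _ => 1)
        (hγ N).aemeasurable (by fun_prop)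
      simp only [Pi.mul_apply, mul_one, one_rpow, lintegral_const, Measure.restrict_apply MeasurableSet.univ, univ_inter, one_mul] at h3
      have e : ∫⁻ t, γ N t = ∫⁻ t in I, γ N t := by
        rw [← lintegral_indicator hI]
        congr 1; ext t
        by_cases ht : t ∈ I <;> simp [ht, hγ0]
      rw [e]
      refine h3.trans ?_
      rw [← hres, ← mul_assoc]
      gcongr
      exact hGb N
    refine tendsto_of_tendsto_of_tendsto_of_le_of_le tendsto_const_nhds ?_ (fun _ => zero_le) hle
    have h4 : Tendsto (fun N : ℕ => (2⁻¹:ℝ≥0∞) ^ N) atTop (nhds 0) :=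
      ENNReal.tendsto_pow_atTop_nhds_zero_of_lt_one (by simp)
    have := ENNReal.Tendsto.mul_const (b := G 0 * (volume I) ^ (1/6:ℝ)) h4
      (Or.inr (ENNReal.mul_ne_top hGf (ENNReal.rpow_ne_top_of_nonneg (by positivity) hIf)))
    simpa using this
end ANS

namespace ANS

lemma lint_E3 (f : E3 → ℝ≥0∞) (hf : Measurable f) :
    ∫⁻ y, f y = ∫⁻ x3, ∫⁻ x2, ∫⁻ x1, f (pt3 x1 x2 x3) := by
  have h1 := (EuclideanSpace.volume_preserving_symm_measurableEquiv_toLp (Fin 3)).symm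
  have h2 := (volume_preserving_piFinSuccAbove (fun _ : Fin 3 => ℝ) 2).symm
  have h3 := (volume_preserving_finTwoArrow ℝ).symm
  have m1 : Measurable fun a => f ((MeasurableEquiv.toLp 2 (Fin 3 → ℝ)).symm.symm a) :=
    hf.comp (MeasurableEquiv.measurable _)
  have m2 : Measurable fun a => f ((MeasurableEquiv.toLp 2 (Fin 3 → ℝ)).symm.symm
      ((MeasurableEquiv.piFinSuccAbove (fun _ : Fin 3 => ℝ) 2).symm a)) :=
    m1.comp (MeasurableEquiv.measurable _)
  rw [← h1.lintegral_comp hf, ← h2.lintegral_comp m1]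
  rw [Measure.volume_eq_prod, lintegral_prod _ m2.aemeasurable]
  refine lintegral_congr fun x3 => ?_
  have m3 := m2.comp (measurable_prodMk_left (x := x3))
  have m4 := m3.comp (MeasurableEquiv.finTwoArrow (α := ℝ)).symm.measurable
  have h4 := h3.lintegral_comp m3
  simp only [Function.comp_def] at h4 m4
  rw [← h4, Measure.volume_eq_prod, lintegral_prod_symm _ m4.aemeasurable]
  refine lintegral_congr fun x2 => lintegral_congr fun x1 => ?_
  congr 1
  unfold pt3
  ext i
  fin_cases i <;> rfl

lemma measurable_pt3 : Measurable fun z : ℝ × ℝ × ℝ => pt3 z.1 z.2.1 z.2.2 := by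
  unfold pt3
  refine (MeasurableEquiv.toLp 2 (Fin 3 → ℝ)).measurable.comp (measurable_pi_iff.2 fun i => ?_)
  fin_cases i <;> simp <;> fun_prop

/-- iterated norm of an extended nonnegative function -/
def An (q1 q2 q3 : ℝ) (g : E3 → ℝ≥0∞) : ℝ≥0∞ :=
  (∫⁻ x3 : ℝ, (∫⁻ x2 : ℝ, (∫⁻ x1 : ℝ, g (pt3 x1 x2 x3) ^ q1) ^ (q2 / q1)) ^ (q3 / q2)) ^ (1 / q3)

/-- one-dimensional majorant of the kernel -/
def kap (τ x : ℝ) : ℝ≥0∞ := min (ENNReal.ofReal |τ| ^ (-(2/3):ℝ)) (ENNReal.ofReal |x| ^ (-(4/3):ℝ))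

lemma measurable_kap (τ : ℝ) : Measurable (kap τ) := by unfold kap; fun_prop

lemma kap_int {e : ℝ} (he : 1 ≤ e) : ∃ c : ℝ≥0∞, c ≠ ∞ ∧ ∀ τ : ℝ, τ ≠ 0 → ∀ a : ℝ,
    ∫⁻ x, kap τ (a - x) ^ e = c * ENNReal.ofReal |τ| ^ (-(2/3)*e+1/2) := by
  have he0 : 0 < e := by linarith
  refine ⟨∫⁻ x, kap 1 x ^ e, ?_, ?_⟩
  · have hfin := finite_integral_one_add_norm (E := ℝ) (μ := volume) (r := 4/3*e) (by simp; linarith)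
    refine ne_of_lt (lt_of_le_of_lt (b := ∫⁻ x : ℝ, ENNReal.ofReal (2 ^ (4/3*e)) * ENNReal.ofReal ((1+‖x‖)^(-(4/3*e)))) (lintegral_mono fun x => ?_) ?_)
    · rw [← ENNReal.ofReal_mul (by positivity)]
      have h1 : 2 ^ (4/3*e) * (1+‖x‖)^(-(4/3*e)) = (((1+|x|)/2) ^ (-(4/3):ℝ))^e := by
        rw [← Real.rpow_mul (by positivity), Real.div_rpow (by positivity) (by norm_num), Real.norm_eq_abs]
        rw [show -(4/3) * e = -(4/3*e) by ring, Real.rpow_neg (x := 2) (by norm_num), div_inv_eq_mul, mul_comm]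
      rw [h1, ← ENNReal.ofReal_rpow_of_nonneg (by positivity) he0.le]
      refine ENNReal.rpow_le_rpow ?_ he0.le
      unfold kap
      rw [← ENNReal.ofReal_rpow_of_pos (by positivity)]
      rcases le_total |x| 1 with h | h
      · refine (min_le_left _ _).trans ?_
        rw [ENNReal.rpow_neg, ENNReal.rpow_neg]
        gcongr
        have : ENNReal.ofReal ((1 + |x|) / 2) ≤ 1 := by simp; linarith
        rw [abs_one, ENNReal.ofReal_one, ENNReal.one_rpow]
        exact ENNReal.rpow_le_one this (by norm_num)
      · refine (min_le_right _ _).trans ?_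
        rw [ENNReal.rpow_neg, ENNReal.rpow_neg]
        gcongr
        linarith
    · rw [lintegral_const_mul' _ _ (by simp)]
      exact ENNReal.mul_lt_top (by simp) hfin
  · intro τ hτ a
    have hT : 0 < |τ| := abs_pos.2 hτ
    have e1 : ∫⁻ x, kap τ (a - x) ^ e = ∫⁻ x, kap τ x ^ e :=
      lintegral_sub_left_eq_self (fun x => kap τ x ^ e) a
    set r := |τ| ^ (1/2:ℝ) with hr
    have hr0 : 0 < r := by positivity
    have hT0 : ENNReal.ofReal |τ| ≠ 0 := by simpa using hτ
    have hT1 : ENNReal.ofReal |τ| ≠ ∞ := by simp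
    have hr1 : ENNReal.ofReal r = ENNReal.ofReal |τ| ^ (1/2:ℝ) := (ENNReal.ofReal_rpow_of_pos hT).symm
    have e2 : ∀ x, kap τ (r * x) = ENNReal.ofReal |τ| ^ (-(2/3):ℝ) * kap 1 x := by
      intro x
      unfold kap
      rw [Monotone.map_min (f := fun w => ENNReal.ofReal |τ| ^ (-(2/3):ℝ) * w) (fun _ _ h => mul_le_mul_right h _)]
      congr 1
      · simp
      · rw [abs_mul, abs_of_pos hr0, ENNReal.ofReal_mul hr0.le, hr1]
        rw [ENNReal.mul_rpow_of_ne_top (by simp) (by simp), ← ENNReal.rpow_mul]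
        congr 2; norm_num
    have e3 : ∫⁻ x, kap τ (r * x) ^ e = ENNReal.ofReal |r⁻¹| * ∫⁻ x, kap τ x ^ e := by
      rw [← lintegral_map (f := fun x => kap τ x ^ e) (g := fun x => r * x)
        ((measurable_kap τ).pow_const e) (by fun_prop), Real.map_volume_mul_left hr0.ne', lintegral_smul_measure]
      rfl
    have e4 : ∫⁻ x, kap τ (r * x) ^ e = ENNReal.ofReal |τ| ^ (-(2/3)*e) * ∫⁻ x, kap 1 x ^ e := by
      simp only [e2]
      rw [← lintegral_const_mul' _ _ (ENNReal.rpow_ne_top_of_ne_zero hT0 hT1)]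
      refine lintegral_congr fun x => ?_
      rw [ENNReal.mul_rpow_of_nonneg _ _ he0.le, ← ENNReal.rpow_mul]
    rw [e1]
    rw [e4, abs_of_pos (inv_pos.2 hr0), ENNReal.ofReal_inv_of_pos hr0, hr1] at e3
    have h0 : ENNReal.ofReal |τ| ^ (1/2:ℝ) ≠ 0 := by simp [hτ]
    have h1 : ENNReal.ofReal |τ| ^ (1/2:ℝ) ≠ ∞ := by simp
    rw [ENNReal.rpow_add _ _ hT0 hT1, mul_comm, mul_assoc, mul_comm, mul_assoc, mul_comm _ (ENNReal.ofReal |τ| ^ (-(2/3)*e)), e3]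
    rw [← mul_assoc, ENNReal.mul_inv_cancel h0 h1, one_mul]

lemma holder3 {q1 q2 q3 : ℝ} {r1 r2 r3 : ℝ} (h1 : q1.HolderConjugate r1) (h2 : q2.HolderConjugate r2)
    (h3 : q3.HolderConjugate r3) (k1 k2 k3 : ℝ → ℝ≥0∞) (m1 : Measurable k1) (m2 : Measurable k2)
    (m3 : Measurable k3) (g : E3 → ℝ≥0∞) (hg : Measurable g) :
    ∫⁻ x3, ∫⁻ x2, ∫⁻ x1, (k1 x1 * k2 x2 * k3 x3) * g (pt3 x1 x2 x3)
      ≤ ((∫⁻ x, k1 x ^ r1) ^ (1/r1) * (∫⁻ x, k2 x ^ r2) ^ (1/r2) * (∫⁻ x, k3 x ^ r3) ^ (1/r3)) *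
        An q1 q2 q3 g := by
  have hgm : Measurable fun z : ℝ × ℝ × ℝ => g (pt3 z.1 z.2.1 z.2.2) := hg.comp measurable_pt3
  have hg2 : ∀ x3, Measurable fun z : ℝ × ℝ => g (pt3 z.2 z.1 x3) := fun x3 =>
    hgm.comp (by fun_prop : Measurable fun z : ℝ × ℝ => (z.2, z.1, x3))
  have hg3 : Measurable fun z : (ℝ × ℝ) × ℝ => g (pt3 z.2 z.1.2 z.1.1) :=
    hgm.comp (by fun_prop : Measurable fun z : (ℝ × ℝ) × ℝ => (z.2, z.1.2, z.1.1))
  have hg1 : ∀ x3 x2, Measurable fun x1 : ℝ => g (pt3 x1 x2 x3) := fun x3 x2 =>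
    hgm.comp (by fun_prop : Measurable fun x1 : ℝ => (x1, x2, x3))
  have hI1 : Measurable fun z : ℝ × ℝ => ∫⁻ x1, g (pt3 x1 z.2 z.1) ^ q1 :=
    Measurable.lintegral_prod_right' (f := fun z : (ℝ × ℝ) × ℝ => g (pt3 z.2 z.1.2 z.1.1) ^ q1) (hg3.pow_const _)
  have hI2 : Measurable fun x3 : ℝ => ∫⁻ x2, (∫⁻ x1, g (pt3 x1 x2 x3) ^ q1) ^ (q2/q1) :=
    Measurable.lintegral_prod_right' (f := fun z : ℝ × ℝ => (∫⁻ x1, g (pt3 x1 z.2 z.1) ^ q1) ^ (q2/q1)) (hI1.pow_const _)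
  set N1 := (∫⁻ x, k1 x ^ r1) ^ (1/r1)
  set N2 := (∫⁻ x, k2 x ^ r2) ^ (1/r2)
  set N3 := (∫⁻ x, k3 x ^ r3) ^ (1/r3)
  have s1 : ∀ x3 x2, ∫⁻ x1, (k1 x1 * k2 x2 * k3 x3) * g (pt3 x1 x2 x3)
      ≤ (k3 x3 * N1) * (k2 x2 * (∫⁻ x1, g (pt3 x1 x2 x3) ^ q1) ^ (1/q1)) := by
    intro x3 x2
    have := ENNReal.lintegral_mul_le_Lp_mul_Lq volume h1.symm m1.aemeasurable (hg1 x3 x2).aemeasurable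
    simp only [Pi.mul_apply] at this
    calc _ = ∫⁻ x1, (k2 x2 * k3 x3) * (k1 x1 * g (pt3 x1 x2 x3)) := lintegral_congr fun x1 => by ring
      _ = (k2 x2 * k3 x3) * ∫⁻ x1, (k1 x1 * g (pt3 x1 x2 x3)) :=
        lintegral_const_mul _ (m1.mul (hg1 x3 x2))
      _ ≤ (k2 x2 * k3 x3) * (N1 * (∫⁻ x1, g (pt3 x1 x2 x3) ^ q1) ^ (1/q1)) := by gcongr
      _ = _ := by ring
  have s2 : ∀ x3, ∫⁻ x2, ∫⁻ x1, (k1 x1 * k2 x2 * k3 x3) * g (pt3 x1 x2 x3)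
      ≤ (N1 * N2) * (k3 x3 * (∫⁻ x2, (∫⁻ x1, g (pt3 x1 x2 x3) ^ q1) ^ (q2/q1)) ^ (1/q2)) := by
    intro x3
    have hm : Measurable fun x2 => (∫⁻ x1, g (pt3 x1 x2 x3) ^ q1) ^ (1/q1) :=
      (hI1.comp (measurable_prodMk_left (x := x3))).pow_const _
    have := ENNReal.lintegral_mul_le_Lp_mul_Lq volume h2.symm m2.aemeasurable hm.aemeasurable
    simp only [Pi.mul_apply, ← ENNReal.rpow_mul] at this
    rw [one_div_mul_eq_div] at this
    calc _ ≤ ∫⁻ x2, (k3 x3 * N1) * (k2 x2 * (∫⁻ x1, g (pt3 x1 x2 x3) ^ q1) ^ (1/q1)) :=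
          lintegral_mono fun x2 => s1 x3 x2
      _ = (k3 x3 * N1) * ∫⁻ x2, (k2 x2 * (∫⁻ x1, g (pt3 x1 x2 x3) ^ q1) ^ (1/q1)) :=
        lintegral_const_mul _ (m2.mul hm)
      _ ≤ (k3 x3 * N1) * (N2 * _) := mul_le_mul_right this _
      _ = _ := by ring
  have hm : Measurable fun x3 => (∫⁻ x2, (∫⁻ x1, g (pt3 x1 x2 x3) ^ q1) ^ (q2/q1)) ^ (1/q2) := hI2.pow_const _
  have := ENNReal.lintegral_mul_le_Lp_mul_Lq volume h3.symm m3.aemeasurable hm.aemeasurable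
  simp only [Pi.mul_apply, ← ENNReal.rpow_mul] at this
  rw [one_div_mul_eq_div] at this
  calc _ ≤ ∫⁻ x3, (N1 * N2) * (k3 x3 * (∫⁻ x2, (∫⁻ x1, g (pt3 x1 x2 x3) ^ q1) ^ (q2/q1)) ^ (1/q2)) :=
        lintegral_mono s2
    _ = (N1 * N2) * ∫⁻ x3, (k3 x3 * (∫⁻ x2, (∫⁻ x1, g (pt3 x1 x2 x3) ^ q1) ^ (q2/q1)) ^ (1/q2)) :=
        lintegral_const_mul _ (m3.mul hm)
    _ ≤ (N1 * N2) * (N3 * _) := mul_le_mul_right this _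
    _ = _ := by unfold An; ring

/-- parabolic kernel -/
def kk (y : E3) (τ : ℝ) : ℝ≥0∞ := min (ENNReal.ofReal |τ| ^ (-2:ℝ)) (ENNReal.ofReal ‖y‖ ^ (-4:ℝ))

lemma measurable_kk : Measurable fun z : E3 × ℝ => kk z.1 z.2 := by unfold kk; fun_prop

lemma kk_neg (y : E3) (τ : ℝ) : kk (-y) (-τ) = kk y τ := by simp [kk]
lemma kk_neg1 (y : E3) (τ : ℝ) : kk (-y) τ = kk y τ := by simp [kk]

lemma kk_le (y : E3) (τ : ℝ) : kk y τ ≤ kap τ (y 0) * kap τ (y 1) * kap τ (y 2) := by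
  have h : ∀ i, kk y τ ^ (1/3:ℝ) ≤ kap τ (y i) := by
    intro i
    refine le_min ?_ ?_
    · refine (ENNReal.rpow_le_rpow (min_le_left _ _) (by norm_num)).trans (le_of_eq ?_)
      rw [← ENNReal.rpow_mul]; norm_num
    · refine (ENNReal.rpow_le_rpow (min_le_right _ _) (by norm_num)).trans ?_
      rw [← ENNReal.rpow_mul, show (-4:ℝ) * (1/3) = -(4/3) by norm_num, ENNReal.rpow_neg, ENNReal.rpow_neg]
      gcongr
      exact PiLp.norm_apply_le y i
  calc kk y τ = kk y τ ^ (1/3:ℝ) * kk y τ ^ (1/3:ℝ) * kk y τ ^ (1/3:ℝ) := by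
        rw [← ENNReal.rpow_add_of_nonneg _ _ (by norm_num) (by norm_num),
          ← ENNReal.rpow_add_of_nonneg _ _ (by norm_num) (by norm_num)]
        norm_num
    _ ≤ _ := by gcongr <;> exact h _

lemma kk_le_pt (x : E3) (τ x1 x2 x3 : ℝ) :
    kk (x - pt3 x1 x2 x3) τ ≤ kap τ (x 0 - x1) * kap τ (x 1 - x2) * kap τ (x 2 - x3) :=
  kk_le _ _

lemma space_bound {p q1 q2 q3 : ℝ} (hq1 : 1 < q1) (hq2 : 1 < q2) (hq3 : 1 < q3)
    (hpq : 2 / p + (1/q1 + 1/q2 + 1/q3) = 1) : ∃ C : ℝ≥0∞, C ≠ ∞ ∧ ∀ g : E3 → ℝ≥0∞, Measurable g →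
    ∀ x : E3, ∀ τ : ℝ, τ ≠ 0 → ∫⁻ y, kk (x - y) τ * g y ≤ C * (rk (1-1/p) τ * An q1 q2 q3 g) := by
  have c1 := Real.HolderConjugate.conjExponent hq1
  have c2 := Real.HolderConjugate.conjExponent hq2
  have c3 := Real.HolderConjugate.conjExponent hq3
  set r1 := q1.conjExponent
  set r2 := q2.conjExponent
  set r3 := q3.conjExponent
  obtain ⟨C1, hC1, e1⟩ := kap_int (e := r1) c1.symm.lt.le
  obtain ⟨C2, hC2, e2⟩ := kap_int (e := r2) c2.symm.lt.le
  obtain ⟨C3, hC3, e3⟩ := kap_int (e := r3) c3.symm.lt.le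
  have p1 := c1.symm.pos
  have p2 := c2.symm.pos
  have p3 := c3.symm.pos
  refine ⟨C1 ^ (1/r1) * C2 ^ (1/r2) * C3 ^ (1/r3), ?_, fun g hg x τ hτ => ?_⟩
  · refine ENNReal.mul_ne_top (ENNReal.mul_ne_top ?_ ?_) ?_ <;>
    exact ENNReal.rpow_ne_top_of_nonneg (by positivity) (by assumption)
  have hT0 : ENNReal.ofReal |τ| ≠ 0 := by simpa using hτ
  have hT1 : ENNReal.ofReal |τ| ≠ ∞ := by simp
  have hm : ∀ a, Measurable fun x => kap τ (a - x) := fun a => (measurable_kap τ).comp (by fun_prop)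
  rw [lint_E3 (fun y => kk (x - y) τ * g y) ((measurable_kk.comp (by fun_prop : Measurable fun y : E3 => (x - y, τ))).mul hg)]
  calc _ ≤ ∫⁻ x3, ∫⁻ x2, ∫⁻ x1, (kap τ (x 0 - x1) * kap τ (x 1 - x2) * kap τ (x 2 - x3)) * g (pt3 x1 x2 x3) := by
        gcongr; exact kk_le_pt _ _ _ _ _
    _ ≤ _ := holder3 c1 c2 c3 (fun t => kap τ (x 0 - t)) (fun t => kap τ (x 1 - t)) (fun t => kap τ (x 2 - t))
        (hm _) (hm _) (hm _) g hg
    _ = _ := by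
      rw [e1 τ hτ, e2 τ hτ, e3 τ hτ, ENNReal.mul_rpow_of_nonneg _ _ (by positivity),
        ENNReal.mul_rpow_of_nonneg _ _ (by positivity), ENNReal.mul_rpow_of_nonneg _ _ (by positivity),
        ← ENNReal.rpow_mul, ← ENNReal.rpow_mul, ← ENNReal.rpow_mul]
      have : rk (1-1/p) τ = ENNReal.ofReal |τ| ^ ((-(2/3)*r1+1/2)*(1/r1)) * ENNReal.ofReal |τ| ^ ((-(2/3)*r2+1/2)*(1/r2))
          * ENNReal.ofReal |τ| ^ ((-(2/3)*r3+1/2)*(1/r3)) := by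
        rw [← ENNReal.rpow_add _ _ hT0 hT1, ← ENNReal.rpow_add _ _ hT0 hT1]
        unfold rk
        congr 1
        have i1 := c1.inv_add_inv_eq_one
        have i2 := c2.inv_add_inv_eq_one
        have i3 := c3.inv_add_inv_eq_one
        have j1 : r1 * r1⁻¹ = 1 := mul_inv_cancel₀ p1.ne'
        have j2 : r2 * r2⁻¹ = 1 := mul_inv_cancel₀ p2.ne'
        have j3 : r3 * r3⁻¹ = 1 := mul_inv_cancel₀ p3.ne'
        simp only [one_div, div_eq_mul_inv] at hpq ⊢
        linear_combination (1/2)*hpq - (1/2)*i1 - (1/2)*i2-(1/2)*i3 + (2/3)*(j1+j2+j3)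
      rw [this]; ring

lemma kk_mass : ∃ C : ℝ≥0∞, C ≠ ∞ ∧ ∀ x : E3, ∀ τ : ℝ, τ ≠ 0 → ∫⁻ y, kk (x - y) τ ≤ C * rk (1/2) τ := by
  obtain ⟨C, hC, e⟩ := kap_int (e := 1) le_rfl
  simp only [ENNReal.rpow_one] at e
  refine ⟨C * C * C, by simp [ENNReal.mul_eq_top, hC], fun x τ hτ => ?_⟩
  have hT0 : ENNReal.ofReal |τ| ≠ 0 := by simpa using hτ
  have hT1 : ENNReal.ofReal |τ| ≠ ∞ := by simp
  have hm : ∀ a, Measurable fun x => kap τ (a - x) := fun a => (measurable_kap τ).comp (by fun_prop)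
  rw [lint_E3 (fun y => kk (x - y) τ) ((measurable_kk.comp (by fun_prop : Measurable fun y : E3 => (x - y, τ))))]
  calc _ ≤ ∫⁻ x3, ∫⁻ x2, ∫⁻ x1, (kap τ (x 0 - x1) * kap τ (x 1 - x2) * kap τ (x 2 - x3)) := by
        gcongr; exact kk_le_pt _ _ _ _ _
    _ = (∫⁻ t, kap τ (x 0 - t)) * (∫⁻ t, kap τ (x 1 - t)) * (∫⁻ t, kap τ (x 2 - t)) := by
      rw [← lintegral_const_mul _ (hm _)]
      refine lintegral_congr fun x3 => ?_
      rw [← lintegral_const_mul _ (hm _), ← lintegral_mul_const _ ((hm _).const_mul _)]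
      refine lintegral_congr fun x2 => ?_
      rw [mul_assoc, ← lintegral_mul_const _ (hm _)]
      refine lintegral_congr fun x1 => ?_
      ring
    _ = _ := by
      rw [e τ hτ, e τ hτ, e τ hτ]
      have : rk (1/2) τ = ENNReal.ofReal |τ| ^ (-(2/3)*1+1/2:ℝ) * ENNReal.ofReal |τ| ^ (-(2/3)*1+1/2:ℝ)
          * ENNReal.ofReal |τ| ^ (-(2/3)*1+1/2:ℝ) := by
        rw [← ENNReal.rpow_add _ _ hT0 hT1, ← ENNReal.rpow_add _ _ hT0 hT1]
        unfold rk
        congr 1; norm_num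
      rw [this]; ring

end ANS

namespace ANS

/-- bilinear parabolic potential -/
def Aop (V w : E3 → ℝ → ℝ≥0∞) (x : E3) (t : ℝ) : ℝ≥0∞ :=
  ∫⁻ s, ∫⁻ y, kk (x-y) (t-s) * (V y s * w y s)

section
variable {V w : E3 → ℝ → ℝ≥0∞}

lemma unc (hV : Measurable (Function.uncurry V)) {α : Type*} [MeasurableSpace α] {a : α → E3} {b : α → ℝ}
    (ha : Measurable a) (hb : Measurable b) : Measurable fun z => V (a z) (b z) :=
  hV.comp (ha.prodMk hb)

lemma kkm {α : Type*} [MeasurableSpace α] {a : α → E3} {b : α → ℝ}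
    (ha : Measurable a) (hb : Measurable b) : Measurable fun z => kk (a z) (b z) :=
  measurable_kk.comp (ha.prodMk hb)

lemma Aop_meas (hV : Measurable (Function.uncurry V)) (hw : Measurable (Function.uncurry w)) :
    Measurable (Function.uncurry (Aop V w)) := by
  have h1 : Measurable fun z : ((E3 × ℝ) × ℝ) × E3 => kk (z.1.1.1 - z.2) (z.1.1.2 - z.1.2) * (V z.2 z.1.2 * w z.2 z.1.2) :=
    (kkm (by fun_prop) (by fun_prop)).mul ((unc hV (by fun_prop) (by fun_prop)).mul (unc hw (by fun_prop) (by fun_prop)))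
  exact h1.lintegral_prod_right'.lintegral_prod_right'

lemma An_meas (q1 q2 q3 : ℝ) (hV : Measurable (Function.uncurry V)) :
    Measurable fun s => An q1 q2 q3 (fun y => V y s) := by
  unfold An
  have h1 : Measurable fun z : ((ℝ × ℝ) × ℝ) × ℝ => V (pt3 z.2 z.1.2 z.1.1.2) z.1.1.1 ^ q1 :=
    (unc hV (measurable_pt3.comp (by fun_prop : Measurable fun z : ((ℝ × ℝ) × ℝ) × ℝ => (z.2, z.1.2, z.1.1.2)))
      (by fun_prop)).pow_const _
  exact ((((h1.lintegral_prod_right'.pow_const (q2/q1)).lintegral_prod_right').pow_const (q3/q2)).lintegral_prod_right').pow_const _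

lemma ae_ne (t : ℝ) : ∀ᵐ s : ℝ, t - s ≠ 0 := by
  have : ∀ᵐ s : ℝ, s ≠ t := by simp [ae_iff, measure_singleton]
  filter_upwards [this] with s hs h
  exact hs (by linarith)

lemma Aop_time {C : ℝ≥0∞} {l : ℝ} {q1 q2 q3 : ℝ}
    (hC : ∀ g : E3 → ℝ≥0∞, Measurable g →
    ∀ x : E3, ∀ τ : ℝ, τ ≠ 0 → ∫⁻ y, kk (x - y) τ * g y ≤ C * (rk l τ * An q1 q2 q3 g))
    (hV : Measurable (Function.uncurry V)) (g : ℝ → ℝ≥0∞) (x : E3) (t : ℝ) :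
    Aop V (fun _ s => g s) x t ≤ ∫⁻ s, rk l (t-s) * ((C * An q1 q2 q3 (fun y => V y s)) * g s) := by
  unfold Aop
  refine lintegral_mono_ae ?_
  filter_upwards [ae_ne t] with s hs
  have hm : Measurable fun y => V y s := unc hV measurable_id measurable_const
  have hm2 : Measurable fun y => kk (x-y) (t-s) := kkm (by fun_prop) (by fun_prop)
  calc _ = ∫⁻ y, (kk (x-y) (t-s) * V y s) * g s := lintegral_congr fun y => by ring
    _ = (∫⁻ y, (kk (x-y) (t-s) * V y s)) * g s := lintegral_mul_const _ (hm2.mul hm)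
    _ ≤ (C * (rk l (t-s) * An q1 q2 q3 (fun y => V y s))) * g s := by
      gcongr; exact hC _ hm x _ hs
    _ = _ := by ring

lemma Aop_swap (hV : Measurable (Function.uncurry V)) (hw : Measurable (Function.uncurry w)) (v : E3 → ℝ≥0∞)
    (hv : Measurable v) (t : ℝ) :
    ∫⁻ x, v x * Aop V w x t = ∫⁻ s, ∫⁻ y, (V y s * w y s) * ∫⁻ x, kk (y-x) (t-s) * v x := by
  have h1 : Measurable fun z : (E3 × ℝ) × E3 => kk (z.1.1 - z.2) (t - z.1.2) * (V z.2 z.1.2 * w z.2 z.1.2) :=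
    (kkm (by fun_prop) (by fun_prop)).mul ((unc hV (by fun_prop) (by fun_prop)).mul (unc hw (by fun_prop) (by fun_prop)))
  have hJ : ∀ x, Measurable fun s => ∫⁻ y, kk (x-y) (t-s) * (V y s * w y s) := by
    intro x
    have : Measurable fun z : ℝ × E3 => kk (x - z.2) (t - z.1) * (V z.2 z.1 * w z.2 z.1) :=
      (kkm (by fun_prop) (by fun_prop)).mul ((unc hV (by fun_prop) (by fun_prop)).mul (unc hw (by fun_prop) (by fun_prop)))
    exact this.lintegral_prod_right'
  have hJ1 : Measurable fun z : E3 × ℝ => ∫⁻ y, kk (z.1-y) (t-z.2) * (V y z.2 * w y z.2) :=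
    h1.lintegral_prod_right'
  have hJ2 : Measurable fun z : E3 × ℝ => v z.1 * ∫⁻ y, kk (z.1-y) (t-z.2) * (V y z.2 * w y z.2) :=
    (hv.comp measurable_fst).mul hJ1
  calc _ = ∫⁻ x, ∫⁻ s, v x * ∫⁻ y, kk (x-y) (t-s) * (V y s * w y s) := by
        refine lintegral_congr fun x => ?_
        have m : Measurable fun s => ∫⁻ y, kk (x-y) (t-s) * (V y s * w y s) :=
          hJ x
        rw [Aop, lintegral_const_mul _ m]
    _ = ∫⁻ s, ∫⁻ x, v x * ∫⁻ y, kk (x-y) (t-s) * (V y s * w y s) := by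
        rw [lintegral_lintegral_swap]
        exact hJ2.aemeasurable
    _ = _ := by
      refine lintegral_congr fun s => ?_
      have m1 : Measurable fun y => V y s * w y s :=
        (unc hV measurable_id measurable_const).mul (unc hw measurable_id measurable_const)
      have m2 : ∀ x, Measurable fun y => kk (x-y) (t-s) := fun x => kkm (by fun_prop) (by fun_prop)
      have m3 : Measurable fun z : E3 × E3 => kk (z.1 - z.2) (t-s) := kkm (by fun_prop) (by fun_prop)
      calc _ = ∫⁻ x, ∫⁻ y, v x * (kk (x-y) (t-s) * (V y s * w y s)) := by
            refine lintegral_congr fun x => ?_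
            have m : Measurable fun y => kk (x-y) (t-s) * (V y s * w y s) := (m2 x).mul m1
            rw [lintegral_const_mul _ m]
        _ = ∫⁻ y, ∫⁻ x, v x * (kk (x-y) (t-s) * (V y s * w y s)) := by
            rw [lintegral_lintegral_swap]
            exact ((hv.comp measurable_fst).mul (m3.mul (m1.comp measurable_snd))).aemeasurable
        _ = _ := by
            refine lintegral_congr fun y => ?_
            have m : Measurable fun x => kk (y-x) (t-s) * v x := (m2 y).mul hv
            rw [← lintegral_const_mul _ m]
            refine lintegral_congr fun x => ?_
            rw [← kk_neg1, neg_sub]; ring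

lemma Aop_gamma {C : ℝ≥0∞} {l : ℝ} {q1 q2 q3 : ℝ}
    (hC : ∀ g : E3 → ℝ≥0∞, Measurable g →
    ∀ x : E3, ∀ τ : ℝ, τ ≠ 0 → ∫⁻ y, kk (x - y) τ * g y ≤ C * (rk l τ * An q1 q2 q3 g))
    (hV : Measurable (Function.uncurry V)) (hw : Measurable (Function.uncurry w)) (t : ℝ) :
    ∫⁻ x, V x t * Aop V w x t ≤ (C * An q1 q2 q3 (fun y => V y t)) *
      ∫⁻ s, rk l (t-s) * ∫⁻ y, V y s * w y s := by
  have hm : Measurable fun y => V y t := unc hV measurable_id measurable_const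
  have m0 : Measurable fun z : ℝ × E3 => V z.2 z.1 * w z.2 z.1 :=
    (unc hV measurable_snd measurable_fst).mul (unc hw measurable_snd measurable_fst)
  have m4 : Measurable fun s => ∫⁻ y, V y s * w y s := m0.lintegral_prod_right'
  have m5 : Measurable fun s => rk l (t-s) * ∫⁻ y, V y s * w y s :=
    ((measurable_rk l).comp (by fun_prop)).mul m4
  rw [Aop_swap hV hw _ hm, ← lintegral_const_mul _ m5]
  refine lintegral_mono_ae ?_
  filter_upwards [ae_ne t] with s hs
  have m1 : Measurable fun y => V y s * w y s :=
        (unc hV measurable_id measurable_const).mul (unc hw measurable_id measurable_const)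
  calc _ ≤ ∫⁻ y, (V y s * w y s) * (C * (rk l (t-s) * An q1 q2 q3 (fun y => V y t))) := by
        gcongr with y; exact hC _ hm y _ hs
    _ = _ := by rw [lintegral_mul_const _ m1]; ring

lemma Aop_mass {C : ℝ≥0∞} (hC : ∀ x : E3, ∀ τ : ℝ, τ ≠ 0 → ∫⁻ y, kk (x - y) τ ≤ C * rk (1/2) τ)
    (hV : Measurable (Function.uncurry V)) (hw : Measurable (Function.uncurry w)) (I : Set ℝ) :
    ∫⁻ t in I, ∫⁻ x, Aop V w x t ≤ (C * ((ENNReal.ofReal (2 / (1-1/2)) + 1) * (volume I) ^ (1 - 1/2:ℝ))) *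
      ∫⁻ s, ∫⁻ y, V y s * w y s := by
  have m0 : Measurable fun z : ℝ × E3 => V z.2 z.1 * w z.2 z.1 :=
    (unc hV measurable_snd measurable_fst).mul (unc hw measurable_snd measurable_fst)
  have m4 : Measurable fun s => ∫⁻ y, V y s * w y s := m0.lintegral_prod_right'
  have h1 : ∀ t, ∫⁻ x, Aop V w x t ≤ ∫⁻ s, (C * rk (1/2) (t-s)) * ∫⁻ y, V y s * w y s := by
    intro t
    have := Aop_swap hV hw (fun _ => 1) measurable_const t
    simp only [one_mul, mul_one] at this
    rw [this]
    refine lintegral_mono_ae ?_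
    filter_upwards [ae_ne t] with s hs
    have m1 : Measurable fun y => V y s * w y s :=
        (unc hV measurable_id measurable_const).mul (unc hw measurable_id measurable_const)
    calc _ ≤ ∫⁻ y, (V y s * w y s) * (C * (rk (1/2) (t-s))) := by
          gcongr with y; exact hC y _ hs
      _ = _ := by rw [lintegral_mul_const _ m1]; ring
  have m5 : Measurable fun z : ℝ × ℝ => (C * rk (1/2) (z.1-z.2)) * ∫⁻ y, V y z.2 * w y z.2 :=
    (measurable_const.mul ((measurable_rk _).comp (by fun_prop))).mul (m4.comp measurable_snd)
  calc _ ≤ ∫⁻ t in I, ∫⁻ s, (C * rk (1/2) (t-s)) * ∫⁻ y, V y s * w y s := lintegral_mono fun t => h1 t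
    _ = ∫⁻ s, ∫⁻ t in I, (C * rk (1/2) (t-s)) * ∫⁻ y, V y s * w y s := by
      rw [lintegral_lintegral_swap]
      exact m5.aemeasurable
    _ ≤ _ := by
      rw [← lintegral_const_mul _ m4]
      refine lintegral_mono fun s => ?_
      have m6 : Measurable fun t => rk (1/2) (t-s) := (measurable_rk _).comp (by fun_prop)
      rw [lintegral_mul_const _ (m6.const_mul C), lintegral_const_mul _ m6]
      gcongr
      have := hls_set (l := 1/2) (by norm_num) (by norm_num) s I
      refine le_trans (le_of_eq ?_) this
      refine lintegral_congr fun t => ?_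
      rw [← rk_neg, neg_sub]
end
end ANS

namespace ANS

/-- remainder iterates -/
def Rit (c : ℝ≥0∞) (V f : E3 → ℝ → ℝ≥0∞) : ℕ → E3 → ℝ → ℝ≥0∞
  | 0 => f
  | (N+1) => fun x t => c * Aop V (Rit c V f N) x t

lemma Rit_meas (c : ℝ≥0∞) {V f : E3 → ℝ → ℝ≥0∞} (hV : Measurable (Function.uncurry V))
    (hf : Measurable (Function.uncurry f)) (N : ℕ) : Measurable (Function.uncurry (Rit c V f N)) := by
  induction N with
  | zero => exact hf
  | succ N ih => exact (Aop_meas hV ih).const_mul c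

lemma ae_swap {P : E3 → ℝ → Prop} (h : ∀ᵐ z : E3 × ℝ, P z.1 z.2) : ∀ᵐ s : ℝ, ∀ᵐ y : E3, P y s :=
  Measure.ae_ae_of_ae_prod ((Measure.measurePreserving_swap (μ := (volume : Measure ℝ)) (ν := (volume : Measure E3))).quasiMeasurePreserving.ae h)

set_option maxHeartbeats 1000000 in
lemma iterC {p q1 q2 q3 : ℝ} (hp : 2 < p) (hq1 : 1 < q1) (hq2 : 1 < q2) (hq3 : 1 < q3)
    (hpq : 2 / p + (1/q1 + 1/q2 + 1/q3) = 1) : ∃ ε : ℝ≥0∞, ε ≠ 0 ∧ ∀ I : Set ℝ, MeasurableSet I →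
    volume I ≠ ∞ → ∀ V f : E3 → ℝ → ℝ≥0∞, Measurable (Function.uncurry V) → Measurable (Function.uncurry f) →
    (∀ x, ∀ t ∉ I, V x t = 0) → (∀ x t, f x t ≤ V x t) → ∀ c M E0 : ℝ≥0∞, c ≠ ∞ → E0 ≠ ∞ →
    (∀ᵐ z : E3 × ℝ, f z.1 z.2 ≤ M + c * Aop V f z.1 z.2) → (∀ᵐ t : ℝ, ∫⁻ x, V x t * V x t ≤ E0) →
    c * (∫⁻ t, An q1 q2 q3 (fun x => V x t) ^ p) ^ (1/p) ≤ ε →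
    ∃ H : ℝ → ℝ≥0∞, Measurable H ∧ ∫⁻ t in I, H t ^ (6:ℝ) ≠ ∞ ∧ ∀ᵐ z : E3 × ℝ, f z.1 z.2 ≤ M * H z.2 := by
  obtain ⟨ε, hε, ht⟩ := time_iter hp
  obtain ⟨Cs, hCs, hs⟩ := space_bound (p := p) hq1 hq2 hq3 hpq
  obtain ⟨Cm, hCm, hmass⟩ := kk_mass
  have hp0 : 0 < p := by linarith
  refine ⟨ε / (Cs + 1), by simp [hε, hCs], fun I hI hIf V f hV hf hV0 hfV c M E0 hc hE0 hsub hE hsm => ?_⟩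
  set n : ℝ → ℝ≥0∞ := fun t => (c * Cs) * An q1 q2 q3 (fun x => V x t) with hn
  have hAm := An_meas q1 q2 q3 hV
  have hnm : Measurable n := hAm.const_mul _
  have hn0 : ∀ t ∉ I, n t = 0 := by
    intro t ht
    have : An q1 q2 q3 (fun x => V x t) = 0 := by
      simp only [An, hV0 _ t ht]
      rw [ENNReal.zero_rpow_of_pos (by positivity), lintegral_zero, ENNReal.zero_rpow_of_pos (by positivity),
        lintegral_zero, ENNReal.zero_rpow_of_pos (by positivity), lintegral_zero,
        ENNReal.zero_rpow_of_pos (by positivity)]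
    simp [hn, this]
  have hnp : (∫⁻ t, n t ^ p) ^ (1/p) ≤ ε := by
    have e : ∀ t, n t ^ p = (c * Cs) ^ p * An q1 q2 q3 (fun x => V x t) ^ p := fun t =>
      ENNReal.mul_rpow_of_nonneg _ _ hp0.le
    simp only [e]
    rw [lintegral_const_mul _ (hAm.pow_const p), ENNReal.mul_rpow_of_nonneg _ _ (by positivity), ← ENNReal.rpow_mul,
      mul_one_div_cancel hp0.ne', ENNReal.rpow_one]
    calc _ = Cs * (c * (∫⁻ t, An q1 q2 q3 (fun x => V x t) ^ p) ^ (1/p)) := by ring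
      _ ≤ (Cs + 1) * (ε / (Cs + 1)) := by gcongr; exact le_self_add
      _ ≤ ε := ENNReal.mul_div_le
  obtain ⟨⟨H, hHm, hH6, hH⟩, hγ⟩ := ht I hI hIf n hnm hn0 hnp
  refine ⟨H, hHm, hH6, ?_⟩
  set R := Rit c V f with hR
  have hRm := Rit_meas c hV hf
  have claim : ∀ N, ∀ᵐ z : E3 × ℝ, f z.1 z.2 ≤ M * H z.2 + R N z.1 z.2 := by
    intro N
    induction N with
    | zero => exact Eventually.of_forall fun z => le_add_self
    | succ N ih =>
      filter_upwards [hsub] with z hz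
      refine hz.trans ?_
      have h1 : Aop V f z.1 z.2 ≤ Aop V (fun _ s => M * H s) z.1 z.2 + Aop V (R N) z.1 z.2 := by
        have m1 : Measurable fun w : ℝ × E3 => kk (z.1 - w.2) (z.2 - w.1) * (V w.2 w.1 * (M * H w.1)) :=
          (kkm (by fun_prop) (by fun_prop)).mul ((unc hV (by fun_prop) (by fun_prop)).mul (by fun_prop))
        have m2 : Measurable fun s : ℝ => ∫⁻ y, kk (z.1 - y) (z.2 - s) * (V y s * (M * H s)) :=
          m1.lintegral_prod_right'
        unfold Aop
        rw [← lintegral_add_left m2]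
        refine lintegral_mono_ae ?_
        filter_upwards [ae_swap (P := fun y s => f y s ≤ M * H s + R N y s) ih] with s hs
        have m3 : Measurable fun y => kk (z.1 - y) (z.2 - s) * (V y s * (M * H s)) :=
          (kkm (by fun_prop) (by fun_prop)).mul ((unc hV (by fun_prop) (by fun_prop)).mul (by fun_prop))
        rw [← lintegral_add_left m3]
        refine lintegral_mono_ae ?_
        filter_upwards [hs] with y hy
        rw [← mul_add, ← mul_add]
        gcongr
      have h2 : M + c * Aop V (fun _ s => M * H s) z.1 z.2 ≤ M * H z.2 := by
        calc _ ≤ M + c * ∫⁻ s, rk (1-1/p) (z.2-s) * ((Cs * An q1 q2 q3 (fun y => V y s)) * (M * H s)) := by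
              gcongr; exact Aop_time hs hV _ _ _
          _ = M * (1 + ∫⁻ s, rk (1-1/p) (z.2-s) * (n s * H s)) := by
            rw [mul_add, mul_one]
            congr 1
            have m5 : Measurable fun s => rk (1-1/p) (z.2-s) * (n s * H s) := by fun_prop
            rw [← lintegral_const_mul' _ _ hc, ← lintegral_const_mul _ m5]
            refine lintegral_congr fun s => ?_
            simp only [hn]; ring
          _ ≤ _ := by gcongr; exact hH _
      calc M + c * Aop V f z.1 z.2 ≤ M + c * (Aop V (fun _ s => M * H s) z.1 z.2 + Aop V (R N) z.1 z.2) := by gcongr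
        _ = (M + c * Aop V (fun _ s => M * H s) z.1 z.2) + c * Aop V (R N) z.1 z.2 := by ring
        _ ≤ _ := by gcongr; exact le_rfl
  set γ : ℕ → ℝ → ℝ≥0∞ := fun N t => ∫⁻ x, V x t * R N x t with hγd
  have hγm : ∀ N, Measurable (γ N) := by
    intro N
    have m0 : Measurable fun z : ℝ × E3 => V z.2 z.1 * R N z.2 z.1 :=
      (unc hV measurable_snd measurable_fst).mul (unc (hRm N) measurable_snd measurable_fst)
    exact m0.lintegral_prod_right'
  have hγ0 : ∀ N, ∀ t ∉ I, γ N t = 0 := by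
    intro N t ht
    simp [hγd, hV0 _ t ht]
  have hlim := hγ γ hγm hγ0 (by
    refine ne_of_lt (lt_of_le_of_lt (b := ∫⁻ t, I.indicator (fun _ => E0 ^ (6/5:ℝ)) t) (lintegral_mono_ae ?_) ?_)
    · filter_upwards [hE] with t ht
      by_cases h : t ∈ I
      · rw [indicator_of_mem h]
        gcongr
        refine le_trans (lintegral_mono fun x => ?_) ht
        exact mul_le_mul_right (hfV x t) _
      · rw [hγ0 0 t h, ENNReal.zero_rpow_of_pos (by norm_num)]; exact zero_le
    · rw [lintegral_indicator hI, lintegral_const, Measure.restrict_apply MeasurableSet.univ, univ_inter]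
      exact ENNReal.mul_lt_top (ENNReal.rpow_lt_top_of_nonneg (by norm_num) hE0) hIf.lt_top) (by
    intro N t
    have h1 := Aop_gamma hs hV (hRm N) t
    have m : Measurable fun x => V x t * Aop V (R N) x t :=
      (unc hV measurable_id measurable_const).mul (unc (Aop_meas hV (hRm N)) measurable_id measurable_const)
    calc γ (N+1) t = c * ∫⁻ x, V x t * Aop V (R N) x t := by
          rw [← lintegral_const_mul _ m]
          refine lintegral_congr fun x => ?_
          show V x t * (c * Aop V (R N) x t) = _
          ring
      _ ≤ c * ((Cs * An q1 q2 q3 fun y => V y t) * ∫⁻ s, rk (1-1/p) (t-s) * ∫⁻ y, V y s * R N y s) := by gcongr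
      _ = _ := by simp only [hn, hγd]; ring)
  set K : ℝ≥0∞ := c * (Cm * ((ENNReal.ofReal (2 / (1-1/2)) + 1) * (volume I) ^ (1 - 1/2:ℝ))) with hK
  have hKf : K ≠ ∞ := by
    refine ENNReal.mul_ne_top hc (ENNReal.mul_ne_top hCm (ENNReal.mul_ne_top (by simp) (ENNReal.rpow_ne_top_of_nonneg (by norm_num) hIf)))
  have hRmass : ∀ N, ∫⁻ t in I, ∫⁻ x, R (N+1) x t ≤ K * ∫⁻ t, γ N t := by
    intro N
    have h1 := Aop_mass hmass hV (hRm N) I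
    calc _ = c * ∫⁻ t in I, ∫⁻ x, Aop V (R N) x t := by
          rw [← lintegral_const_mul' _ _ hc]
          refine lintegral_congr fun t => ?_
          rw [← lintegral_const_mul' _ _ hc]; rfl
      _ ≤ _ := by rw [hK, mul_assoc]; gcongr
  have hg : Measurable fun z : E3 × ℝ => f z.1 z.2 - M * H z.2 := by
    have : Measurable fun z : E3 × ℝ => f z.1 z.2 := hf
    fun_prop
  have hzero : ∫⁻ z : E3 × ℝ, (f z.1 z.2 - M * H z.2) = 0 := by
    have hle : ∀ N, ∫⁻ z : E3 × ℝ, (f z.1 z.2 - M * H z.2) ≤ K * ∫⁻ t, γ N t := by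
      intro N
      refine le_trans ?_ (hRmass N)
      rw [Measure.volume_eq_prod, lintegral_prod_symm _ hg.aemeasurable, ← lintegral_indicator hI]
      refine lintegral_mono_ae ?_
      filter_upwards [ae_swap (P := fun y s => f y s ≤ M * H s + R (N+1) y s) (claim (N+1))] with t ht
      by_cases h : t ∈ I
      · rw [indicator_of_mem h]
        refine lintegral_mono_ae ?_
        filter_upwards [ht] with x hx
        rw [tsub_le_iff_left]; exact hx
      · have : ∀ x, f x t = 0 := fun x => le_antisymm ((hfV x t).trans (hV0 x t h).le) zero_le
        simp [this]
    have h5 : Tendsto (fun N => K * ∫⁻ t, γ N t) atTop (nhds 0) := by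
      have := ENNReal.Tendsto.const_mul hlim (Or.inr hKf)
      simpa using this
    exact le_antisymm (ge_of_tendsto' h5 hle) zero_le
  rw [lintegral_eq_zero_iff hg] at hzero
  filter_upwards [hzero] with z hz
  exact tsub_eq_zero_iff_le.1 hz
end ANS

namespace ANS

/-- parabolic cylinder at the origin -/
def QQ (r : ℝ) : Set (E3 × ℝ) := ball (0:E3) r ×ˢ Ioo (-(r^2)) 0
/-- parabolic cylinder at z -/
def Qz (z : E3 × ℝ) (r : ℝ) : Set (E3 × ℝ) := ball z.1 r ×ˢ Ioo (z.2 - r^2) z.2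

lemma QQ_meas (r : ℝ) : MeasurableSet (QQ r) := measurableSet_ball.prod measurableSet_Ioo

lemma QQ_mono {r s : ℝ} (hr : 0 ≤ r) (h : r ≤ s) : QQ r ⊆ QQ s := by
  refine prod_mono (ball_subset_ball h) (Ioo_subset_Ioo_left ?_)
  nlinarith

lemma Qz_sub {z : E3 × ℝ} {a b c : ℝ} (ha : 0 ≤ a) (hb : 0 ≤ b) (hz : z ∈ QQ a) (h : a + b ≤ c) : Qz z b ⊆ QQ c := by
  rintro ⟨y, s⟩ ⟨hy, hs⟩
  obtain ⟨h1, h2⟩ := hz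
  simp only [mem_ball, dist_zero_right, mem_Ioo] at *
  refine ⟨?_, ?_, ?_⟩
  · simp only [mem_ball, dist_zero_right]
    have : ‖y‖ ≤ dist y z.1 + ‖z.1‖ := by
      rw [dist_eq_norm]; simpa using norm_add_le (y - z.1) z.1
    linarith
  · nlinarith [hs.1, h2.1]
  · linarith [hs.2, h2.2]

/-- the pointwise representation bound -/
def PB (V0 : E3 → ℝ → ℝ≥0∞) (ϱ : ℝ) (C : ℝ≥0∞) (m : ℕ) (E : ℝ≥0∞) : Prop :=
  ∀ r : ℝ, 0 < r → r ≤ 1 → ∀ᵐ z : E3 × ℝ, Qz z r ⊆ QQ ϱ →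
    V0 z.1 z.2 ≤ C * (∫⁻ w in Qz z r, kk (z.1 - w.1) (z.2 - w.2) * (V0 w.1 w.2 * V0 w.1 w.2))
      + C * ((ENNReal.ofReal r)⁻¹ ^ m * E)

lemma step1 {V0 : E3 → ℝ → ℝ≥0∞} (hV0 : Measurable (Function.uncurry V0)) {ϱ : ℝ} {C E : ℝ≥0∞} {m : ℕ}
    (hB : PB V0 ϱ C m E) {ρ : ℝ} (hρ : 0 < ρ) (hρ1 : ρ ≤ 1) (hρϱ : ρ ≤ ϱ) :
    ∃ V f : E3 → ℝ → ℝ≥0∞, Measurable (Function.uncurry V) ∧ Measurable (Function.uncurry f) ∧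
    (∀ x t, V x t = (QQ ρ).indicator (fun z => V0 z.1 z.2) (x, t)) ∧ (∀ x t, f x t ≤ V x t) ∧
    (∀ z ∈ QQ (ρ/2), V0 z.1 z.2 ≤ 2 ^ m * f z.1 z.2) ∧
    (∀ᵐ z : E3 × ℝ, f z.1 z.2 ≤ (C * 2 ^ m) * ((ENNReal.ofReal ρ)⁻¹ ^ m * E) + (C * 2 ^ m) * Aop V f z.1 z.2) := by
  have hV0' : Measurable fun z : E3 × ℝ => V0 z.1 z.2 := hV0
  set rn : ℕ → ℝ := fun n => ρ * (1 - 2⁻¹ ^ n) with hrn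
  have hp1 : ∀ n : ℕ, (2⁻¹:ℝ) ^ n ≤ 1 := fun n => pow_le_one₀ (by norm_num) (by norm_num)
  have hp0 : ∀ n : ℕ, (0:ℝ) < (2⁻¹:ℝ) ^ n := fun n => by positivity
  have hrn0 : ∀ n, 0 ≤ rn n := fun n => mul_nonneg hρ.le (by linarith [hp1 n])
  have hrnρ : ∀ n, rn n ≤ ρ := fun n => by simp only [hrn]; nlinarith [hp0 n]
  set V : E3 → ℝ → ℝ≥0∞ := fun x t => (QQ ρ).indicator (fun z => V0 z.1 z.2) (x, t) with hV
  set f : E3 → ℝ → ℝ≥0∞ := fun x t => ⨆ n : ℕ, (QQ (rn n)).indicator (fun z => (2⁻¹:ℝ≥0∞) ^ (m*n) * V0 z.1 z.2) (x, t) with hf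
  have hVm : Measurable (Function.uncurry V) := hV0'.indicator (QQ_meas ρ)
  have hfm : Measurable (Function.uncurry f) := by
    have : Measurable fun z : E3 × ℝ => ⨆ n : ℕ, (QQ (rn n)).indicator (fun z => (2⁻¹:ℝ≥0∞) ^ (m*n) * V0 z.1 z.2) z :=
      Measurable.iSup fun n => (hV0'.const_mul _).indicator (QQ_meas _)
    exact this
  have two : ∀ k : ℕ, (2:ℝ≥0∞) ^ k * 2⁻¹ ^ k = 1 := by
    intro k; rw [← mul_pow, ENNReal.mul_inv_cancel (by simp) (by simp), one_pow]
  have hlow : ∀ n, ∀ z ∈ QQ (rn n), V0 z.1 z.2 ≤ 2 ^ (m * n) * f z.1 z.2 := by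
    intro n z hz
    calc V0 z.1 z.2 = 2 ^ (m * n) * (2⁻¹ ^ (m*n) * V0 z.1 z.2) := by rw [← mul_assoc, two, one_mul]
      _ ≤ _ := by
        gcongr
        refine le_trans ?_ (le_iSup _ n)
        rw [indicator_of_mem hz]
  refine ⟨V, f, hVm, hfm, fun x t => rfl, ?_, ?_, ?_⟩
  · intro x t
    refine iSup_le fun n => ?_
    by_cases h : (x, t) ∈ QQ (rn n)
    · have h' := QQ_mono (hrn0 n) (hrnρ n) h
      simp only [hV]
      rw [indicator_of_mem h, indicator_of_mem h']
      calc _ ≤ 1 * V0 x t := by gcongr; exact pow_le_one₀ zero_le (by simp)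
        _ = _ := one_mul _
    · rw [indicator_of_notMem h]; exact zero_le
  · intro z hz
    have := hlow 1 z (by simp only [hrn]; convert hz using 2; ring)
    simpa using this
  · have hall := ae_all_iff.2 fun n : ℕ => hB (ρ * 2⁻¹ ^ (n+1)) (by positivity)
      (by have := hp1 (n+1); have := hp0 (n+1); nlinarith)
    filter_upwards [hall] with z hz
    refine iSup_le fun n => ?_
    by_cases h : z ∈ QQ (rn n)
    swap
    · rw [indicator_of_notMem h]; exact zero_le
    rw [indicator_of_mem h]
    have hsub : Qz z (ρ * 2⁻¹ ^ (n+1)) ⊆ QQ (rn (n+1)) :=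
      Qz_sub (hrn0 n) (by positivity) h (by simp only [hrn]; rw [pow_succ]; linarith)
    have h1 := hz n (hsub.trans (QQ_mono (hrn0 _) ((hrnρ _).trans hρϱ)))
    have h2 : (∫⁻ w in Qz z (ρ * 2⁻¹ ^ (n+1)), kk (z.1 - w.1) (z.2 - w.2) * (V0 w.1 w.2 * V0 w.1 w.2))
        ≤ 2 ^ (m*(n+1)) * Aop V f z.1 z.2 := by
      have mm : Measurable fun w : E3 × ℝ => kk (z.1 - w.1) (z.2 - w.2) * (V w.1 w.2 * f w.1 w.2) :=
        (kkm (by fun_prop) (by fun_prop)).mul (hVm.mul hfm)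
      have e : Aop V f z.1 z.2 = ∫⁻ w : E3 × ℝ, kk (z.1 - w.1) (z.2 - w.2) * (V w.1 w.2 * f w.1 w.2) := by
        rw [Measure.volume_eq_prod, lintegral_prod_symm _ mm.aemeasurable]; rfl
      rw [e, ← lintegral_const_mul _ mm]
      refine le_trans ?_ (setLIntegral_le_lintegral (Qz z (ρ * 2⁻¹ ^ (n+1))) _)
      refine setLIntegral_mono (mm.const_mul _) fun w hw => ?_
      have e1 : V w.1 w.2 = V0 w.1 w.2 := by
        simp only [hV]
        rw [indicator_of_mem (QQ_mono (hrn0 _) (hrnρ _) (hsub hw))]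
      rw [e1]
      calc _ ≤ kk (z.1 - w.1) (z.2 - w.2) * (V0 w.1 w.2 * (2 ^ (m * (n+1)) * f w.1 w.2)) := by
            gcongr; exact hlow (n+1) w (hsub hw)
        _ = _ := by ring
    have h3 : (ENNReal.ofReal (ρ * 2⁻¹ ^ (n+1)))⁻¹ ^ m = (ENNReal.ofReal ρ)⁻¹ ^ m * 2 ^ (m * (n+1)) := by
      rw [ENNReal.ofReal_mul hρ.le, ENNReal.mul_inv (by simp) (by simp [hρ]), mul_pow]
      congr 1
      rw [ENNReal.ofReal_pow (by norm_num), ENNReal.ofReal_inv_of_pos (by norm_num), ENNReal.inv_pow, inv_inv, ← pow_mul, mul_comm]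
      simp
    have h4 : (2⁻¹:ℝ≥0∞) ^ (m*n) * 2 ^ (m*(n+1)) = 2 ^ m := by
      rw [mul_add, pow_add, mul_one, ← mul_assoc, mul_comm (2⁻¹ ^ _), two, one_mul]
    calc (2⁻¹:ℝ≥0∞) ^ (m*n) * V0 z.1 z.2 ≤ (2⁻¹:ℝ≥0∞) ^ (m*n) * (C * (2 ^ (m*(n+1)) * Aop V f z.1 z.2) + C * (((ENNReal.ofReal ρ)⁻¹ ^ m * 2 ^ (m * (n+1))) * E)) := by
          rw [← h3]; gcongr; exact h1.trans (by gcongr)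
      _ = ((2⁻¹:ℝ≥0∞) ^ (m*n) * 2 ^ (m*(n+1))) * (C * Aop V f z.1 z.2 + C * ((ENNReal.ofReal ρ)⁻¹ ^ m * E)) := by ring
      _ = _ := by rw [h4]; ring
end ANS

namespace ANS

lemma An_mono {q1 q2 q3 : ℝ} (hq1 : 0 < q1) (hq2 : 0 < q2) (hq3 : 0 < q3) {g h : E3 → ℝ≥0∞} (hgh : ∀ x, g x ≤ h x) :
    An q1 q2 q3 g ≤ An q1 q2 q3 h := by
  unfold An
  gcongr
  exact hgh _

lemma final_kernel {C : ℝ≥0∞} (hCf : C ≠ ∞) (hC : ∀ x : E3, ∀ τ : ℝ, τ ≠ 0 → ∫⁻ y, kk (x - y) τ ≤ C * rk (1/2) τ)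
    (I : Set ℝ) (hI : MeasurableSet I) (hIf : volume I ≠ ∞) (H : ℝ → ℝ≥0∞) (hH : Measurable H)
    (hH6 : ∫⁻ t in I, H t ^ (6:ℝ) ≠ ∞) : ∃ K : ℝ≥0∞, K ≠ ∞ ∧ ∀ z : E3 × ℝ,
    ∫⁻ s in I, ∫⁻ y, kk (z.1 - y) (z.2 - s) * (H s * H s) ≤ K := by
  refine ⟨C * ((((ENNReal.ofReal (2 / (1-3/4)) + 1) * (volume I) ^ (1 - 3/4:ℝ))) ^ (1/(3/2):ℝ) *
    (∫⁻ t in I, H t ^ (6:ℝ)) ^ (1/3:ℝ)), ?_, fun z => ?_⟩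
  · refine ENNReal.mul_ne_top hCf (ENNReal.mul_ne_top (ENNReal.rpow_ne_top_of_nonneg (by norm_num) ?_) (ENNReal.rpow_ne_top_of_nonneg (by norm_num) hH6))
    exact ENNReal.mul_ne_top (by simp) (ENNReal.rpow_ne_top_of_nonneg (by norm_num) hIf)
  have m1 : Measurable fun s => rk (1/2) (z.2 - s) := (measurable_rk _).comp (by fun_prop)
  have m2 : Measurable fun s => H s * H s := hH.mul hH
  calc _ ≤ ∫⁻ s in I, C * (rk (1/2) (z.2 - s) * (H s * H s)) := by
        refine lintegral_mono_ae ?_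
        filter_upwards [ae_restrict_of_ae (ae_ne z.2)] with s hs
        have m3 : Measurable fun y => kk (z.1 - y) (z.2 - s) := kkm (by fun_prop) (by fun_prop)
        rw [lintegral_mul_const _ m3]
        calc _ ≤ (C * rk (1/2) (z.2-s)) * (H s * H s) := mul_le_mul_left (hC _ _ hs) _
          _ = _ := by ring
    _ = C * ∫⁻ s in I, (rk (1/2) (z.2 - s) * (H s * H s)) := lintegral_const_mul' _ _ hCf
    _ ≤ _ := by
      gcongr
      have h := ENNReal.lintegral_mul_le_Lp_mul_Lq (volume.restrict I) (p := 3/2) (q := 3)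
        (Real.holderConjugate_iff.2 ⟨by norm_num, by norm_num⟩) m1.aemeasurable m2.aemeasurable
      simp only [Pi.mul_apply] at h
      refine h.trans ?_
      gcongr
      · have := hls_set (l := 3/4) (by norm_num) (by norm_num) z.2 I
        refine le_trans (le_of_eq ?_) this
        refine lintegral_congr fun t => ?_
        unfold rk
        rw [← ENNReal.rpow_mul]; norm_num
      · refine le_of_eq ?_
        rw [ENNReal.mul_rpow_of_nonneg _ _ (by norm_num), ← ENNReal.rpow_add_of_nonneg _ _ (by norm_num) (by norm_num)]
        norm_num

theorem partC {p q1 q2 q3 : ℝ} (hp : 2 < p) (hq1 : 1 < q1) (hq2 : 1 < q2) (hq3 : 1 < q3)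
    (hpq : 2 / p + (1/q1 + 1/q2 + 1/q3) = 1) {V0 : E3 → ℝ → ℝ≥0∞} (hV0 : Measurable (Function.uncurry V0))
    {ϱ : ℝ} (hϱ : 0 < ϱ) {C E E0 : ℝ≥0∞} {m : ℕ} (hC : C ≠ ∞) (hE : E ≠ ∞) (hE0 : E0 ≠ ∞)
    (hB : PB V0 ϱ C m E)
    (hL2 : ∀ᵐ t ∂(volume.restrict (Ioo (-(ϱ^2)) 0)), ∫⁻ x in ball (0:E3) ϱ, V0 x t * V0 x t ≤ E0)
    (hn : ∫⁻ t in Ioo (-(ϱ^2)) 0, (An q1 q2 q3 ((ball (0:E3) ϱ).indicator (fun x => V0 x t))) ^ p ≠ ∞) :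
    ∃ r > 0, ∃ M : ℝ≥0∞, M ≠ ∞ ∧ ∀ᵐ z ∂(volume.restrict (QQ r)), V0 z.1 z.2 ≤ M := by
  obtain ⟨ε, hε, hit⟩ := iterC hp hq1 hq2 hq3 hpq
  have hp0 : 0 < p := by linarith
  set c := C * 2 ^ m with hc
  have hcf : c ≠ ∞ := ENNReal.mul_ne_top hC (by simp)
  have hη : (ε / (c + 1)) ^ p ≠ 0 := by simp [hε, hcf, hp0.le]
  obtain ⟨δ, hδ, hδs⟩ := exists_pos_setLIntegral_lt_of_measure_lt hn hη
  obtain ⟨d, hd0, hd⟩ := ENNReal.lt_iff_exists_nnreal_btwn.1 hδ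
  have hd0' : (0:ℝ) < d := by exact_mod_cast hd0
  set ρ : ℝ := min (min ϱ 1) d with hρd
  have hρ : 0 < ρ := lt_min (lt_min hϱ one_pos) hd0'
  have hρ1 : ρ ≤ 1 := (min_le_left _ _).trans (min_le_right _ _)
  have hρϱ : ρ ≤ ϱ := (min_le_left _ _).trans (min_le_left _ _)
  have hρd' : ρ ≤ d := min_le_right _ _
  obtain ⟨V, f, hVm, hfm, hV, hfV, hlow, hsub⟩ := step1 hV0 hB hρ hρ1 hρϱ
  set I := Ioo (-(ρ^2)) 0 with hI
  have hIs : I ⊆ Ioo (-(ϱ^2)) 0 := Ioo_subset_Ioo_left (by nlinarith)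
  have hIm : MeasurableSet I := measurableSet_Ioo
  have hIv : volume I = ENNReal.ofReal (ρ^2) := by rw [hI, Real.volume_Ioo]; congr 1; ring
  have hIf : volume I ≠ ∞ := by rw [hIv]; simp
  have hVI : ∀ x, ∀ t ∉ I, V x t = 0 := by
    intro x t ht
    rw [hV, indicator_of_notMem]
    exact fun h => ht h.2
  have hVle : ∀ t, ∀ x, V x t ≤ (ball (0:E3) ϱ).indicator (fun x => V0 x t) x := by
    intro t x
    rw [hV]
    by_cases h : (x, t) ∈ QQ ρ
    · rw [indicator_of_mem h, indicator_of_mem (ball_subset_ball hρϱ h.1)]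
    · rw [indicator_of_notMem h]; exact zero_le
  have hVE : ∀ᵐ t : ℝ, ∫⁻ x, V x t * V x t ≤ E0 := by
    have h1 := (ae_restrict_iff' measurableSet_Ioo).1 hL2
    filter_upwards [h1] with t ht
    by_cases h : t ∈ I
    · refine le_trans ?_ (ht (hIs h))
      rw [← lintegral_indicator measurableSet_ball]
      refine lintegral_mono fun x => ?_
      have := hVle t x
      by_cases hx : x ∈ ball (0:E3) ϱ
      · rw [indicator_of_mem hx] at this ⊢
        gcongr
      · rw [indicator_of_notMem hx] at this ⊢
        simp [le_antisymm this zero_le]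
    · simp [hVI _ t h]
  have hsm : c * (∫⁻ t, An q1 q2 q3 (fun x => V x t) ^ p) ^ (1/p) ≤ ε := by
    have h1 : ∫⁻ t, An q1 q2 q3 (fun x => V x t) ^ p ≤ (ε / (c + 1)) ^ p := by
      have hv : (volume.restrict (Ioo (-(ϱ^2)) 0)) I < δ := by
        rw [Measure.restrict_apply hIm, inter_eq_left.2 hIs, hIv]
        refine lt_of_le_of_lt ?_ hd
        rw [← ENNReal.ofReal_coe_nnreal]
        exact ENNReal.ofReal_le_ofReal (by nlinarith)
      refine le_trans ?_ (hδs I hv).le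
      rw [Measure.restrict_restrict hIm, inter_eq_left.2 hIs, ← lintegral_indicator hIm]
      refine lintegral_mono fun t => ?_
      by_cases h : t ∈ I
      · rw [indicator_of_mem h]
        gcongr
        exact An_mono (by linarith) (by linarith) (by linarith) (hVle t)
      · have : An q1 q2 q3 (fun x => V x t) = 0 := by
          have a1 : 0 < q1 := by linarith
          have a2 : 0 < q2 := by linarith
          have a3 : 0 < q3 := by linarith
          simp only [An, hVI _ t h]
          rw [ENNReal.zero_rpow_of_pos (by positivity), lintegral_zero, ENNReal.zero_rpow_of_pos (by positivity),
            lintegral_zero, ENNReal.zero_rpow_of_pos (by positivity), lintegral_zero,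
            ENNReal.zero_rpow_of_pos (by positivity)]
        simp only [this]
        rw [ENNReal.zero_rpow_of_pos hp0]; exact zero_le
    calc _ ≤ (c + 1) * ((ε / (c + 1)) ^ p) ^ (1/p) := by gcongr; exact le_self_add
      _ = (c + 1) * (ε / (c + 1)) := by rw [← ENNReal.rpow_mul, mul_one_div_cancel hp0.ne', ENNReal.rpow_one]
      _ ≤ ε := ENNReal.mul_div_le
  set M := c * ((ENNReal.ofReal ρ)⁻¹ ^ m * E) with hM
  have hMf : M ≠ ∞ := ENNReal.mul_ne_top hcf (ENNReal.mul_ne_top (ENNReal.pow_ne_top (by simpa using hρ)) hE)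
  obtain ⟨H, hHm, hH6, hfH⟩ := hit I hIm hIf V f hVm hfm hVI hfV c M E0 hcf hE0 hsub hVE hsm
  obtain ⟨Cm, hCm, hmass⟩ := kk_mass
  set G : ℝ → ℝ≥0∞ := fun s => 2 ^ m * (M * H s) with hG
  have hGm : Measurable G := by fun_prop
  have hG6 : ∫⁻ t in I, G t ^ (6:ℝ) ≠ ∞ := by
    have e : ∀ t, G t ^ (6:ℝ) = (2 ^ m * M) ^ (6:ℝ) * H t ^ (6:ℝ) := fun t => by
      rw [← ENNReal.mul_rpow_of_nonneg _ _ (by norm_num)]; simp only [hG]; ring_nf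
    simp only [e]
    have hf2 : (2 ^ m * M) ^ (6:ℝ) ≠ ∞ := ENNReal.rpow_ne_top_of_nonneg (by norm_num) (ENNReal.mul_ne_top (by simp) hMf)
    rw [lintegral_const_mul' _ _ hf2]
    exact ENNReal.mul_ne_top hf2 hH6
  obtain ⟨K, hK, hKb⟩ := final_kernel hCm hmass I hIm hIf G hGm hG6
  have hV0G : ∀ᵐ z : E3 × ℝ, z ∈ QQ (ρ/2) → V0 z.1 z.2 ≤ G z.2 := by
    filter_upwards [hfH] with z hz hzQ
    exact (hlow z hzQ).trans (by simp only [hG]; gcongr)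
  refine ⟨ρ/4, by positivity, C * K + C * ((ENNReal.ofReal (ρ/4))⁻¹ ^ m * E), ?_, ?_⟩
  · refine ENNReal.add_ne_top.2 ⟨ENNReal.mul_ne_top hC hK, ENNReal.mul_ne_top hC (ENNReal.mul_ne_top (ENNReal.pow_ne_top ?_) hE)⟩
    simpa using hρ
  rw [ae_restrict_iff' (QQ_meas _)]
  filter_upwards [hB (ρ/4) (by positivity) (by linarith)] with z hz hzQ
  have hs : Qz z (ρ/4) ⊆ QQ (ρ/2) := Qz_sub (by positivity) (by positivity) hzQ (by linarith)
  refine (hz (hs.trans (QQ_mono (by positivity) (by linarith)))).trans ?_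
  gcongr
  refine le_trans ?_ (hKb z)
  have mm : Measurable fun w : E3 × ℝ => I.indicator (fun _ => (1:ℝ≥0∞)) w.2 * (kk (z.1 - w.1) (z.2 - w.2) * (G w.2 * G w.2)) :=
    ((measurable_const.indicator hIm).comp measurable_snd).mul ((kkm (by fun_prop) (by fun_prop)).mul ((hGm.comp measurable_snd).mul (hGm.comp measurable_snd)))
  have hQm : MeasurableSet (Qz z (ρ/4)) := measurableSet_ball.prod measurableSet_Ioo
  calc _ ≤ ∫⁻ w : E3 × ℝ, I.indicator (fun _ => (1:ℝ≥0∞)) w.2 * (kk (z.1 - w.1) (z.2 - w.2) * (G w.2 * G w.2)) := by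
        rw [← lintegral_indicator hQm]
        refine lintegral_mono_ae ?_
        filter_upwards [hV0G] with w hw
        by_cases h : w ∈ Qz z (ρ/4)
        · have h' := hs h
          have hwI : w.2 ∈ I := (QQ_mono (by positivity) (by linarith) h' : w ∈ QQ ρ).2
          rw [indicator_of_mem h, indicator_of_mem hwI, one_mul]
          have := hw h'
          gcongr
        · rw [indicator_of_notMem h]; exact zero_le
    _ = _ := by
      rw [Measure.volume_eq_prod, lintegral_prod_symm _ mm.aemeasurable, ← lintegral_indicator hIm]
      refine lintegral_congr fun s => ?_
      by_cases h : s ∈ I <;> simp [h]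
end ANS

namespace ANS

/-- space-time -/
abbrev ET : Type := E3 × ℝ

/-- algebra of smooth functions -/
def SS : Subalgebra ℝ (ET → ℝ) where
  carrier := {f | ContDiff ℝ (⊤ : ℕ∞) f}
  mul_mem' := fun {a b} ha hb => by
    rw [mem_ofPred_eq] at *
    exact ContDiff.mul ha hb
  add_mem' := fun {a b} ha hb => by
    rw [mem_ofPred_eq] at *
    exact ContDiff.add ha hb
  algebraMap_mem' := fun r => by
    rw [mem_ofPred_eq]
    exact contDiff_const

lemma smo (f : SS) : ContDiff ℝ (⊤ : ℕ∞) (f : ET → ℝ) := f.2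
lemma dif (f : SS) : Differentiable ℝ (f : ET → ℝ) := (smo f).differentiable (by simp)
lemma con (f : SS) : Continuous (f : ET → ℝ) := (smo f).continuous

/-- directional derivative as a derivation -/
def DV (v : ET) : Derivation ℝ SS SS :=
  Derivation.mk'
    { toFun := fun f => ⟨fun z => fderiv ℝ (f : ET → ℝ) z v, by
        have h := smo f
        exact (h.fderiv_right (m := (⊤ : ℕ∞)) (by simp)).clm_apply contDiff_const⟩
      map_add' := fun f g => by
        ext z
        change fderiv ℝ ((f : ET → ℝ) + (g : ET → ℝ)) z v = _
        rw [fderiv_add (dif f z) (dif g z)]; rfl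
      map_smul' := fun c f => by
        ext z
        change fderiv ℝ (c • (f : ET → ℝ)) z v = _
        rw [fderiv_const_smul (dif f z)]; rfl }
    (fun f g => by
        ext z
        change fderiv ℝ ((f : ET → ℝ) * (g : ET → ℝ)) z v = f.1 z * fderiv ℝ g.1 z v + g.1 z * fderiv ℝ f.1 z v
        rw [fderiv_mul (dif f z) (dif g z)]; rfl)

lemma DV_apply (v : ET) (f : SS) (z : ET) : (DV v f).1 z = fderiv ℝ f.1 z v := rfl

lemma DV_comm (v w : ET) (f : SS) : DV v (DV w f) = DV w (DV v f) := by
  ext z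
  rw [DV_apply, DV_apply]
  have h2 : ContDiff ℝ 2 f.1 := contDiff_infty.1 (smo f) 2
  have hd : Differentiable ℝ (fderiv ℝ f.1) := (h2.fderiv_right (m := 1) (by norm_num)).differentiable (by simp)
  have e : ∀ a b : ET, fderiv ℝ (DV a f).1 z b = fderiv ℝ (fderiv ℝ f.1) z b a := by
    intro a b
    change fderiv ℝ (fun z => fderiv ℝ f.1 z a) z b = _
    rw [fderiv_clm_apply (hd z) (by fun_prop)]
    simp
  rw [e, e]
  exact (h2.contDiffAt.isSymmSndFDerivAt (by simp)) v w

/-- spatial derivations and time derivation -/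
def DI (i : Fin 3) : Derivation ℝ SS SS := DV (EuclideanSpace.single i 1, 0)
def DT : Derivation ℝ SS SS := DV (0, 1)
lemma DI_comm (i j : Fin 3) (f : SS) : DI i (DI j f) = DI j (DI i f) := DV_comm _ _ _
lemma DT_comm (i : Fin 3) (f : SS) : DT (DI i f) = DI i (DT f) := DV_comm _ _ _

def LAP (f : SS) : SS := ∑ i, DI i (DI i f)
def LLL (f : SS) : SS := DT f + LAP f

lemma LAP_DI (i : Fin 3) (f : SS) : LAP (DI i f) = DI i (LAP f) := by
  unfold LAP
  rw [map_sum]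
  refine Finset.sum_congr rfl fun j _ => ?_
  rw [DI_comm j i, DI_comm j i]

lemma LAP_DT (f : SS) : LAP (DT f) = DT (LAP f) := by
  unfold LAP
  rw [map_sum]
  refine Finset.sum_congr rfl fun j _ => ?_
  rw [DT_comm, DT_comm]
lemma LLL_DI (i : Fin 3) (f : SS) : LLL (DI i f) = DI i (LLL f) := by
  unfold LLL
  rw [LAP_DI, DT_comm, map_add]
lemma LAP_add (f g : SS) : LAP (f + g) = LAP f + LAP g := by
  simp [LAP, Finset.sum_add_distrib]
lemma LLL_LAP (f : SS) : LLL (LAP f) = LAP (LLL f) := by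
  unfold LLL
  rw [LAP_add, LAP_DT]
lemma LLL_sub (f g : SS) : LLL (f - g) = LLL f - LLL g := by
  simp only [LLL, LAP, map_sub, Finset.sum_sub_distrib]; ring

/-- vanishing off a closed set is preserved -/
def Van (A : Set ET) (f : SS) : Prop := ∀ z ∉ A, f.1 z = 0
lemma Van.D {A : Set ET} (hA : IsClosed A) {f : SS} (hf : Van A f) (v : ET) : Van A (DV v f) := by
  intro z hz
  rw [DV_apply]
  have : f.1 =ᶠ[nhds z] fun _ => 0 := by
    filter_upwards [hA.isOpen_compl.mem_nhds hz] with w hw using hf w hw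
  rw [this.fderiv_eq]; simp
lemma Van.DI {A : Set ET} (hA : IsClosed A) {f : SS} (hf : Van A f) (i : Fin 3) : Van A (DI i f) := hf.D hA _
lemma Van.DT {A : Set ET} (hA : IsClosed A) {f : SS} (hf : Van A f) : Van A (DT f) := hf.D hA _
lemma Van.mul_left {A : Set ET} {f : SS} (hf : Van A f) (g : SS) : Van A (g * f) := by
  intro z hz
  change g.1 z * f.1 z = 0
  rw [hf z hz, mul_zero]
lemma Van.mul_right {A : Set ET} {f : SS} (hf : Van A f) (g : SS) : Van A (f * g) := by
  rw [mul_comm]; exact hf.mul_left g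
lemma Van.add {A : Set ET} {f g : SS} (hf : Van A f) (hg : Van A g) : Van A (f + g) := by
  intro z hz
  change f.1 z + g.1 z = 0
  rw [hf z hz, hg z hz, add_zero]
lemma Van.sub {A : Set ET} {f g : SS} (hf : Van A f) (hg : Van A g) : Van A (f - g) := by
  intro z hz
  change f.1 z - g.1 z = 0
  rw [hf z hz, hg z hz, sub_zero]
lemma Van.sum {A : Set ET} {f : Fin 3 → SS} (hf : ∀ i, Van A (f i)) : Van A (∑ i, f i) := by
  intro z hz
  simp only [Fin.sum_univ_three]
  exact ((hf 0).add (hf 1)).add (hf 2) z hz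
lemma Van.LAP {A : Set ET} (hA : IsClosed A) {f : SS} (hf : Van A f) : Van A (LAP f) :=
  Van.sum fun i => (hf.D hA _).D hA _
lemma Van.LLL {A : Set ET} (hA : IsClosed A) {f : SS} (hf : Van A f) : Van A (LLL f) :=
  (hf.D hA _).add (hf.LAP hA)
lemma Van.tsupport {A : Set ET} (hA : IsClosed A) {f : SS} (hf : Van A f) : tsupport f.1 ⊆ A := by
  refine closure_minimal (fun z hz => ?_) hA
  by_contra h
  exact hz (hf z h)
lemma Van.compact {A : Set ET} (hA : IsCompact A) {f : SS} (hf : Van A f) : HasCompactSupport f.1 :=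
  hA.of_isClosed_subset (isClosed_tsupport _) (hf.tsupport hA.isClosed)
lemma Van.bdd {A : Set ET} (hA : IsCompact A) {f : SS} (hf : Van A f) : ∃ C : ℝ, 0 ≤ C ∧ ∀ z, |f.1 z| ≤ C := by
  obtain ⟨C, hC⟩ := (hf.compact hA).exists_bound_of_continuous (con f)
  exact ⟨C, (norm_nonneg _).trans (hC 0), hC⟩

end ANS

namespace ANS

lemma pd_slice (f : SS) (i : Fin 3) (x : E3) (t : ℝ) : pd i (fun y => f.1 (y, t)) x = (DI i f).1 (x, t) := by
  unfold pd
  have h := ((dif f (x, t)).hasFDerivAt.comp x (hasFDerivAt_prodMk_left (𝕜 := ℝ) x t)).fderiv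
  change fderiv ℝ (f.1 ∘ fun y => (y, t)) x _ = _
  rw [h]
  rfl

lemma lap_slice (f : SS) (x : E3) (t : ℝ) : lap (fun y => f.1 (y, t)) x = (LAP f).1 (x, t) := by
  unfold lap LAP
  simp only [pd_slice]
  simp [Fin.sum_univ_three]

lemma dt_slice (f : SS) (x : E3) (t : ℝ) : deriv (fun s => f.1 (x, s)) t = (DT f).1 (x, t) := by
  have h := ((dif f (x, t)).hasFDerivAt.comp t (hasFDerivAt_prodMk_right (𝕜 := ℝ) x t)).hasDerivAt.deriv
  change deriv (f.1 ∘ fun s => (x, s)) t = _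
  rw [h]
  rfl

variable {R : ℝ} {u : E3 → ℝ → E3} {P : E3 → ℝ → ℝ}

lemma sol_L2 (sol : SuitableWeakSolution R u P) : ∃ E0 : ℝ≥0∞, E0 ≠ ∞ ∧
    ∀ᵐ t ∂(volume.restrict (Ioo (-(R^2)) 0)), ∫⁻ x in ball (0:E3) R, ‖u x t‖ₑ * ‖u x t‖ₑ ≤ E0 := by
  refine ⟨_, sol.bdd_L2.ne, ?_⟩
  filter_upwards [ENNReal.ae_le_essSup (μ := volume.restrict (Ioo (-(R^2)) 0)) (fun t => ∫⁻ x in ball (0 : E3) R, ((‖u x t‖₊ : ℝ≥0∞)) ^ 2)] with t ht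
  refine le_trans (le_of_eq ?_) ht
  refine lintegral_congr fun x => ?_
  rw [sq]; rfl

lemma lint_QQ (f : ET → ℝ≥0∞) (hf : Measurable f) : ∫⁻ z in QQ R, f z = ∫⁻ t in Ioo (-(R^2)) 0, ∫⁻ x in ball (0:E3) R, f (x, t) := by
  unfold QQ
  rw [Measure.volume_eq_prod, ← Measure.prod_restrict, lintegral_prod_symm _ hf.aemeasurable]

lemma int_QQ (f : ET → ℝ) (hf : IntegrableOn f (QQ R)) : ∫ t in Ioo (-(R^2)) 0, ∫ x in ball (0:E3) R, f (x, t) = ∫ z in QQ R, f z := by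
  unfold IntegrableOn QQ at *
  rw [Measure.volume_eq_prod, ← Measure.prod_restrict] at *
  rw [integral_prod_symm _ hf]

lemma QQ_fin : volume (QQ R) ≠ ∞ := by
  unfold QQ
  rw [Measure.volume_eq_prod, Measure.prod_prod]
  exact ENNReal.mul_ne_top measure_ball_lt_top.ne (by simp)

lemma sol_meas (sol : SuitableWeakSolution R u P) : Measurable fun z : ET => u z.1 z.2 := sol.meas_u
lemma sol_meas_c (sol : SuitableWeakSolution R u P) (k : Fin 3) : Measurable fun z : ET => u z.1 z.2 k := by
  have := sol_meas sol
  fun_prop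

lemma sol_F (sol : SuitableWeakSolution R u P) : ∫⁻ z in QQ R, ‖u z.1 z.2‖ₑ * ‖u z.1 z.2‖ₑ ≠ ∞ := by
  obtain ⟨E0, h0, h⟩ := sol_L2 sol
  have m := sol_meas sol
  rw [lint_QQ (fun z => ‖u z.1 z.2‖ₑ * ‖u z.1 z.2‖ₑ) (by fun_prop)]
  refine ne_top_of_le_ne_top ?_ (lintegral_mono_ae h)
  simp [ENNReal.mul_eq_top, h0]

lemma comp_le (x : E3) (k : Fin 3) : |x k| ≤ ‖x‖ := by
  simpa using PiLp.norm_apply_le x k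

lemma sol_int (sol : SuitableWeakSolution R u P) : IntegrableOn (fun z : ET => ‖u z.1 z.2‖ * ‖u z.1 z.2‖) (QQ R) := by
  have m := sol_meas sol
  refine ⟨by fun_prop, ?_⟩
  refine lt_of_le_of_lt (le_of_eq ?_) (sol_F sol).lt_top
  refine lintegral_congr fun z => ?_
  simp

lemma sol_int2 (sol : SuitableWeakSolution R u P) (i j : Fin 3) (f : SS) (hf : ∃ C : ℝ, 0 ≤ C ∧ ∀ z, |f.1 z| ≤ C) :
    IntegrableOn (fun z : ET => u z.1 z.2 i * u z.1 z.2 j * f.1 z) (QQ R) := by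
  obtain ⟨C, hC0, hC⟩ := hf
  have m := sol_meas sol
  have mf := (con f).measurable
  have m1 := sol_meas_c sol i
  have m2 := sol_meas_c sol j
  refine Integrable.mono' ((sol_int sol).mul_const C) (by fun_prop) (ae_of_all _ fun z => ?_)
  rw [norm_mul, norm_mul]
  simp only [Real.norm_eq_abs]
  have := hC z
  have a1 := comp_le (u z.1 z.2) i
  have a2 := comp_le (u z.1 z.2) j
  gcongr

lemma sol_int1 (sol : SuitableWeakSolution R u P) (i : Fin 3) (f : SS) (hf : ∃ C : ℝ, 0 ≤ C ∧ ∀ z, |f.1 z| ≤ C) :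
    IntegrableOn (fun z : ET => u z.1 z.2 i * f.1 z) (QQ R) := by
  obtain ⟨C, hC0, hC⟩ := hf
  have m := sol_meas sol
  have mf := (con f).measurable
  have m1 := sol_meas_c sol i
  have h1 : IntegrableOn (fun _ : ET => (1:ℝ)) (QQ R) := integrableOn_const QQ_fin
  refine Integrable.mono' ((h1.add (sol_int sol)).mul_const C) (by fun_prop) (ae_of_all _ fun z => ?_)
  rw [norm_mul]
  simp only [Real.norm_eq_abs, Pi.add_apply]
  have := hC z
  have a1 := comp_le (u z.1 z.2) i
  have : |u z.1 z.2 i| ≤ 1 + ‖u z.1 z.2‖ * ‖u z.1 z.2‖ := by nlinarith [sq_nonneg (‖u z.1 z.2‖ - 1), norm_nonneg (u z.1 z.2)]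
  gcongr


lemma SS_sum (f : Fin 3 → SS) (z : ET) : (∑ i, f i : SS).1 z = ∑ i, (f i).1 z := by
  simp [Fin.sum_univ_three]

/-- divergence free test field -/
def WW (Φ : SS) (k j : Fin 3) : SS := DI j (DI k Φ) - (if j = k then LAP Φ else 0)

lemma WW_div (Φ : SS) (k : Fin 3) : ∑ j, DI j (WW Φ k j) = 0 := by
  unfold WW
  simp only [map_sub, Finset.sum_sub_distrib]
  have : ∑ j, DI j (if j = k then LAP Φ else 0) = DI k (LAP Φ) := by
    rw [Finset.sum_eq_single k]
    · simp
    · intro j _ hj; simp [hj]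
    · simp
  rw [this, ← LAP_DI]
  unfold LAP
  simp

lemma Van_WW {A : Set ET} (hA : IsClosed A) {Φ : SS} (h : Van A Φ) (k j : Fin 3) : Van A (WW Φ k j) := by
  unfold WW
  refine ((h.D hA _).D hA _).sub ?_
  split_ifs
  · exact h.LAP hA
  · intro z _; rfl

lemma star_div (sol : SuitableWeakSolution R u P) {A : Set ET} (hA : IsCompact A) (hAR : A ⊆ QQ R) {ψ : SS} (h : Van A ψ) :
    ∑ i, ∫ z in QQ R, u z.1 z.2 i * (DI i ψ).1 z = 0 := by
  have hA' := hA.isClosed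
  have ht : IsTest R (fun x t => ψ.1 (x, t)) := ⟨smo ψ, h.compact hA, (h.tsupport hA').trans hAR⟩
  have := sol.weak_div _ ht
  simp only [pd_slice] at this
  rw [← this]
  have hi : ∀ i, IntegrableOn (fun z : ET => u z.1 z.2 i * (DI i ψ).1 z) (QQ R) := fun i =>
    sol_int1 sol i _ ((h.DI hA' _).bdd hA)
  rw [← integral_finsetSum _ (fun i _ => hi i)]
  rw [← int_QQ _ (integrable_finsetSum _ fun i _ => hi i)]

lemma star_NS (sol : SuitableWeakSolution R u P) {A : Set ET} (hA : IsCompact A) (hAR : A ⊆ QQ R) {w : Fin 3 → SS} (h : ∀ j, Van A (w j))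
    (hd : ∑ j, DI j (w j) = 0) :
    ∑ i, ∫ z in QQ R, u z.1 z.2 i * (LLL (w i)).1 z = - ∑ i, ∑ j, ∫ z in QQ R, u z.1 z.2 i * u z.1 z.2 j * (DI i (w j)).1 z := by
  have hA' := hA.isClosed
  have ht : IsTestV R (fun x t => WithLp.toLp 2 (fun j => (w j).1 (x, t))) := by
    have hv : ∀ z ∉ A, (WithLp.toLp 2 (fun j => (w j).1 z) : E3) = 0 := by
      intro z hz
      ext j
      simpa using h j z hz
    have ht : tsupport (fun z : ET => (WithLp.toLp 2 (fun j => (w j).1 z) : E3)) ⊆ A := by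
      refine closure_minimal (fun z hz => ?_) hA'
      by_contra h
      exact hz (hv z h)
    refine ⟨?_, hA.of_isClosed_subset (isClosed_tsupport _) ht, ht.trans hAR⟩
    rw [contDiff_euclidean]
    exact fun j => smo (w j)
  have := sol.weak_NS _ ht
  simp only [pd_slice, lap_slice, dt_slice] at this
  have hd' : ∀ z, ∑ j, (DI j (w j)).1 z = 0 := fun z => by rw [← SS_sum, hd]; rfl
  have hi1 : ∀ i, IntegrableOn (fun z : ET => u z.1 z.2 i * (LLL (w i)).1 z) (QQ R) := fun i =>
    sol_int1 sol i _ (((h i).LLL hA').bdd hA)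
  have hi2 : ∀ i j, IntegrableOn (fun z : ET => u z.1 z.2 i * u z.1 z.2 j * (DI i (w j)).1 z) (QQ R) := fun i j =>
    sol_int2 sol i j _ (((h j).DI hA' _).bdd hA)
  have hi1s := integrable_finsetSum (μ := volume.restrict (QQ R)) Finset.univ fun i _ => hi1 i
  have hi2s := integrable_finsetSum (μ := volume.restrict (QQ R)) Finset.univ fun i _ => integrable_finsetSum Finset.univ fun j _ => hi2 i j
  have e : ∫ z in QQ R, (-((∑ i, u z.1 z.2 i * (LLL (w i)).1 z) + ∑ i, ∑ j, u z.1 z.2 i * u z.1 z.2 j * (DI i (w j)).1 z)) = 0 := by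
    refine (int_QQ _ (hi1s.add hi2s).neg).symm.trans (Eq.trans ?_ this)
    refine integral_congr_ae (ae_of_all _ fun t => ?_)
    refine integral_congr_ae (ae_of_all _ fun x => ?_)
    have := hd' (x, t)
    simp only [this, LLL]
    simp only [Fin.sum_univ_three, AddMemClass.coe_add, Pi.add_apply, Pi.neg_apply]
    ring
  rw [integral_neg, integral_add hi1s hi2s, integral_finsetSum _ (fun i _ => hi1 i), integral_finsetSum _ (fun i _ => integrable_finsetSum Finset.univ fun j _ => hi2 i j)] at e
  simp_rw [integral_finsetSum _ (fun j _ => hi2 _ j)] at e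
  linarith

lemma star (sol : SuitableWeakSolution R u P) {A : Set ET} (hA : IsCompact A) (hAR : A ⊆ QQ R) {Φ : SS} (h : Van A Φ) (k : Fin 3) :
    ∫ z in QQ R, u z.1 z.2 k * (LLL (LAP Φ)).1 z = ∑ i, ∑ j, ∫ z in QQ R, u z.1 z.2 i * u z.1 z.2 j * (DI i (WW Φ k j)).1 z := by
  have hA' := hA.isClosed
  have h1 := star_NS sol hA hAR (fun j => Van_WW hA' h k j) (WW_div Φ k)
  have h2 := star_div sol hA hAR (((h.DI hA' _).LLL hA') : Van A (LLL (DI k Φ)))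
  have e : ∀ i, ∫ z in QQ R, u z.1 z.2 i * (LLL (WW Φ k i)).1 z = (∫ z in QQ R, u z.1 z.2 i * (DI i (LLL (DI k Φ))).1 z)
      - if i = k then ∫ z in QQ R, u z.1 z.2 k * (LLL (LAP Φ)).1 z else 0 := by
    intro i
    unfold WW
    rw [LLL_sub, LLL_DI]
    split_ifs with hik
    · subst hik
      rw [← integral_sub (sol_int1 sol i _ (((((h.DI hA' _).LLL hA').DI hA' _)).bdd hA)) (sol_int1 sol i _ (((h.LAP hA').LLL hA').bdd hA))]
      refine integral_congr_ae (ae_of_all _ fun z => ?_)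
      simp only [AddSubgroupClass.coe_sub, Pi.sub_apply]
      ring
    · have : LLL 0 = 0 := by simp [LLL, LAP]
      rw [this, sub_zero, sub_zero]
  simp only [e, Finset.sum_sub_distrib, h2] at h1
  simp at h1
  rw [← h1]

/-- final form of part A -/
lemma partA (sol : SuitableWeakSolution R u P) {A : Set ET} (hA : IsCompact A) (hAR : A ⊆ QQ R) {Φ : SS} (h : Van A Φ) (k : Fin 3) :
    ‖∫ z, (QQ R).indicator (fun z => u z.1 z.2 k) z * (LLL (LAP Φ)).1 z‖ₑ ≤
      36 * ∫⁻ z, (QQ R).indicator (fun z => ‖u z.1 z.2‖ₑ * ‖u z.1 z.2‖ₑ) z * ∑ i, ∑ j, ∑ l, ‖(DI i (DI j (DI l Φ))).1 z‖ₑ := by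
  have hA' := hA.isClosed
  have e1 : ∫ z, (QQ R).indicator (fun z => u z.1 z.2 k) z * (LLL (LAP Φ)).1 z = ∫ z in QQ R, u z.1 z.2 k * (LLL (LAP Φ)).1 z := by
    rw [← integral_indicator (QQ_meas R)]
    refine integral_congr_ae (ae_of_all _ fun z => ?_)
    by_cases hz : z ∈ QQ R <;> simp [hz]
  have e2 : ∫⁻ z, (QQ R).indicator (fun z => ‖u z.1 z.2‖ₑ * ‖u z.1 z.2‖ₑ) z * ∑ i, ∑ j, ∑ l, ‖(DI i (DI j (DI l Φ))).1 z‖ₑ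
      = ∫⁻ z in QQ R, ‖u z.1 z.2‖ₑ * ‖u z.1 z.2‖ₑ * ∑ i, ∑ j, ∑ l, ‖(DI i (DI j (DI l Φ))).1 z‖ₑ := by
    rw [← lintegral_indicator (QQ_meas R)]
    refine lintegral_congr fun z => ?_
    by_cases hz : z ∈ QQ R <;> simp [hz]
  rw [e1, e2, star sol hA hAR h k]
  set S : ET → ℝ≥0∞ := fun z => ∑ i, ∑ j, ∑ l, ‖(DI i (DI j (DI l Φ))).1 z‖ₑ with hS
  have hterm : ∀ z i j l, ‖(DI i (DI j (DI l Φ))).1 z‖ₑ ≤ S z := by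
    intro z i j l
    refine le_trans ?_ (Finset.single_le_sum (f := fun i => ∑ j, ∑ l, ‖(DI i (DI j (DI l Φ))).1 z‖ₑ) (fun _ _ => zero_le) (Finset.mem_univ i))
    refine le_trans ?_ (Finset.single_le_sum (f := fun j => ∑ l, ‖(DI i (DI j (DI l Φ))).1 z‖ₑ) (fun _ _ => zero_le) (Finset.mem_univ j))
    exact (Finset.single_le_sum (f := fun l => ‖(DI i (DI j (DI l Φ))).1 z‖ₑ) (fun _ _ => zero_le) (Finset.mem_univ l))
  have hW : ∀ z i j, ‖(DI i (WW Φ k j)).1 z‖ₑ ≤ 4 * S z := by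
    intro z i j
    have h3 : ‖(DI i (LAP Φ)).1 z‖ₑ ≤ 3 * S z := by
      unfold LAP
      rw [map_sum, SS_sum, Fin.sum_univ_three]
      calc _ ≤ S z + S z + S z := by
            refine (enorm_add_le _ _).trans ?_
            refine add_le_add ((enorm_add_le _ _).trans ?_) (hterm z i 2 2)
            exact add_le_add (hterm z i 0 0) (hterm z i 1 1)
        _ = _ := by ring
    unfold WW
    rw [map_sub]
    calc _ ≤ S z + 3 * S z := by
          change ‖(DI i (DI j (DI k Φ))).1 z - (DI i (if j = k then LAP Φ else 0)).1 z‖ₑ ≤ _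
          refine (enorm_sub_le).trans ?_
          refine add_le_add (hterm z i j k) ?_
          split_ifs
          · exact h3
          · simp
      _ = _ := by ring
  have hcomp : ∀ z : ET, ∀ i, ‖u z.1 z.2 i‖ₑ ≤ ‖u z.1 z.2‖ₑ := by
    intro z i
    exact enorm_le_iff_norm_le.2 (comp_le _ i)
  have hij : ∀ i j, ‖∫ z in QQ R, u z.1 z.2 i * u z.1 z.2 j * (DI i (WW Φ k j)).1 z‖ₑ ≤ 4 * ∫⁻ z in QQ R, ‖u z.1 z.2‖ₑ * ‖u z.1 z.2‖ₑ * S z := by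
    intro i j
    refine (enorm_integral_le_lintegral_enorm _).trans ?_
    rw [← lintegral_const_mul' _ _ (by simp)]
    refine lintegral_mono fun z => ?_
    rw [enorm_mul, enorm_mul]
    calc _ ≤ ‖u z.1 z.2‖ₑ * ‖u z.1 z.2‖ₑ * (4 * S z) := by
          gcongr
          · exact hcomp z i
          · exact hcomp z j
          · exact hW z i j
      _ = _ := by ring
  calc _ ≤ ∑ i : Fin 3, ∑ j : Fin 3, 4 * ∫⁻ z in QQ R, ‖u z.1 z.2‖ₑ * ‖u z.1 z.2‖ₑ * S z := by
        refine (enorm_sum_le _ _).trans (Finset.sum_le_sum fun i _ => ?_)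
        refine (enorm_sum_le _ _).trans (Finset.sum_le_sum fun j _ => hij i j)
    _ = _ := by
      change _ = 36 * ∫⁻ z in QQ R, ‖u z.1 z.2‖ₑ * ‖u z.1 z.2‖ₑ * S z
      generalize ∫⁻ z in QQ R, ‖u z.1 z.2‖ₑ * ‖u z.1 z.2‖ₑ * S z = I
      simp only [Finset.sum_const, Finset.card_univ, Fintype.card_fin, nsmul_eq_mul]
      push_cast
      ring

end ANS

namespace ANS

/-- coordinate functions -/
def yy (i : Fin 3) : SS := ⟨fun z => z.1 i, by
  change ContDiff ℝ (⊤ : ℕ∞) fun z : ET => z.1 i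
  fun_prop⟩
/-- functions of time -/
def TF (f : ℝ → ℝ) (hf : ContDiff ℝ (⊤ : ℕ∞) f) : SS := ⟨fun z => f z.2, hf.comp contDiff_snd⟩
/-- exponentials -/
def EX (e : SS) : SS := ⟨fun z => Real.exp (e.1 z), (smo e).exp⟩

lemma DI_yy (i j : Fin 3) : DI i (yy j) = if i = j then 1 else 0 := by
  ext z
  have : fderiv ℝ (fun z : ET => z.1 j) z = (EuclideanSpace.proj j).comp (ContinuousLinearMap.fst ℝ E3 ℝ) :=
    ((EuclideanSpace.proj j : E3 →L[ℝ] ℝ).comp (ContinuousLinearMap.fst ℝ E3 ℝ)).fderiv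
  change fderiv ℝ (fun z : ET => z.1 j) z (EuclideanSpace.single i 1, 0) = _
  rw [this]
  by_cases h : i = j
  · subst h; simp
  · have h' : j ≠ i := fun e => h e.symm
    simp [h, h']

lemma DT_yy (j : Fin 3) : DT (yy j) = 0 := by
  ext z
  have : fderiv ℝ (fun z : ET => z.1 j) z = (EuclideanSpace.proj j).comp (ContinuousLinearMap.fst ℝ E3 ℝ) :=
    ((EuclideanSpace.proj j : E3 →L[ℝ] ℝ).comp (ContinuousLinearMap.fst ℝ E3 ℝ)).fderiv
  change fderiv ℝ (fun z : ET => z.1 j) z (0, 1) = _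
  rw [this]
  simp

lemma cd_deriv {f : ℝ → ℝ} (hf : ContDiff ℝ (⊤ : ℕ∞) f) : ContDiff ℝ (⊤ : ℕ∞) (deriv f) :=
  (contDiff_infty_iff_deriv.1 hf).2

lemma TF_fd {f : ℝ → ℝ} (hf : ContDiff ℝ (⊤ : ℕ∞) f) (z v : ET) : fderiv ℝ (TF f hf).1 z v = deriv f z.2 * v.2 := by
  have h1 : HasDerivAt f (deriv f z.2) z.2 := (hf.differentiable (by simp) z.2).hasDerivAt
  have h2 : HasFDerivAt (fun z : ET => z.2) (ContinuousLinearMap.snd ℝ E3 ℝ) z := hasFDerivAt_snd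
  have := (h1.comp_hasFDerivAt z h2).fderiv
  change fderiv ℝ (f ∘ fun z : ET => z.2) z v = _
  rw [this]; simp

lemma DI_TF {f : ℝ → ℝ} (hf : ContDiff ℝ (⊤ : ℕ∞) f) (i : Fin 3) : DI i (TF f hf) = 0 := by
  ext z
  change fderiv ℝ (TF f hf).1 z _ = 0
  rw [TF_fd]; simp
lemma DT_TF {f : ℝ → ℝ} (hf : ContDiff ℝ (⊤ : ℕ∞) f) : DT (TF f hf) = TF (deriv f) (cd_deriv hf) := by
  ext z
  change fderiv ℝ (TF f hf).1 z _ = deriv f z.2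
  rw [TF_fd]; simp
lemma DV_EX (e : SS) (v : ET) : DV v (EX e) = DV v e * EX e := by
  ext z
  change fderiv ℝ (fun z => Real.exp (e.1 z)) z v = fderiv ℝ e.1 z v * Real.exp (e.1 z)
  rw [((dif e z).hasFDerivAt.exp).fderiv]
  simp [mul_comm]

section G
variable (σ : ℝ → ℝ) (hs : ContDiff ℝ (⊤ : ℕ∞) σ) (hp : ∀ s, 0 < σ s)

/-- 1/(2σ) -/
def RH : SS := TF (fun s => (2 * σ s)⁻¹) ((contDiff_const.mul hs).inv fun s => (by have := hp s; positivity))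
/-- σ' -/
def SP : SS := TF (deriv σ) (cd_deriv hs)
/-- |y|^2 -/
def NN : SS := ∑ i, yy i * yy i
def GE : SS := TF (fun s => -(3/2) * Real.log (σ s)) (contDiff_const.mul (hs.log fun s => (hp s).ne'))
  + (-(1/2) : ℝ) • (NN * RH σ hs hp)
/-- Gaussian -/
def GG : SS := EX (GE σ hs hp)

lemma DI_RH (i : Fin 3) : DI i (RH σ hs hp) = 0 := DI_TF _ _
lemma DI_SP (i : Fin 3) : DI i (SP σ hs) = 0 := DI_TF _ _
lemma DI_NN (i : Fin 3) : DI i NN = 2 * yy i := by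
  unfold NN
  simp only [map_sum, Derivation.leibniz, DI_yy, smul_eq_mul]
  fin_cases i <;> simp [Fin.sum_univ_three] <;> ring
lemma DT_NN : DT NN = 0 := by
  unfold NN
  simp [Derivation.leibniz, DT_yy]
lemma half_two (x : SS) : (-(1/2):ℝ) • (2 * x) = -x := by
  have : (2 * x : SS) = (2:ℝ) • x := by rw [two_mul, two_smul]
  rw [this, smul_smul]; norm_num

lemma DI_GG (i : Fin 3) : DI i (GG σ hs hp) = - (yy i * RH σ hs hp) * GG σ hs hp := by
  unfold GG
  have h := DV_EX (GE σ hs hp) (EuclideanSpace.single i 1, 0)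
  change DI i _ = DI i _ * _ at h
  rw [h]
  congr 1
  unfold GE
  rw [map_add, DI_TF, Derivation.map_smul, Derivation.leibniz, DI_RH, DI_NN, zero_add, smul_zero, zero_add, smul_eq_mul]
  rw [← half_two]; congr 1; ring

lemma DT_RH : DT (RH σ hs hp) = - 2 * (RH σ hs hp * RH σ hs hp * SP σ hs) := by
  unfold RH
  rw [DT_TF]
  ext z
  change deriv (fun s => (2 * σ s)⁻¹) z.2 = -2 * ((2 * σ z.2)⁻¹ * (2 * σ z.2)⁻¹ * deriv σ z.2)
  have h1 : HasDerivAt σ (deriv σ z.2) z.2 := (hs.differentiable (by simp) z.2).hasDerivAt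
  have := hp z.2
  refine (((h1.const_mul 2).inv (by positivity)).deriv).trans ?_
  field_simp

lemma DT_GG : DT (GG σ hs hp) = SP σ hs * ((NN * RH σ hs hp * RH σ hs hp - 3 * RH σ hs hp) * GG σ hs hp) := by
  unfold GG
  have h := DV_EX (GE σ hs hp) (0, 1)
  change DT _ = DT _ * _ at h
  rw [h, ← mul_assoc]
  congr 1
  unfold GE
  rw [map_add, DT_TF, Derivation.map_smul, Derivation.leibniz, DT_RH, DT_NN, smul_zero, add_zero, smul_eq_mul]
  have : (-(1/2):ℝ) • (NN * (-2 * (RH σ hs hp * RH σ hs hp * SP σ hs))) = NN * (RH σ hs hp * RH σ hs hp * SP σ hs) := by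
    rw [show (NN * (-2 * (RH σ hs hp * RH σ hs hp * SP σ hs))) = 2 * (-(NN * (RH σ hs hp * RH σ hs hp * SP σ hs))) by ring, half_two, neg_neg]
  rw [this]
  have e : TF (deriv fun s => -(3/2) * Real.log (σ s)) (cd_deriv (contDiff_const.mul (hs.log fun s => (hp s).ne'))) = - (3 * (RH σ hs hp * SP σ hs)) := by
    ext z
    change deriv (fun s => -(3/2) * Real.log (σ s)) z.2 = -(3 * ((2 * σ z.2)⁻¹ * deriv σ z.2))
    have h1 : HasDerivAt σ (deriv σ z.2) z.2 := (hs.differentiable (by simp) z.2).hasDerivAt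
    have := hp z.2
    rw [((h1.log this.ne').const_mul _).deriv]
    field_simp
  rw [e]; ring

lemma DIJ_GG (i j : Fin 3) : DI i (DI j (GG σ hs hp)) = (yy i * yy j * (RH σ hs hp * RH σ hs hp) - (if i = j then 1 else 0) * RH σ hs hp) * GG σ hs hp := by
  rw [DI_GG]
  simp only [map_neg, Derivation.leibniz, DI_GG, DI_RH, DI_yy, smul_eq_mul]
  ring

lemma DIJK_GG (i j k : Fin 3) : DI i (DI j (DI k (GG σ hs hp))) =
    (-(yy i * yy j * yy k * (RH σ hs hp * RH σ hs hp * RH σ hs hp)) + ((if i = j then 1 else 0) * yy k + (if i = k then 1 else 0) * yy j + (if j = k then 1 else 0) * yy i) * (RH σ hs hp * RH σ hs hp)) * GG σ hs hp := by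
  rw [DIJ_GG]
  simp only [map_sub, Derivation.leibniz, DI_GG, DI_RH, DI_yy, smul_eq_mul]
  have : DI i (if j = k then (1:SS) else 0) = 0 := by split_ifs <;> simp
  rw [this]
  ring

lemma LAP_GG : LAP (GG σ hs hp) = (NN * RH σ hs hp * RH σ hs hp - 3 * RH σ hs hp) * GG σ hs hp := by
  unfold LAP
  simp only [DIJ_GG, NN, Fin.sum_univ_three, if_true]
  ring

lemma LLL_GG : LLL (GG σ hs hp) = (1 + SP σ hs) * LAP (GG σ hs hp) := by
  unfold LLL
  rw [DT_GG, LAP_GG]; ring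
end G

end ANS

namespace ANS

/-- parameters -/
structure Par where
  e : ℝ
  l : ℝ
  he : 0 < e
  he' : e ≤ 1/8
  hl : 0 < l
  hl' : l ≤ 1

/-- smooth positive extension of e + l - s -/
def sgf (e l s : ℝ) : ℝ := e + l - s * Real.smoothTransition (1 - 2 * s / e)
lemma sgf_smooth (e l : ℝ) : ContDiff ℝ (⊤ : ℕ∞) (sgf e l) := by
  unfold sgf
  refine contDiff_const.sub (contDiff_id.mul (Real.smoothTransition.contDiff.comp ?_))
  fun_prop
lemma sgf_neg {e : ℝ} (he : 0 < e) (l : ℝ) {s : ℝ} (hs : s ≤ 0) : sgf e l s = e + l - s := by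
  unfold sgf
  rw [Real.smoothTransition.one_of_one_le, mul_one]
  have : 2 * s / e ≤ 0 := div_nonpos_of_nonpos_of_nonneg (by linarith) he.le
  linarith
lemma sgf_pos {e l : ℝ} (he : 0 < e) (hl : 0 < l) (s : ℝ) : 0 < sgf e l s := by
  rcases le_or_gt s 0 with h | h
  · rw [sgf_neg he l h]; linarith
  · unfold sgf
    rcases le_or_gt (e/2) s with h2 | h2
    · rw [Real.smoothTransition.zero_of_nonpos]
      · linarith
      · have : 1 ≤ 2 * s / e := by rw [le_div_iff₀ he]; linarith
        linarith
    · have := Real.smoothTransition.le_one (1 - 2 * s / e)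
      have := Real.smoothTransition.nonneg (1 - 2 * s / e)
      nlinarith

def gg (p : Par) : SS := GG (sgf p.e p.l) (sgf_smooth _ _) (sgf_pos p.he p.hl)
def rho (p : Par) : SS := RH (sgf p.e p.l) (sgf_smooth _ _) (sgf_pos p.he p.hl)
def ssp (p : Par) : SS := SP (sgf p.e p.l) (sgf_smooth _ _)

/-- cutoff in time -/
def hf (e s : ℝ) : ℝ := Real.smoothTransition (-s / e - 1)
lemma hf_smooth (e : ℝ) : ContDiff ℝ (⊤ : ℕ∞) (hf e) := by
  unfold hf
  refine Real.smoothTransition.contDiff.comp ?_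
  fun_prop
def hh (e : ℝ) : SS := TF (hf e) (hf_smooth e)
def hh' (e : ℝ) : SS := TF (deriv (hf e)) (cd_deriv (hf_smooth e))

/-- region -/
def Reg : Set ET := {z | ‖z.1‖ ≤ 1 ∧ -1 ≤ z.2 ∧ z.2 ≤ 0}
def th (p : Par) (z : ET) : ℝ := p.e + p.l - z.2 + ‖z.1‖ ^ 2

lemma base {σ n v : ℝ} (hσ : 0 < σ) (hσ3 : σ ≤ 3) (hn : 0 ≤ n) (hv : 0 < v) (hvσ : v ^ 2 * σ = 1) {a k : ℕ} (ha : a ≤ 3) (hk : k ≤ 6) :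
    (n * v) ^ a * v ^ k * Real.exp (-(n * v) ^ 2 / 4) ≤ 204800000 * ((σ + n ^ 2)⁻¹) ^ 3 := by
  have hw : 0 ≤ n * v := by positivity
  set w := n * v with hwd
  have h1 : w ^ a ≤ (1 + w ^ 2) ^ 2 := by
    interval_cases a
    · nlinarith [sq_nonneg w, sq_nonneg (w^2)]
    · nlinarith [sq_nonneg (w-1), sq_nonneg (w^2)]
    · nlinarith [sq_nonneg w, sq_nonneg (w^2)]
    · nlinarith [sq_nonneg (w-1), sq_nonneg (w^2-w)]
  have h2 : v ^ k ≤ 64 * v ^ 6 := by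
    have hv2 : 1 / 2 ≤ v := by
      by_contra h
      push Not at h
      nlinarith
    have h3 : (1:ℝ) ≤ (2 * v) ^ (6 - k) := one_le_pow₀ (by linarith)
    have h4 : (2:ℝ) ^ (6 - k) ≤ 64 := by
      calc (2:ℝ) ^ (6 - k) ≤ 2 ^ 6 := pow_le_pow_right₀ (by norm_num) (by omega)
        _ = 64 := by norm_num
    calc v ^ k ≤ v ^ k * (2 * v) ^ (6 - k) := le_mul_of_one_le_right (by positivity) h3
      _ = 2 ^ (6 - k) * (v ^ k * v ^ (6 - k)) := by rw [mul_pow]; ring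
      _ = 2 ^ (6 - k) * v ^ 6 := by rw [← pow_add]; congr 2; omega
      _ ≤ _ := by gcongr
  have h5 : (1 + w ^ 2) ^ 5 * Real.exp (-w ^ 2 / 4) ≤ 3200000 := by
    have h6 : 1 + w ^ 2 / 20 ≤ Real.exp (w ^ 2 / 20) := by linarith [Real.add_one_le_exp (w ^ 2 / 20)]
    have h7 : (1 + w ^ 2) ≤ 20 * Real.exp (w ^ 2 / 20) := by nlinarith [sq_nonneg w]
    calc (1 + w ^ 2) ^ 5 * Real.exp (-w ^ 2 / 4) ≤ (20 * Real.exp (w ^ 2 / 20)) ^ 5 * Real.exp (-w ^ 2 / 4) := by gcongr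
      _ = 3200000 * (Real.exp (w ^ 2 / 20) ^ 5 * Real.exp (-w ^ 2 / 4)) := by ring
      _ = 3200000 := by
        rw [← Real.exp_nat_mul, ← Real.exp_add]
        have : (((5:ℕ):ℝ) * (w ^ 2 / 20) + -w ^ 2 / 4) = 0 := by push_cast; ring
        rw [this]; simp
  have h8 : v ^ 6 = (1 + w ^ 2) ^ 3 * ((σ + n ^ 2)⁻¹) ^ 3 := by
    have : σ + n ^ 2 ≠ 0 := by positivity
    have e : v ^ 2 * (σ + n ^ 2) = 1 + w ^ 2 := by rw [mul_add, hvσ, hwd]; ring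
    rw [← mul_pow, ← e, mul_assoc, mul_inv_cancel₀ this, mul_one]; ring
  calc w ^ a * v ^ k * Real.exp (-w ^ 2 / 4) ≤ (1 + w ^ 2) ^ 2 * (64 * v ^ 6) * Real.exp (-w ^ 2 / 4) := by gcongr
    _ = 64 * ((1 + w ^ 2) ^ 5 * Real.exp (-w ^ 2 / 4)) * ((σ + n ^ 2)⁻¹) ^ 3 := by rw [h8]; ring
    _ ≤ 64 * 3200000 * ((σ + n ^ 2)⁻¹) ^ 3 := by gcongr
    _ = _ := by norm_num

/-- kernel bound predicate -/
def GB (f : Par → SS) : Prop := ∃ C : ℝ, 0 ≤ C ∧ ∀ p, ∀ z ∈ Reg, |(f p).1 z| ≤ C * ((th p z)⁻¹) ^ 3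

lemma gg_val (p : Par) {z : ET} (hz : z.2 ≤ 0) : ∃ v : ℝ, 0 < v ∧ v ^ 2 * (p.e + p.l - z.2) = 1 ∧ (rho p).1 z = v ^ 2 / 2 ∧
    (gg p).1 z = v ^ 3 * Real.exp (-(‖z.1‖ * v) ^ 2 / 4) := by
  have hσ : 0 < p.e + p.l - z.2 := by have := p.he; have := p.hl; linarith
  set σ := p.e + p.l - z.2 with hσd
  have hv2 : Real.exp (-(1/2) * Real.log σ) ^ 2 = σ⁻¹ := by
    rw [← Real.exp_nat_mul, ← Real.exp_log (inv_pos.2 hσ), Real.log_inv]; congr 1; push_cast; ring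
  refine ⟨Real.exp (-(1/2) * Real.log σ), Real.exp_pos _, ?_, ?_, ?_⟩
  · rw [hv2]; exact inv_mul_cancel₀ hσ.ne'
  · change (2 * sgf p.e p.l z.2)⁻¹ = _
    rw [sgf_neg p.he _ hz, hv2, mul_inv]; ring
  · have hN : (NN).1 z = ‖z.1‖ ^ 2 := by
      unfold NN
      rw [SS_sum, EuclideanSpace.real_norm_sq_eq]
      refine Finset.sum_congr rfl fun i _ => ?_
      change z.1 i * z.1 i = _
      ring
    change Real.exp (-(3/2) * Real.log (sgf p.e p.l z.2) + (-(1/2)) * ((NN).1 z * (2 * sgf p.e p.l z.2)⁻¹)) = _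
    rw [sgf_neg p.he _ hz, hN, mul_pow, hv2, ← Real.exp_nat_mul, ← Real.exp_add]
    congr 1
    rw [mul_inv]; push_cast; ring

lemma gb_aux (f : Par → SS) (h : ∀ p, ∀ z ∈ Reg, ∀ n v : ℝ, 0 ≤ n → 0 < v → (∀ i, |(yy i).1 z| ≤ n) → (rho p).1 z = v ^ 2 / 2 →
    (gg p).1 z = v ^ 3 * Real.exp (-(n * v) ^ 2 / 4) → (∀ a k : ℕ, a ≤ 3 → k ≤ 6 → (n * v) ^ a * v ^ k * Real.exp (-(n * v) ^ 2 / 4) ≤ 204800000 * ((th p z)⁻¹) ^ 3) →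
    |(f p).1 z| ≤ 10 * (204800000 * ((th p z)⁻¹) ^ 3)) : GB f := by
  refine ⟨10 * 204800000, by norm_num, fun p z hz => ?_⟩
  obtain ⟨h1, h2, h3⟩ := hz
  obtain ⟨v, hv, hvs, hr, hg⟩ := gg_val p h3
  rw [mul_assoc]
  refine h p z ⟨h1, h2, h3⟩ ‖z.1‖ v (norm_nonneg _) hv (fun i => comp_le _ i) hr hg ?_
  intro a k ha hk
  refine base ?_ ?_ (norm_nonneg _) hv hvs ha hk
  · have := p.he; have := p.hl; linarith
  · have := p.he'; have := p.hl'; linarith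

lemma ite_abs (c : Prop) [Decidable c] (z : ET) : |((if c then 1 else 0 : SS)).1 z| ≤ 1 := by
  split_ifs
  · change |(1:ℝ)| ≤ 1; simp
  · change |(0:ℝ)| ≤ 1; simp

lemma gb0 : GB gg := by
  refine gb_aux _ fun p z _ n v hn hv hy hr hg hb => ?_
  have := hb 0 3 (by norm_num) (by norm_num)
  rw [hg, abs_of_nonneg (by positivity)]
  have h0 : 0 ≤ (n * v) ^ 0 * v ^ 3 * Real.exp (-(n * v) ^ 2 / 4) := by positivity
  simp only [pow_zero, one_mul] at *
  linarith

lemma gb1 (i : Fin 3) : GB fun p => DI i (gg p) := by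
  refine gb_aux _ fun p z _ n v hn hv hy hr hg hb => ?_
  have h1 := hb 1 4 (by norm_num) (by norm_num)
  have e : (DI i (gg p)).1 z = -((yy i).1 z * (rho p).1 z) * (gg p).1 z := by
    have := DI_GG (sgf p.e p.l) (sgf_smooth _ _) (sgf_pos p.he p.hl) i
    exact congrFun (congrArg Subtype.val this) z
  rw [e, hr, hg, abs_mul, abs_neg, abs_mul]
  rw [abs_of_nonneg (by positivity : 0 ≤ v ^ 2 / 2), abs_of_nonneg (by positivity : 0 ≤ v ^ 3 * Real.exp (-(n * v) ^ 2 / 4))]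
  have := hy i
  have h0 : 0 ≤ (n * v) ^ 1 * v ^ 4 * Real.exp (-(n * v) ^ 2 / 4) := by positivity
  calc |(yy i).1 z| * (v ^ 2 / 2) * (v ^ 3 * Real.exp (-(n * v) ^ 2 / 4)) ≤ n * (v ^ 2 / 2) * (v ^ 3 * Real.exp (-(n * v) ^ 2 / 4)) := by gcongr
    _ = 1/2 * ((n * v) ^ 1 * v ^ 4 * Real.exp (-(n * v) ^ 2 / 4)) := by ring
    _ ≤ _ := by linarith

lemma gb2 (i j : Fin 3) : GB fun p => DI i (DI j (gg p)) := by
  refine gb_aux _ fun p z _ n v hn hv hy hr hg hb => ?_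
  have h1 := hb 2 5 (by norm_num) (by norm_num)
  have h2 := hb 0 5 (by norm_num) (by norm_num)
  have e : (DI i (DI j (gg p))).1 z = ((yy i).1 z * (yy j).1 z * ((rho p).1 z * (rho p).1 z) - (if i = j then 1 else 0 : SS).1 z * (rho p).1 z) * (gg p).1 z := by
    have := DIJ_GG (sgf p.e p.l) (sgf_smooth _ _) (sgf_pos p.he p.hl) i j
    exact congrFun (congrArg Subtype.val this) z
  rw [e, hr, hg, abs_mul]
  rw [abs_of_nonneg (by positivity : 0 ≤ v ^ 3 * Real.exp (-(n * v) ^ 2 / 4))]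
  have hi := hy i
  have hj := hy j
  have hd := ite_abs (i = j) z
  have h0 : 0 ≤ (n * v) ^ 2 * v ^ 5 * Real.exp (-(n * v) ^ 2 / 4) := by positivity
  have h0 : 0 ≤ (n * v) ^ 0 * v ^ 5 * Real.exp (-(n * v) ^ 2 / 4) := by positivity
  have hm : |(yy i).1 z * (yy j).1 z * (v ^ 2 / 2 * (v ^ 2 / 2)) - (if i = j then 1 else 0 : SS).1 z * (v ^ 2 / 2)| ≤ n * n * (v ^ 2 / 2 * (v ^ 2 / 2)) + 1 * (v ^ 2 / 2) := by
    refine (abs_sub _ _).trans ?_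
    simp only [abs_mul, abs_of_nonneg (by positivity : 0 ≤ v ^ 2 / 2)]
    gcongr
  calc _ ≤ (n * n * (v ^ 2 / 2 * (v ^ 2 / 2)) + 1 * (v ^ 2 / 2)) * (v ^ 3 * Real.exp (-(n * v) ^ 2 / 4)) := by gcongr
    _ = 1/4 * ((n * v) ^ 2 * v ^ 5 * Real.exp (-(n * v) ^ 2 / 4)) + 1/2 * ((n * v) ^ 0 * v ^ 5 * Real.exp (-(n * v) ^ 2 / 4)) := by ring
    _ ≤ _ := by linarith

lemma gb3 (i j k : Fin 3) : GB fun p => DI i (DI j (DI k (gg p))) := by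
  refine gb_aux _ fun p z _ n v hn hv hy hr hg hb => ?_
  have h1 := hb 3 6 (by norm_num) (by norm_num)
  have h2 := hb 1 6 (by norm_num) (by norm_num)
  have e : (DI i (DI j (DI k (gg p)))).1 z = (-((yy i).1 z * (yy j).1 z * (yy k).1 z * ((rho p).1 z * (rho p).1 z * (rho p).1 z)) +
      ((if i = j then 1 else 0 : SS).1 z * (yy k).1 z + (if i = k then 1 else 0 : SS).1 z * (yy j).1 z + (if j = k then 1 else 0 : SS).1 z * (yy i).1 z) * ((rho p).1 z * (rho p).1 z)) * (gg p).1 z := by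
    have := DIJK_GG (sgf p.e p.l) (sgf_smooth _ _) (sgf_pos p.he p.hl) i j k
    exact congrFun (congrArg Subtype.val this) z
  rw [e, hr, hg, abs_mul]
  rw [abs_of_nonneg (by positivity : 0 ≤ v ^ 3 * Real.exp (-(n * v) ^ 2 / 4))]
  have hi := hy i
  have hj := hy j
  have hk := hy k
  have d1 := ite_abs (i = j) z
  have d2 := ite_abs (i = k) z
  have d3 := ite_abs (j = k) z
  have h0 : 0 ≤ (n * v) ^ 3 * v ^ 6 * Real.exp (-(n * v) ^ 2 / 4) := by positivity
  have h0 : 0 ≤ (n * v) ^ 1 * v ^ 6 * Real.exp (-(n * v) ^ 2 / 4) := by positivity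
  set a1 := (if i = j then 1 else 0 : SS).1 z
  set a2 := (if i = k then 1 else 0 : SS).1 z
  set a3 := (if j = k then 1 else 0 : SS).1 z
  have hm : |(-((yy i).1 z * (yy j).1 z * (yy k).1 z * (v ^ 2 / 2 * (v ^ 2 / 2) * (v ^ 2 / 2))) +
      (a1 * (yy k).1 z + a2 * (yy j).1 z + a3 * (yy i).1 z) * (v ^ 2 / 2 * (v ^ 2 / 2)))| ≤ n * n * n * (v ^ 2 / 2 * (v ^ 2 / 2) * (v ^ 2 / 2)) + (1 * n + 1 * n + 1 * n) * (v ^ 2 / 2 * (v ^ 2 / 2)) := by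
    refine (abs_add_le _ _).trans ?_
    have : |a1 * (yy k).1 z + a2 * (yy j).1 z + a3 * (yy i).1 z| ≤ 1 * n + 1 * n + 1 * n := by
      refine (abs_add_three _ _ _).trans ?_
      rw [abs_mul, abs_mul, abs_mul]
      gcongr
    simp only [abs_neg, abs_mul, abs_of_nonneg (by positivity : 0 ≤ v ^ 2 / 2)]
    gcongr
  calc _ ≤ (n * n * n * (v ^ 2 / 2 * (v ^ 2 / 2) * (v ^ 2 / 2)) + (1 * n + 1 * n + 1 * n) * (v ^ 2 / 2 * (v ^ 2 / 2))) * (v ^ 3 * Real.exp (-(n * v) ^ 2 / 4)) := by gcongr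
    _ = 1/8 * ((n * v) ^ 3 * v ^ 6 * Real.exp (-(n * v) ^ 2 / 4)) + 3/4 * ((n * v) ^ 1 * v ^ 6 * Real.exp (-(n * v) ^ 2 / 4)) := by ring
    _ ≤ _ := by linarith

end ANS

namespace ANS

def bs : ContDiffBump (0:E3) := ⟨1/2, 3/4, by norm_num, by norm_num⟩
def bt : ContDiffBump (0:ℝ) := ⟨1/2, 3/4, by norm_num, by norm_num⟩
/-- space-time cutoff -/
def XX : SS := ⟨fun z => bs z.1 * bt z.2, (bs.contDiff.comp contDiff_fst).mul (bt.contDiff.comp contDiff_snd)⟩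
def KX : Set ET := closedBall (0:E3) (3/4) ×ˢ Icc (-(3/4)) (3/4)
def Ann : Set ET := {z | 1/2 ≤ ‖z.1‖ ∨ 1/2 ≤ |z.2|}

lemma KX_compact : IsCompact KX := (isCompact_closedBall _ _).prod isCompact_Icc
lemma Ann_closed : IsClosed Ann := by
  have h1 : IsClosed {z : ET | 1/2 ≤ ‖z.1‖} := isClosed_le continuous_const (by fun_prop)
  have h2 : IsClosed {z : ET | 1/2 ≤ |z.2|} := isClosed_le continuous_const (by fun_prop)
  exact h1.union h2

lemma XX_abs (z : ET) : 0 ≤ XX.1 z ∧ XX.1 z ≤ 1 := by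
  change 0 ≤ bs z.1 * bt z.2 ∧ bs z.1 * bt z.2 ≤ 1
  exact ⟨mul_nonneg bs.nonneg bt.nonneg, mul_le_one₀ bs.le_one bt.nonneg bt.le_one⟩

lemma XX_one {z : ET} (h1 : ‖z.1‖ ≤ 1/2) (h2 : |z.2| ≤ 1/2) : XX.1 z = 1 := by
  change bs z.1 * bt z.2 = 1
  rw [bs.one_of_mem_closedBall, bt.one_of_mem_closedBall, mul_one]
  · simpa [bt] using h2
  · simpa [bs] using h1

lemma XX_van : Van KX XX := by
  intro z hz
  change bs z.1 * bt z.2 = 0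
  by_cases h : 3/4 ≤ ‖z.1‖
  · rw [bs.zero_of_le_dist (by simpa [bs] using h), zero_mul]
  · rw [bt.zero_of_le_dist, mul_zero]
    by_contra h2
    refine hz ⟨by simpa using (not_le.1 h).le, ?_⟩
    have : |z.2| < 3/4 := by simpa [bt] using h2
    rw [abs_lt] at this
    exact ⟨this.1.le, this.2.le⟩

def GX (Y : SS) : Prop := Van KX Y ∧ Van Ann Y
lemma GX.DI {Y : SS} (h : GX Y) (i : Fin 3) : GX (DI i Y) := ⟨h.1.DI KX_compact.isClosed i, h.2.DI Ann_closed i⟩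
lemma GX.DT {Y : SS} (h : GX Y) : GX (DT Y) := ⟨h.1.DT KX_compact.isClosed, h.2.DT Ann_closed⟩
lemma GX.add {Y Z : SS} (h : GX Y) (h' : GX Z) : GX (Y + Z) := ⟨h.1.add h'.1, h.2.add h'.2⟩
lemma XX_DV (v : ET) : GX (DV v XX) := by
  refine ⟨XX_van.D KX_compact.isClosed v, fun z hz => ?_⟩
  rw [DV_apply]
  have : XX.1 =ᶠ[nhds z] fun _ => 1 := by
    filter_upwards [Ann_closed.isOpen_compl.mem_nhds hz] with w hw
    have hw' : ¬ (1/2 ≤ ‖w.1‖ ∨ 1/2 ≤ |w.2|) := hw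
    push Not at hw'
    exact XX_one hw'.1.le hw'.2.le
  rw [this.fderiv_eq]; simp
lemma XX_DI (i : Fin 3) : GX (DI i XX) := XX_DV _
lemma XX_DT : GX (DT XX) := XX_DV _
lemma GX.sum {f : Fin 3 → SS} (h : ∀ i, GX (f i)) : GX (∑ i, f i) := ⟨Van.sum fun i => (h i).1, Van.sum fun i => (h i).2⟩
lemma XX_LAP : GX (LAP XX) := GX.sum fun i => (XX_DI i).DI i
lemma XX_LLL : GX (LLL XX) := XX_DT.add XX_LAP

/-- bounded families -/
def BB (f : Par → SS) : Prop := ∃ C : ℝ, 0 ≤ C ∧ ∀ p, ∀ z ∈ Reg, |(f p).1 z| ≤ C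

lemma BB.add {f g : Par → SS} (hf : BB f) (hg : BB g) : BB fun p => f p + g p := by
  obtain ⟨C, hC, h⟩ := hf
  obtain ⟨D, hD, h'⟩ := hg
  refine ⟨C + D, by positivity, fun p z hz => ?_⟩
  change |(f p).1 z + (g p).1 z| ≤ _
  exact (abs_add_le _ _).trans (add_le_add (h p z hz) (h' p z hz))
lemma GB.add {f g : Par → SS} (hf : GB f) (hg : GB g) : GB fun p => f p + g p := by
  obtain ⟨C, hC, h⟩ := hf
  obtain ⟨D, hD, h'⟩ := hg
  refine ⟨C + D, by positivity, fun p z hz => ?_⟩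
  change |(f p).1 z + (g p).1 z| ≤ _
  rw [add_mul]
  exact (abs_add_le _ _).trans (add_le_add (h p z hz) (h' p z hz))
lemma BB.sum {f : Fin 3 → Par → SS} (hf : ∀ i, BB (f i)) : BB fun p => ∑ i, f i p := by
  simp only [Fin.sum_univ_three]
  exact ((hf 0).add (hf 1)).add (hf 2)
lemma BB.two {f : Par → SS} (hf : BB f) : BB fun p => 2 * f p := by
  simp only [two_mul]
  exact hf.add hf

lemma th_pos (p : Par) {z : ET} (hz : z ∈ Reg) : 0 < th p z := by
  have := p.he; have := p.hl; have := hz.2.2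
  unfold th; nlinarith [sq_nonneg ‖z.1‖]

lemma GB.mul {f : Par → SS} (hf : GB f) {Y : SS} (hY : Van KX Y) : GB fun p => Y * f p := by
  obtain ⟨C, hC, h⟩ := hf
  obtain ⟨D, hD, h'⟩ := hY.bdd KX_compact
  refine ⟨D * C, by positivity, fun p z hz => ?_⟩
  change |Y.1 z * (f p).1 z| ≤ _
  rw [abs_mul, mul_assoc]
  have := h p z hz
  have := h' z
  gcongr

lemma BB.mul {f : Par → SS} (hf : GB f) {Y : SS} (hY : GX Y) : BB fun p => Y * f p := by
  obtain ⟨C, hC, h⟩ := hf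
  obtain ⟨D, hD, h'⟩ := hY.1.bdd KX_compact
  refine ⟨D * (C * 4 ^ 3), by positivity, fun p z hz => ?_⟩
  change |Y.1 z * (f p).1 z| ≤ _
  by_cases hzA : z ∈ Ann
  · have h1 := h p z hz
    have h2 := h' z
    have h3 : 1 / 4 ≤ th p z := by
      have := p.he; have := p.hl; have := hz.2.2
      unfold th
      rcases hzA with h | h
      · nlinarith
      · rw [abs_of_nonpos this] at h
        nlinarith [sq_nonneg ‖z.1‖]
    have h4 : (th p z)⁻¹ ≤ 4 := by
      rw [inv_le_comm₀ (th_pos p hz) (by norm_num)]; linarith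
    have h5 := (th_pos p hz).le
    rw [abs_mul]
    calc _ ≤ D * (C * ((th p z)⁻¹) ^ 3) := by gcongr
      _ ≤ _ := by gcongr
  · rw [hY.2 z hzA]; simp; positivity

lemma hf_abs (e s : ℝ) : 0 ≤ hf e s ∧ hf e s ≤ 1 := ⟨Real.smoothTransition.nonneg _, Real.smoothTransition.le_one _⟩

lemma GB.hh {f : Par → SS} (hf : GB f) : GB fun p => hh p.e * f p := by
  obtain ⟨C, hC, h⟩ := hf
  refine ⟨C, hC, fun p z hz => ?_⟩
  change |ANS.hf p.e z.2 * (f p).1 z| ≤ _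
  obtain ⟨h1, h2⟩ := hf_abs p.e z.2
  rw [abs_mul, abs_of_nonneg h1]
  calc _ ≤ 1 * |(f p).1 z| := by gcongr
    _ ≤ _ := by rw [one_mul]; exact h p z hz

lemma DI_hh (i : Fin 3) (e : ℝ) (f : SS) : DI i (hh e * f) = hh e * DI i f := by
  rw [Derivation.leibniz]
  have : DI i (hh e) = 0 := DI_TF _ _
  rw [this]; simp
lemma DT_hh (e : ℝ) (f : SS) : DT (hh e * f) = hh e * DT f + hh' e * f := by
  rw [Derivation.leibniz]
  have : DT (hh e) = hh' e := DT_TF _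
  rw [this]; simp [mul_comm]
lemma LAP_hh (e : ℝ) (f : SS) : LAP (hh e * f) = hh e * LAP f := by
  unfold LAP; simp only [DI_hh, Finset.mul_sum]
lemma LLL_hh (e : ℝ) (f : SS) : LLL (hh e * f) = hh e * LLL f + hh' e * f := by
  unfold LLL; rw [LAP_hh, DT_hh]; ring
lemma DD_mul (j : Fin 3) (f g : SS) : DI j (DI j (f * g)) = DI j (DI j f) * g + 2 * (DI j f * DI j g) + f * DI j (DI j g) := by
  simp only [Derivation.leibniz, map_add, smul_eq_mul]; ring
lemma LAP_mul (f g : SS) : LAP (f * g) = LAP f * g + 2 * (∑ i, DI i f * DI i g) + f * LAP g := by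
  unfold LAP
  simp only [DD_mul, Fin.sum_univ_three]; ring
lemma LLL_mul (f g : SS) : LLL (f * g) = LLL f * g + 2 * (∑ i, DI i f * DI i g) + f * LLL g := by
  unfold LLL
  rw [LAP_mul, Derivation.leibniz]; simp only [smul_eq_mul]; ring

/-- the test function -/
def PH (p : Par) : SS := hh p.e * (XX * gg p)

lemma PH_D3 (i j k : Fin 3) : GB fun p => DI i (DI j (DI k (PH p))) := by
  unfold PH
  simp only [DI_hh]
  refine GB.hh ?_
  have e : ∀ p, DI i (DI j (DI k (XX * gg p))) = XX * DI i (DI j (DI k (gg p))) + DI i XX * DI j (DI k (gg p)) + DI j XX * DI i (DI k (gg p))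
     + DI k XX * DI i (DI j (gg p)) + DI i (DI j XX) * DI k (gg p) + DI i (DI k XX) * DI j (gg p) + DI j (DI k XX) * DI i (gg p)
     + DI i (DI j (DI k XX)) * gg p := by
    intro p
    simp only [Derivation.leibniz, map_add, smul_eq_mul]; ring
  simp only [e]
  have hX := fun i => (XX_DI i)
  refine ((((((((gb3 i j k).mul XX_van).add ((gb2 j k).mul (hX i).1)).add ((gb2 i k).mul (hX j).1)).add ((gb2 i j).mul (hX k).1)).add
    ((gb1 k).mul ((hX j).DI i).1)).add ((gb1 j).mul ((hX k).DI i).1)).add ((gb1 i).mul ((hX k).DI j).1)).add (gb0.mul (((hX k).DI j).DI i).1)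

def RA (p : Par) : SS := LAP XX * gg p + 2 * (∑ i, DI i XX * DI i (gg p))
def RT (p : Par) : SS := LLL XX * gg p + 2 * (∑ i, DI i XX * DI i (gg p))
def RB (p : Par) : SS := LAP (RT p)

lemma RA_bb : BB RA := (BB.mul gb0 XX_LAP).add (BB.two (BB.sum fun i => BB.mul (gb1 i) (XX_DI i)))
lemma RB_bb : BB RB := by
  have e : ∀ p, RB p = (∑ j, (DI j (DI j (LLL XX)) * gg p + 2 * (DI j (LLL XX) * DI j (gg p)) + LLL XX * DI j (DI j (gg p)))) +
    2 * ∑ i, ∑ j, (DI j (DI j (DI i XX)) * DI i (gg p) + 2 * (DI j (DI i XX) * DI j (DI i (gg p))) + DI i XX * DI j (DI j (DI i (gg p)))) := by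
    intro p
    unfold RB RT LAP
    have : (2 : SS) * (∑ i, DI i XX * DI i (gg p)) = ∑ i, DI i XX * DI i (gg p) + ∑ i, DI i XX * DI i (gg p) := two_mul _
    rw [this]
    simp only [map_add, DD_mul, Fin.sum_univ_three]; ring
  have : RB = fun p => _ := funext e
  rw [this]
  refine BB.add (BB.sum fun j => ?_) (BB.two (BB.sum fun i => BB.sum fun j => ?_))
  · exact ((BB.mul gb0 ((XX_LLL.DI j).DI j)).add (BB.two (BB.mul (gb1 j) (XX_LLL.DI j)))).add (BB.mul (gb2 j j) XX_LLL)
  · exact ((BB.mul (gb1 i) (((XX_DI i).DI j).DI j)).add (BB.two (BB.mul (gb2 j i) ((XX_DI i).DI j)))).add (BB.mul (gb3 j j i) (XX_DI i))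

lemma hf_zero {e : ℝ} (he : 0 < e) {s : ℝ} (hs : -e ≤ s) : hf e s = 0 := by
  unfold hf
  apply Real.smoothTransition.zero_of_nonpos
  have : -s / e ≤ 1 := by rw [div_le_one he]; linarith
  linarith

lemma h_ssp (p : Par) : hh p.e * (1 + ssp p) = 0 := by
  ext z
  change hf p.e z.2 * (1 + deriv (sgf p.e p.l) z.2) = 0
  rcases le_or_gt (-p.e) z.2 with h | h
  · rw [hf_zero p.he h, zero_mul]
  · have : sgf p.e p.l =ᶠ[nhds z.2] fun s => p.e + p.l - s := by
      have h0 : z.2 < 0 := by linarith [p.he]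
      filter_upwards [Iio_mem_nhds h0] with s hs using sgf_neg p.he _ (le_of_lt hs)
    rw [this.deriv_eq]
    simp

theorem PH_LL (p : Par) : LLL (LAP (PH p)) = hh' p.e * (XX * LAP (gg p)) + (hh' p.e * RA p + hh p.e * RB p) := by
  unfold PH
  rw [LAP_hh, LLL_hh, LLL_LAP]
  have h1 : LLL (XX * gg p) = RT p + (1 + ssp p) * (XX * LAP (gg p)) := by
    rw [LLL_mul]
    have : LLL (gg p) = (1 + ssp p) * LAP (gg p) := LLL_GG _ _ _
    rw [this, RT]; ring
  have h2 : LAP ((1 + ssp p) * (XX * LAP (gg p))) = (1 + ssp p) * LAP (XX * LAP (gg p)) := by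
    have : ∀ i, DI i (1 + ssp p) = 0 := by
      intro i
      have : DI i (ssp p) = 0 := DI_SP _ _ i
      rw [map_add, this]; simp
    rw [LAP_mul]
    simp [this, LAP]
  rw [h1, LAP_add, h2, LAP_mul XX (gg p), mul_add, ← mul_assoc (hh p.e) (1 + ssp p), h_ssp]
  unfold RA RB
  ring

end ANS

namespace ANS

/-- parabolic rescaling -/
def Sm (z0 : ET) (r : ℝ) (z : ET) : ET := (r⁻¹ • (z.1 - z0.1), (r^2)⁻¹ * (z.2 - z0.2))
lemma Sm_smooth (z0 : ET) (r : ℝ) : ContDiff ℝ (⊤ : ℕ∞) (Sm z0 r) := by unfold Sm; fun_prop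
lemma Sm_cont (z0 : ET) (r : ℝ) : Continuous (Sm z0 r) := (Sm_smooth z0 r).continuous
def TT (z0 : ET) (r : ℝ) (f : SS) : SS := ⟨fun z => f.1 (Sm z0 r z), (smo f).comp (Sm_smooth z0 r)⟩

lemma Sm_deriv (z0 : ET) (r : ℝ) (z v : ET) : fderiv ℝ (Sm z0 r) z v = (r⁻¹ • v.1, (r^2)⁻¹ * v.2) := by
  have h : HasFDerivAt (Sm z0 r) ((r⁻¹ • ContinuousLinearMap.fst ℝ E3 ℝ).prod ((r^2)⁻¹ • ContinuousLinearMap.snd ℝ E3 ℝ)) z := by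
    unfold Sm
    have h1 : HasFDerivAt (fun z : ET => r⁻¹ • (z.1 - z0.1)) (r⁻¹ • ContinuousLinearMap.fst ℝ E3 ℝ) z :=
      (HasFDerivAt.sub_const z0.1 (hasFDerivAt_fst (𝕜 := ℝ) (p := z))).const_smul r⁻¹
    have h2 : HasFDerivAt (fun z : ET => (r^2)⁻¹ * (z.2 - z0.2)) ((r^2)⁻¹ • ContinuousLinearMap.snd ℝ E3 ℝ) z :=
      (HasFDerivAt.sub_const z0.2 (hasFDerivAt_snd (𝕜 := ℝ) (p := z))).const_smul (r^2)⁻¹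
    exact h1.prodMk h2
  rw [h.fderiv]; rfl

lemma TT_DV (z0 : ET) (r : ℝ) (v : ET) (f : SS) : DV v (TT z0 r f) = TT z0 r (DV (r⁻¹ • v.1, (r^2)⁻¹ * v.2) f) := by
  ext z
  change fderiv ℝ (f.1 ∘ Sm z0 r) z v = fderiv ℝ f.1 (Sm z0 r z) _
  rw [fderiv_comp z (dif f _) ((Sm_smooth z0 r).differentiable (by simp) z), ContinuousLinearMap.comp_apply, Sm_deriv]

lemma TT_DI (z0 : ET) (r : ℝ) (i : Fin 3) (f : SS) : DI i (TT z0 r f) = r⁻¹ • TT z0 r (DI i f) := by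
  unfold DI
  rw [TT_DV]
  ext z
  change fderiv ℝ f.1 (Sm z0 r z) _ = r⁻¹ * fderiv ℝ f.1 (Sm z0 r z) _
  refine Eq.trans ?_ (ContinuousLinearMap.map_smul (fderiv ℝ f.1 (Sm z0 r z)) r⁻¹ _)
  simp

lemma TT_DT (z0 : ET) (r : ℝ) (f : SS) : DT (TT z0 r f) = (r^2)⁻¹ • TT z0 r (DT f) := by
  unfold DT
  rw [TT_DV]
  ext z
  change fderiv ℝ f.1 (Sm z0 r z) _ = (r^2)⁻¹ * fderiv ℝ f.1 (Sm z0 r z) _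
  refine Eq.trans ?_ (ContinuousLinearMap.map_smul (fderiv ℝ f.1 (Sm z0 r z)) (r^2)⁻¹ _)
  simp

lemma TT_add (z0 : ET) (r : ℝ) (f g : SS) : TT z0 r (f + g) = TT z0 r f + TT z0 r g := rfl
lemma TT_sum (z0 : ET) (r : ℝ) (f : Fin 3 → SS) : TT z0 r (∑ i, f i) = ∑ i, TT z0 r (f i) := by
  simp only [Fin.sum_univ_three, TT_add]
lemma TT_LAP (z0 : ET) (r : ℝ) (f : SS) : LAP (TT z0 r f) = (r^2)⁻¹ • TT z0 r (LAP f) := by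
  unfold LAP
  simp only [TT_DI, Derivation.map_smul, TT_sum, Finset.smul_sum, smul_smul]
  congr 1; ext i; rw [pow_two, mul_inv]
lemma LAP_smul (c : ℝ) (f : SS) : LAP (c • f) = c • LAP f := by
  unfold LAP; simp only [Derivation.map_smul, Finset.smul_sum]
lemma LLL_smul (c : ℝ) (f : SS) : LLL (c • f) = c • LLL f := by
  unfold LLL; rw [LAP_smul, Derivation.map_smul, smul_add]
lemma TT_LLL (z0 : ET) (r : ℝ) (f : SS) : LLL (TT z0 r f) = (r^2)⁻¹ • TT z0 r (LLL f) := by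
  unfold LLL; rw [TT_LAP, TT_DT, TT_add, smul_add]

lemma TT_LL (z0 : ET) (r : ℝ) (f : SS) (z : ET) : (LLL (LAP (TT z0 r f))).1 z = r⁻¹ ^ 4 * (LLL (LAP f)).1 (Sm z0 r z) := by
  rw [TT_LAP, LLL_smul, TT_LLL, smul_smul]
  change _ * (LLL (LAP f)).1 (Sm z0 r z) = _
  congr 1
  rw [← mul_inv, inv_pow]; ring
lemma TT_D3 (z0 : ET) (r : ℝ) (f : SS) (i j l : Fin 3) (z : ET) : (DI i (DI j (DI l (TT z0 r f)))).1 z = r⁻¹ ^ 3 * (DI i (DI j (DI l f))).1 (Sm z0 r z) := by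
  simp only [TT_DI, Derivation.map_smul, smul_smul]
  change _ * (DI i (DI j (DI l f))).1 (Sm z0 r z) = _
  congr 1
  ring

def KE (e : ℝ) : Set ET := closedBall (0:E3) (3/4) ×ˢ Icc (-(3/4)) (-e)
lemma KE_compact (e : ℝ) : IsCompact (KE e) := (isCompact_closedBall _ _).prod isCompact_Icc
lemma KE_Reg {e : ℝ} (he : 0 < e) : KE e ⊆ Reg := by
  rintro z ⟨h1, h2, h3⟩
  rw [mem_closedBall_zero_iff] at h1
  exact ⟨by linarith, by linarith, by linarith⟩

lemma Sm_Qz {z0 : ET} {r e : ℝ} (hr : 0 < r) (he : 0 < e) {z : ET} (h : Sm z0 r z ∈ KE e) : z ∈ Qz z0 r := by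
  obtain ⟨h1, h2, h3⟩ := h
  have hr2 : 0 < r ^ 2 := by positivity
  simp only [Sm, mem_closedBall_zero_iff, norm_smul, norm_inv, Real.norm_eq_abs, abs_of_pos hr] at h1
  simp only [Sm] at h2 h3
  rw [inv_mul_le_iff₀ hr] at h1
  rw [inv_mul_le_iff₀ hr2] at h3
  rw [le_inv_mul_iff₀ hr2] at h2
  refine ⟨?_, ?_, ?_⟩
  · rw [mem_ball, dist_eq_norm]; nlinarith
  · nlinarith
  · have := _root_.mul_pos hr2 he
    linarith

lemma Sm_pre_compact {z0 : ET} {r : ℝ} (hr : 0 < r) {K : Set ET} (hK : IsCompact K) : IsCompact (Sm z0 r ⁻¹' K) := by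
  have hr2 : r ^ 2 ≠ 0 := by positivity
  have : Sm z0 r ⁻¹' K ⊆ Set.image (fun w : ET => ((r • w.1 + z0.1, r^2 * w.2 + z0.2) : ET)) K := by
    intro z hz
    refine ⟨_, hz, ?_⟩
    simp only [Sm]
    rw [smul_smul, mul_inv_cancel₀ hr.ne', one_smul, ← mul_assoc, mul_inv_cancel₀ hr2, one_mul]
    simp
  exact (hK.image (by fun_prop)).of_isClosed_subset (hK.isClosed.preimage (Sm_cont _ _)) this

def KT (e : ℝ) : Set ET := univ ×ˢ Iic (-e)
lemma hh_van {e : ℝ} (he : 0 < e) : Van (KT e) (hh e) := by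
  intro z hz
  change hf e z.2 = 0
  refine hf_zero he ?_
  by_contra h
  exact hz ⟨mem_univ _, by simpa using (not_le.1 h).le⟩
lemma hh'_van {e : ℝ} (he : 0 < e) : Van (KT e) (hh' e) := by
  have : DT (hh e) = hh' e := DT_TF _
  rw [← this]
  exact (hh_van he).DT (isClosed_univ.prod isClosed_Iic)
lemma van_KE {e : ℝ} {f g : SS} (hf : Van (KT e) f) (hg : Van KX g) : Van (KE e) (f * g) := by
  intro z hz
  change f.1 z * g.1 z = 0
  by_cases h1 : z ∈ KT e
  · rw [hg z, mul_zero]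
    intro h2
    exact hz ⟨h2.1, h2.2.1, h1.2⟩
  · rw [hf z h1, zero_mul]

lemma PH_van (p : Par) : Van (KE p.e) (PH p) := van_KE (hh_van p.he) (XX_van.mul_right _)
/-- main term -/
def MM (p : Par) : SS := hh' p.e * (XX * LAP (gg p))
def RR (p : Par) : SS := hh' p.e * RA p + hh p.e * RB p
lemma MM_van (p : Par) : Van (KE p.e) (MM p) := van_KE (hh'_van p.he) (XX_van.mul_right _)
lemma RR_van (p : Par) : Van (KE p.e) (RR p) := by
  have h : RR p = LLL (LAP (PH p)) - MM p := by
    rw [PH_LL]; unfold RR MM; ring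
  rw [h]
  exact (((PH_van p).LAP (KE_compact _).isClosed).LLL (KE_compact _).isClosed).sub (MM_van p)
lemma RR_bb : ∃ C : ℝ, 0 ≤ C ∧ ∀ p, ∀ z, |(RR p).1 z| ≤ C * (1 + |(hh' p.e).1 z|) := by
  obtain ⟨C, hC, h⟩ := RA_bb
  obtain ⟨D, hD, h'⟩ := RB_bb
  refine ⟨C + D, by positivity, fun p z => ?_⟩
  by_cases hz : z ∈ KE p.e
  · have hz := KE_Reg p.he hz
    have h1 := h p z hz
    have h2 := h' p z hz
    change |(hh' p.e).1 z * (RA p).1 z + hf p.e z.2 * (RB p).1 z| ≤ _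
    obtain ⟨h3, h4⟩ := hf_abs p.e z.2
    have h5 : |(hh' p.e).1 z * (RA p).1 z| ≤ |(hh' p.e).1 z| * C := by rw [abs_mul]; gcongr
    have h6 : |hf p.e z.2 * (RB p).1 z| ≤ 1 * D := by rw [abs_mul, abs_of_nonneg h3]; gcongr
    have h7 := abs_add_le ((hh' p.e).1 z * (RA p).1 z) (hf p.e z.2 * (RB p).1 z)
    have h8 := abs_nonneg ((hh' p.e).1 z)
    nlinarith [mul_nonneg hD h8]
  · rw [RR_van p z hz, abs_zero]
    have h8 := abs_nonneg ((hh' p.e).1 z)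
    positivity

def UU (R : ℝ) (u : E3 → ℝ → E3) (k : Fin 3) (z : ET) : ℝ := (QQ R).indicator (fun z => u z.1 z.2 k) z
def FF (R : ℝ) (u : E3 → ℝ → E3) (z : ET) : ℝ≥0∞ := (QQ R).indicator (fun z => ‖u z.1 z.2‖ₑ * ‖u z.1 z.2‖ₑ) z

lemma UU_int {R : ℝ} {u : E3 → ℝ → E3} {P} (sol : SuitableWeakSolution R u P) (k : Fin 3) (f : SS)
    (hf : ∃ C : ℝ, 0 ≤ C ∧ ∀ z, |f.1 z| ≤ C) : Integrable fun z => UU R u k z * f.1 z := by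
  have h := (sol_int1 sol k f hf).integrable_indicator (QQ_meas R)
  refine h.congr (ae_of_all _ fun z => ?_)
  unfold UU
  by_cases hz : z ∈ QQ R <;> simp [hz]

lemma stepP : ∃ C : ℝ≥0∞, C ≠ ∞ ∧ ∀ (R : ℝ) (u : E3 → ℝ → E3) (P : E3 → ℝ → ℝ), SuitableWeakSolution R u P →
    ∀ (z0 : ET) (r : ℝ), 0 < r → r ≤ 1 → Qz z0 r ⊆ QQ R → ∀ (p : Par) (k : Fin 3),
    ‖∫ z, UU R u k z * (MM p).1 (Sm z0 r z)‖ₑ ≤ C * (∫⁻ z in Qz z0 r, ‖UU R u k z‖ₑ * (1 + ‖(hh' p.e).1 (Sm z0 r z)‖ₑ))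
      + C * (ENNReal.ofReal r * ∫⁻ z in Qz z0 r, FF R u z * ENNReal.ofReal ((KE p.e).indicator (fun w => ((th p w)⁻¹) ^ 3) (Sm z0 r z))) := by
  obtain ⟨C, hC, hR⟩ := RR_bb
  choose D hD hD3 using fun i j l => PH_D3 i j l
  set D' : ℝ := ∑ i, ∑ j, ∑ l, D i j l with hD'
  refine ⟨ENNReal.ofReal C + 36 * ENNReal.ofReal D', by finiteness, ?_⟩
  intro R u P sol z0 r hr hr1 hQ p k
  set A := Sm z0 r ⁻¹' (KE p.e) with hA
  have hAc : IsCompact A := Sm_pre_compact hr (KE_compact _)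
  have hAQ : A ⊆ Qz z0 r := fun z hz => Sm_Qz hr p.he hz
  have hTv : ∀ f : SS, Van (KE p.e) f → Van A (TT z0 r f) := fun f hf z hz => hf _ hz
  have key := partA sol hAc (hAQ.trans hQ) (hTv _ (PH_van p)) k
  have mQ : MeasurableSet (Qz z0 r) := measurableSet_ball.prod measurableSet_Ioo
  have c0 : ENNReal.ofReal (r⁻¹ ^ 4) ≠ 0 := by simp; positivity
  -- left
  have eL : ‖∫ z, (QQ R).indicator (fun z => u z.1 z.2 k) z * (LLL (LAP (TT z0 r (PH p)))).1 z‖ₑ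
      = ENNReal.ofReal (r⁻¹ ^ 4) * ‖∫ z, UU R u k z * (LLL (LAP (PH p))).1 (Sm z0 r z)‖ₑ := by
    rw [← Real.enorm_of_nonneg (by positivity), ← enorm_mul, ← integral_const_mul]
    congr 2; ext z
    rw [TT_LL]; unfold UU; ring
  have mF : Measurable (FF R u) := by
    have := sol_meas sol
    exact (by fun_prop : Measurable fun z : ET => ‖u z.1 z.2‖ₑ * ‖u z.1 z.2‖ₑ).indicator (QQ_meas R)
  have mth : Measurable fun z => ENNReal.ofReal ((KE p.e).indicator (fun w => ((th p w)⁻¹) ^ 3) (Sm z0 r z)) := by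
    have h1 : Measurable fun w : ET => ((th p w)⁻¹) ^ 3 := by unfold th; fun_prop
    have h2 := h1.indicator (KE_compact p.e).isClosed.measurableSet
    exact (h2.comp (Sm_cont z0 r).measurable).ennreal_ofReal
  have eR : ∫⁻ z, (QQ R).indicator (fun z => ‖u z.1 z.2‖ₑ * ‖u z.1 z.2‖ₑ) z * ∑ i, ∑ j, ∑ l, ‖(DI i (DI j (DI l (TT z0 r (PH p))))).1 z‖ₑ
      ≤ ENNReal.ofReal (r⁻¹ ^ 3) * (ENNReal.ofReal D' * ∫⁻ z in Qz z0 r, FF R u z * ENNReal.ofReal ((KE p.e).indicator (fun w => ((th p w)⁻¹) ^ 3) (Sm z0 r z))) := by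
    have m3 : Measurable fun z => FF R u z * ENNReal.ofReal ((KE p.e).indicator (fun w => ((th p w)⁻¹) ^ 3) (Sm z0 r z)) := mF.mul mth
    rw [← lintegral_const_mul _ m3, ← lintegral_const_mul _ (m3.const_mul _), ← lintegral_indicator mQ]
    refine lintegral_mono fun z => ?_
    by_cases hz : Sm z0 r z ∈ KE p.e
    · rw [indicator_of_mem (Sm_Qz hr p.he hz), indicator_of_mem hz]
      have : ∑ i, ∑ j, ∑ l, ‖(DI i (DI j (DI l (TT z0 r (PH p))))).1 z‖ₑ ≤ ENNReal.ofReal (r⁻¹ ^ 3) * (ENNReal.ofReal D' * ENNReal.ofReal (((th p (Sm z0 r z))⁻¹) ^ 3)) := by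
        have ht : 0 < th p (Sm z0 r z) := th_pos p (KE_Reg p.he hz)
        rw [← ENNReal.ofReal_mul (by rw [hD']; exact Finset.sum_nonneg fun i _ => Finset.sum_nonneg fun j _ => Finset.sum_nonneg fun l _ => hD i j l), ← ENNReal.ofReal_mul (by positivity), hD']
        simp only [Finset.sum_mul, Finset.mul_sum]
        rw [ENNReal.ofReal_sum_of_nonneg]
        swap
        · intro i _; refine Finset.sum_nonneg fun j _ => Finset.sum_nonneg fun l _ => ?_
          have := hD i j l; positivity
        refine Finset.sum_le_sum fun i _ => ?_
        rw [ENNReal.ofReal_sum_of_nonneg]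
        swap
        · intro j _; refine Finset.sum_nonneg fun l _ => ?_
          have := hD i j l; positivity
        refine Finset.sum_le_sum fun j _ => ?_
        rw [ENNReal.ofReal_sum_of_nonneg]
        swap
        · intro l _
          have := hD i j l; positivity
        refine Finset.sum_le_sum fun l _ => ?_
        rw [TT_D3, ← ofReal_norm]
        refine ENNReal.ofReal_le_ofReal ?_
        rw [Real.norm_eq_abs, abs_mul, abs_of_pos (by positivity)]
        have h1 := hD3 i j l p _ (KE_Reg p.he hz)
        gcongr
      calc _ ≤ FF R u z * _ := mul_le_mul_right this _
        _ = _ := by ring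
    · have : ∀ i j l, (DI i (DI j (DI l (TT z0 r (PH p))))).1 z = 0 := by
        intro i j l
        have hc := hAc.isClosed
        exact ((((hTv _ (PH_van p)).DI hc l).DI hc j).DI hc i) z hz
      simp [this]
  rw [eL] at key
  have key2 : ‖∫ z, UU R u k z * (LLL (LAP (PH p))).1 (Sm z0 r z)‖ₑ ≤ 36 * ENNReal.ofReal D' * (ENNReal.ofReal r * ∫⁻ z in Qz z0 r, FF R u z * ENNReal.ofReal ((KE p.e).indicator (fun w => ((th p w)⁻¹) ^ 3) (Sm z0 r z))) := by
    refine (ENNReal.mul_le_mul_iff_right c0 (by simp)).1 ((key.trans (mul_le_mul_right eR _)).trans (le_of_eq ?_))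
    have h3 : ENNReal.ofReal (r⁻¹ ^ 3) = ENNReal.ofReal (r⁻¹ ^ 4) * ENNReal.ofReal r := by
      rw [← ENNReal.ofReal_mul (by positivity)]
      congr 1; field_simp
    rw [h3]
    ring
  -- split
  have iM : Integrable fun z => UU R u k z * (MM p).1 (Sm z0 r z) := UU_int sol k (TT z0 r (MM p)) ((hTv _ (MM_van p)).bdd hAc)
  have iR : Integrable fun z => UU R u k z * (RR p).1 (Sm z0 r z) := UU_int sol k (TT z0 r (RR p)) ((hTv _ (RR_van p)).bdd hAc)
  have eS : ∫ z, UU R u k z * (MM p).1 (Sm z0 r z) = (∫ z, UU R u k z * (LLL (LAP (PH p))).1 (Sm z0 r z)) - ∫ z, UU R u k z * (RR p).1 (Sm z0 r z) := by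
    have : ∫ z, UU R u k z * (LLL (LAP (PH p))).1 (Sm z0 r z) = (∫ z, UU R u k z * (MM p).1 (Sm z0 r z)) + ∫ z, UU R u k z * (RR p).1 (Sm z0 r z) := by
      rw [← integral_add iM iR]
      congr 1; ext z
      rw [PH_LL, ← mul_add]; rfl
    rw [this]; ring
  have hrem : ‖∫ z, UU R u k z * (RR p).1 (Sm z0 r z)‖ₑ ≤ ENNReal.ofReal C * ∫⁻ z in Qz z0 r, ‖UU R u k z‖ₑ * (1 + ‖(hh' p.e).1 (Sm z0 r z)‖ₑ) := by
    refine (enorm_integral_le_lintegral_enorm _).trans ?_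
    rw [← lintegral_const_mul' _ _ (by simp), ← lintegral_indicator mQ]
    refine lintegral_mono fun z => ?_
    by_cases hz : Sm z0 r z ∈ KE p.e
    · rw [indicator_of_mem (Sm_Qz hr p.he hz), enorm_mul]
      have : ‖(RR p).1 (Sm z0 r z)‖ₑ ≤ ENNReal.ofReal C * (1 + ‖(hh' p.e).1 (Sm z0 r z)‖ₑ) := by
        have h1 := hR p (Sm z0 r z)
        rw [← ofReal_norm, ← ofReal_norm, ← ENNReal.ofReal_one, ← ENNReal.ofReal_add (by norm_num) (norm_nonneg _), ← ENNReal.ofReal_mul hC]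
        exact ENNReal.ofReal_le_ofReal h1
      calc _ ≤ ‖UU R u k z‖ₑ * _ := mul_le_mul_right this _
        _ = _ := by ring
    · rw [RR_van p _ hz]; simp
  rw [eS]
  refine (enorm_sub_le).trans ?_
  rw [add_comm]
  refine add_le_add (hrem.trans ?_) (key2.trans ?_)
  · gcongr; exact le_self_add
  · gcongr; exact le_add_self

end ANS

namespace ANS

def Gf (σ n : ℝ) : ℝ := Real.exp (-(3/2) * Real.log σ + (-(1/2)) * (n ^ 2 * (2 * σ)⁻¹))
def Lf (σ n : ℝ) : ℝ := (n ^ 2 * (2 * σ)⁻¹ * (2 * σ)⁻¹ - 3 * (2 * σ)⁻¹) * Gf σ n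

lemma NN_val (z : ET) : (NN).1 z = ‖z.1‖ ^ 2 := by
  unfold NN
  rw [SS_sum, EuclideanSpace.real_norm_sq_eq]
  refine Finset.sum_congr rfl fun i _ => ?_
  change z.1 i * z.1 i = _
  ring

lemma LAP_val (p : Par) {z : ET} (hz : z.2 ≤ 0) : (LAP (gg p)).1 z = Lf (p.e + p.l - z.2) ‖z.1‖ := by
  have : LAP (gg p) = _ := LAP_GG _ _ _
  rw [this]
  change ((NN).1 z * (2 * sgf p.e p.l z.2)⁻¹ * (2 * sgf p.e p.l z.2)⁻¹ - 3 * (2 * sgf p.e p.l z.2)⁻¹) *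
    Real.exp (-(3/2) * Real.log (sgf p.e p.l z.2) + (-(1/2)) * ((NN).1 z * (2 * sgf p.e p.l z.2)⁻¹)) = _
  rw [sgf_neg p.he _ hz, NN_val]; rfl

lemma Gf_deriv {σ : ℝ} (hσ : 0 < σ) (n : ℝ) : HasDerivAt (fun s => Gf s n) (Lf σ n) σ := by
  unfold Gf Lf Gf
  have h1 := (Real.hasDerivAt_log hσ.ne').const_mul (-(3/2))
  have h2 : HasDerivAt (fun s : ℝ => (2 * s)⁻¹) (-(2 * 1) / (2 * σ) ^ 2) σ := ((hasDerivAt_id σ).const_mul 2).fun_inv (by simpa using hσ.ne')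
  have h3 := (h1.add ((h2.const_mul (n^2)).const_mul (-(1/2)))).exp
  refine h3.congr_deriv ?_
  rw [mul_comm]
  simp only [Pi.add_apply]
  congr 1
  field_simp; ring

lemma Gf_le {σ : ℝ} (hσ : 1 ≤ σ) (n : ℝ) : 0 ≤ Gf σ n ∧ Gf σ n ≤ 1 := by
  refine ⟨(Real.exp_pos _).le, ?_⟩
  unfold Gf
  rw [Real.exp_le_one_iff]
  have := Real.log_nonneg hσ
  have : 0 ≤ n ^ 2 * (2 * σ)⁻¹ := by positivity
  linarith

lemma Lf_meas {α : Type*} [MeasurableSpace α] {f g : α → ℝ} (hf : Measurable f) (hg : Measurable g) : Measurable fun x => Lf (f x) (g x) := by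
  unfold Lf Gf; fun_prop
lemma Gf_meas {α : Type*} [MeasurableSpace α] {f g : α → ℝ} (hf : Measurable f) (hg : Measurable g) : Measurable fun x => Gf (f x) (g x) := by
  unfold Gf; fun_prop

def Mf (e l : ℝ) (z : ET) : ℝ := (hh' e).1 z * (XX.1 z * Lf (e + l - z.2) ‖z.1‖)
def Hf (e : ℝ) (z : ET) : ℝ := (hh' e).1 z * (XX.1 z * Gf (e + 1 - z.2) ‖z.1‖)
/-- approximate identity kernel -/
def Kf (e : ℝ) (z : ET) : ℝ := -(hh' e).1 z * (XX.1 z * Gf (e - z.2) ‖z.1‖)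

lemma hh'_zero {e : ℝ} (he : 0 < e) {z : ET} (hz : ¬ z.2 ≤ 0) : (hh' e).1 z = 0 := by
  refine hh'_van he z fun h => hz ?_
  have : z.2 ≤ -e := h.2
  linarith

lemma MM_val (p : Par) (z : ET) : (MM p).1 z = Mf p.e p.l z := by
  change (hh' p.e).1 z * (XX.1 z * (LAP (gg p)).1 z) = _
  unfold Mf
  by_cases hz : z.2 ≤ 0
  · rw [LAP_val p hz]
  · rw [hh'_zero p.he hz]; simp

lemma Lf_int {c : ℝ} (hc : 0 < c) (n : ℝ) : ∫ l in Ioc (0:ℝ) 1, Lf (c + l) n = Gf (c + 1) n - Gf c n := by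
  rw [← intervalIntegral.integral_of_le (by norm_num)]
  have h : ∀ l ∈ uIcc (0:ℝ) 1, HasDerivAt (fun l => Gf (c + l) n) (Lf (c + l) n) l := by
    intro l hl
    rw [uIcc_of_le (by norm_num)] at hl
    exact (Gf_deriv (by linarith [hl.1]) n).comp_const_add c l
  rw [intervalIntegral.integral_eq_sub_of_hasDerivAt h]
  · simp
  · refine ContinuousOn.intervalIntegrable ?_
    rw [uIcc_of_le (by norm_num)]
    have h2 : ∀ l ∈ Icc (0:ℝ) 1, c + l ≠ 0 := fun l hl => by linarith [hl.1]
    have h3 : ∀ l ∈ Icc (0:ℝ) 1, 2 * (c + l) ≠ 0 := fun l hl => by linarith [hl.1]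
    unfold Lf Gf
    fun_prop (disch := assumption)

lemma Mf_int {e : ℝ} (he : 0 < e) (z : ET) : ∫ l in Ioc (0:ℝ) 1, Mf e l z = Hf e z + Kf e z := by
  unfold Mf Hf Kf
  by_cases hz : z.2 ≤ 0
  · rw [integral_const_mul, integral_const_mul]
    have : ∀ l, e + l - z.2 = (e - z.2) + l := fun l => by ring
    simp only [this]
    rw [Lf_int (by linarith)]; ring
  · rw [hh'_zero he hz]; simp

lemma Mf_bdd {e : ℝ} (he : 0 < e) (he' : e ≤ 1/8) : ∃ B : ℝ, 0 ≤ B ∧ ∀ l ∈ Ioc (0:ℝ) 1, ∀ z, |Mf e l z| ≤ B := by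
  have h0 : GB fun p => LAP (gg p) := by
    unfold LAP
    simp only [Fin.sum_univ_three]
    exact ((gb2 0 0).add (gb2 1 1)).add (gb2 2 2)
  obtain ⟨C, hC, h⟩ := h0
  obtain ⟨D, hD, h'⟩ := (van_KE (hh'_van he) XX_van).bdd (KE_compact e)
  refine ⟨D * (C * (e⁻¹) ^ 3), by positivity, fun l hl z => ?_⟩
  set p : Par := ⟨e, l, he, he', hl.1, hl.2⟩
  have hp : Mf e l z = (MM p).1 z := (MM_val p z).symm
  by_cases hz : z ∈ KE e
  · rw [hp]
    have e1 : (MM p).1 z = (hh' e * XX).1 z * (LAP (gg p)).1 z := by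
      change (hh' e).1 z * (XX.1 z * (LAP (gg p)).1 z) = ((hh' e).1 z * XX.1 z) * (LAP (gg p)).1 z
      ring
    rw [e1, abs_mul]
    have h1 := h p z (KE_Reg he hz)
    have h2 := h' z
    have h3 : e ≤ th p z := by
      have := (KE_Reg he hz).2.2
      have := hl.1
      change e ≤ e + l - z.2 + ‖z.1‖ ^ 2
      nlinarith [sq_nonneg ‖z.1‖]
    have h4 : (th p z)⁻¹ ≤ e⁻¹ := inv_anti₀ he h3
    have h5 := (th_pos p (KE_Reg he hz)).le
    calc _ ≤ D * (C * ((th p z)⁻¹) ^ 3) := by gcongr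
      _ ≤ _ := by gcongr
  · rw [hp, MM_van p z hz, abs_zero]; positivity

lemma th_kk {e : ℝ} (he : 0 < e) (w : ET) : ∫⁻ l in Ioc (0:ℝ) 1, ENNReal.ofReal ((KE e).indicator (fun w => ((e + l - w.2 + ‖w.1‖ ^ 2)⁻¹) ^ 3) w) ≤ kk w.1 w.2 := by
  by_cases hw : w ∈ KE e
  swap
  · simp [hw]
  simp only [indicator_of_mem hw]
  have hs : w.2 ≤ -e := hw.2.2
  set c := e - w.2 + ‖w.1‖ ^ 2 with hc
  have hc0 : 0 < c := by nlinarith [sq_nonneg ‖w.1‖]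
  have hd : ∀ l ∈ uIcc (0:ℝ) 1, HasDerivAt (fun l => -(1/2) * ((c + l)⁻¹) ^ 2) (((c + l)⁻¹) ^ 3) l := by
    intro l hl
    rw [uIcc_of_le (by norm_num)] at hl
    have hl' : c + l ≠ 0 := by linarith [hl.1]
    have := (((((hasDerivAt_id l).const_add c).fun_inv hl').fun_pow 2).const_mul (-(1/2)))
    refine this.congr_deriv ?_
    simp only [id]
    field_simp
    norm_num
    rw [mul_assoc, mul_inv_cancel₀ hl', mul_one]
  have hco : ContinuousOn (fun l => ((c + l)⁻¹) ^ 3) (Icc (0:ℝ) 1) := by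
    have h2 : ∀ l ∈ Icc (0:ℝ) 1, c + l ≠ 0 := fun l hl => by linarith [hl.1]
    fun_prop (disch := assumption)
  have hI : ∫ l in Ioc (0:ℝ) 1, ((c + l)⁻¹) ^ 3 ≤ (c⁻¹) ^ 2 := by
    rw [← intervalIntegral.integral_of_le (by norm_num), intervalIntegral.integral_eq_sub_of_hasDerivAt hd]
    · have : 0 < ((c+1)⁻¹)^2 := by positivity
      have : 0 < (c⁻¹)^2 := by positivity
      simp only [add_zero]; linarith
    · refine ContinuousOn.intervalIntegrable ?_
      rwa [uIcc_of_le (by norm_num)]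
  have hii : IntegrableOn (fun l => ((c + l)⁻¹) ^ 3) (Ioc (0:ℝ) 1) := (hco.integrableOn_Icc).mono_set Ioc_subset_Icc_self
  have e1 : ∀ l, e + l - w.2 + ‖w.1‖ ^ 2 = c + l := fun l => by rw [hc]; ring
  simp only [e1]
  rw [← ofReal_integral_eq_lintegral_ofReal hii]
  swap
  · filter_upwards [ae_restrict_mem measurableSet_Ioc] with l hl
    have := hl.1
    simp only [Pi.zero_apply]
    positivity
  refine (ENNReal.ofReal_le_ofReal hI).trans ?_
  have e2 : ENNReal.ofReal ((c⁻¹) ^ 2) = (ENNReal.ofReal c ^ 2)⁻¹ := by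
    rw [ENNReal.ofReal_pow (by positivity), ENNReal.ofReal_inv_of_pos hc0, ENNReal.inv_pow]
  rw [e2]
  have hs2 : |w.2| ≤ c := by
    rw [abs_of_neg (by linarith)]; nlinarith [sq_nonneg ‖w.1‖]
  have hn2 : ‖w.1‖ ^ 2 ≤ c := by linarith
  refine le_min ?_ ?_
  · rw [ENNReal.rpow_neg]
    refine ENNReal.inv_le_inv.2 ?_
    rw [ENNReal.rpow_ofNat]
    gcongr
  · rw [ENNReal.rpow_neg]
    refine ENNReal.inv_le_inv.2 ?_
    rw [ENNReal.rpow_ofNat, show (4:ℕ) = 2 * 2 by norm_num, pow_mul, ← ENNReal.ofReal_pow (norm_nonneg _)]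
    gcongr

lemma UU_meas {R : ℝ} {u : E3 → ℝ → E3} {P} (sol : SuitableWeakSolution R u P) (k : Fin 3) : Measurable (UU R u k) :=
  (sol_meas_c sol k).indicator (QQ_meas R)
lemma FF_meas {R : ℝ} {u : E3 → ℝ → E3} {P} (sol : SuitableWeakSolution R u P) : Measurable (FF R u) := by
  have := sol_meas sol
  exact (by fun_prop : Measurable fun z : ET => ‖u z.1 z.2‖ₑ * ‖u z.1 z.2‖ₑ).indicator (QQ_meas R)
lemma UU_L1 {R : ℝ} {u : E3 → ℝ → E3} {P} (sol : SuitableWeakSolution R u P) (k : Fin 3) : Integrable (UU R u k) := by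
  have := UU_int sol k 1 ⟨1, by norm_num, fun z => by change |(1:ℝ)| ≤ 1; simp⟩
  refine this.congr (ae_of_all _ fun z => ?_)
  change _ * (1:ℝ) = _
  simp
lemma Mf_meas (e : ℝ) (z0 : ET) (r : ℝ) : Measurable fun x : ℝ × ET => Mf e x.1 (Sm z0 r x.2) := by
  unfold Mf
  have h0 := (Sm_cont z0 r).measurable
  have h1 : Measurable fun x : ℝ × ET => (hh' e).1 (Sm z0 r x.2) := (con (hh' e)).measurable.comp (h0.comp measurable_snd)
  have h2 : Measurable fun x : ℝ × ET => XX.1 (Sm z0 r x.2) := (con XX).measurable.comp (h0.comp measurable_snd)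
  have h3 : Measurable fun x : ℝ × ET => Lf (e + x.1 - (Sm z0 r x.2).2) ‖(Sm z0 r x.2).1‖ :=
    Lf_meas (by fun_prop) (by fun_prop)
  exact h1.mul (h2.mul h3)

lemma stepK : ∃ C : ℝ≥0∞, C ≠ ∞ ∧ ∀ (R : ℝ) (u : E3 → ℝ → E3) (P : E3 → ℝ → ℝ), SuitableWeakSolution R u P →
    ∀ (z0 : ET) (r : ℝ), 0 < r → r ≤ 1 → Qz z0 r ⊆ QQ R → ∀ (e : ℝ), 0 < e → e ≤ 1/8 → ∀ (k : Fin 3),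
    ‖∫ z, UU R u k z * Kf e (Sm z0 r z)‖ₑ ≤ C * (∫⁻ z in Qz z0 r, ‖UU R u k z‖ₑ * (1 + ‖(hh' e).1 (Sm z0 r z)‖ₑ))
      + C * (ENNReal.ofReal r * ∫⁻ z in Qz z0 r, FF R u z * kk (Sm z0 r z).1 (Sm z0 r z).2) := by
  obtain ⟨C, hC, hS⟩ := stepP
  refine ⟨C + 1, by finiteness, ?_⟩
  intro R u P sol z0 r hr hr1 hQ e he he' k
  have hS := fun l (hl : l ∈ Ioc (0:ℝ) 1) => hS R u P sol z0 r hr hr1 hQ ⟨e, l, he, he', hl.1, hl.2⟩ k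
  simp only [MM_val] at hS
  obtain ⟨B, hB, hMB⟩ := Mf_bdd he he'
  have mQ : MeasurableSet (Qz z0 r) := measurableSet_ball.prod measurableSet_Ioo
  have mU := UU_meas sol k
  have mM := Mf_meas e z0 r
  have hInt9 : Integrable (Function.uncurry fun (l : ℝ) (z : ET) => UU R u k z * Mf e l (Sm z0 r z)) ((volume.restrict (Ioc (0:ℝ) 1)).prod volume) := by
    have h1 : Integrable (fun x : ℝ × ET => B * UU R u k x.2) ((volume.restrict (Ioc (0:ℝ) 1)).prod volume) := by
      have : Integrable (fun _ : ℝ => B) (volume.restrict (Ioc (0:ℝ) 1)) := integrable_const _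
      exact this.mul_prod (UU_L1 sol k)
    refine h1.mono (by exact ((mU.comp measurable_snd).mul mM).aestronglyMeasurable) ?_
    have : ∀ᵐ x : ℝ × ET ∂((volume.restrict (Ioc (0:ℝ) 1)).prod volume), x.1 ∈ Ioc (0:ℝ) 1 := by
      have h := ae_restrict_mem (μ := (volume : Measure ℝ)) (measurableSet_Ioc (a := (0:ℝ)) (b := 1))
      exact (Measure.quasiMeasurePreserving_fst (μ := volume.restrict (Ioc (0:ℝ) 1)) (ν := (volume : Measure ET))).ae h
    filter_upwards [this] with x hx
    simp only [Function.uncurry, norm_mul, Real.norm_eq_abs, abs_of_nonneg hB]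
    rw [mul_comm]
    have := hMB _ hx (Sm z0 r x.2)
    gcongr
  have hsw := integral_integral_swap hInt9
  simp only [integral_const_mul, Mf_int he] at hsw
  have iH : ∀ f : ET → ℝ, Measurable f → (∀ z, |f z| ≤ |(hh' e * XX).1 z|) → Integrable fun z => UU R u k z * f (Sm z0 r z) := by
    intro f hfm hfz
    obtain ⟨D, hD, h'⟩ := (van_KE (hh'_van he) XX_van).bdd (KE_compact e)
    refine ((UU_L1 sol k).const_mul D).mono (mU.mul (hfm.comp (Sm_cont z0 r).measurable)).aestronglyMeasurable (ae_of_all _ fun z => ?_)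
    simp only [norm_mul, Real.norm_eq_abs, abs_of_nonneg hD]
    rw [mul_comm]
    have := (hfz (Sm z0 r z)).trans (h' _)
    gcongr
  have hHb : ∀ z, |Hf e z| ≤ |(hh' e * XX).1 z| := by
    intro z
    change |(hh' e).1 z * (XX.1 z * Gf (e + 1 - z.2) ‖z.1‖)| ≤ |(hh' e).1 z * XX.1 z|
    by_cases hz : z.2 ≤ 0
    · have := Gf_le (σ := e + 1 - z.2) (by linarith) ‖z.1‖
      rw [← mul_assoc, abs_mul, abs_of_nonneg this.1]
      exact mul_le_of_le_one_right (abs_nonneg _) this.2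
    · rw [hh'_zero he hz]; simp
  have mHf : Measurable (Hf e) := by
    unfold Hf
    exact (con (hh' e)).measurable.mul ((con XX).measurable.mul (Gf_meas (by fun_prop) (by fun_prop)))
  have jH := iH _ mHf hHb
  have jS : Integrable fun z => UU R u k z * (Hf e (Sm z0 r z) + Kf e (Sm z0 r z)) := by
    have := hInt9.integral_prod_right
    simpa only [Function.uncurry, integral_const_mul, Mf_int he] using this
  have eK : ∫ z, UU R u k z * Kf e (Sm z0 r z) = (∫ l in Ioc (0:ℝ) 1, ∫ z, UU R u k z * Mf e l (Sm z0 r z)) - ∫ z, UU R u k z * Hf e (Sm z0 r z) := by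
    rw [hsw, ← integral_sub jS jH]
    congr 1; ext z; ring
  rw [eK]
  refine (enorm_sub_le).trans ?_
  set T1 := ∫⁻ z in Qz z0 r, ‖UU R u k z‖ₑ * (1 + ‖(hh' e).1 (Sm z0 r z)‖ₑ) with hT1
  have b2 : ‖∫ z, UU R u k z * Hf e (Sm z0 r z)‖ₑ ≤ T1 := by
    refine (enorm_integral_le_lintegral_enorm _).trans ?_
    rw [hT1, ← lintegral_indicator mQ]
    refine lintegral_mono fun z => ?_
    by_cases hz : Sm z0 r z ∈ KE e
    · rw [indicator_of_mem (Sm_Qz hr he hz), enorm_mul]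
      gcongr
      refine le_trans ?_ le_add_self
      rw [← ofReal_norm, ← ofReal_norm]
      refine ENNReal.ofReal_le_ofReal ((hHb _).trans ?_)
      change |(hh' e).1 _ * XX.1 _| ≤ _
      have := XX_abs (Sm z0 r z)
      rw [abs_mul, abs_of_nonneg this.1]
      exact mul_le_of_le_one_right (abs_nonneg _) this.2
    · have : Hf e (Sm z0 r z) = 0 := by
        have := hHb (Sm z0 r z)
        rw [van_KE (hh'_van he) XX_van _ hz, abs_zero] at this
        exact abs_nonpos_iff.1 this
      simp [this]
  have mF := FF_meas sol
  have b1 : ‖∫ l in Ioc (0:ℝ) 1, ∫ z, UU R u k z * Mf e l (Sm z0 r z)‖ₑ ≤ C * T1 + C * (ENNReal.ofReal r * ∫⁻ z in Qz z0 r, FF R u z * kk (Sm z0 r z).1 (Sm z0 r z).2) := by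
    refine (enorm_integral_le_lintegral_enorm _).trans ?_
    have mt : Measurable fun x : ℝ × ET => FF R u x.2 * ENNReal.ofReal ((KE e).indicator (fun w => ((e + x.1 - w.2 + ‖w.1‖ ^ 2)⁻¹) ^ 3) (Sm z0 r x.2)) := by
      have h0 := (Sm_cont z0 r).measurable
      have m1 : Measurable fun x : ℝ × ET => (Sm z0 r ⁻¹' (KE e)).indicator (fun _ => (1:ℝ)) x.2 :=
        (measurable_const.indicator ((KE_compact e).isClosed.measurableSet.preimage h0)).comp measurable_snd
      have m2 : Measurable fun x : ℝ × ET => ((e + x.1 - (Sm z0 r x.2).2 + ‖(Sm z0 r x.2).1‖ ^ 2)⁻¹) ^ 3 := by fun_prop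
      have m3 : Measurable fun x : ℝ × ET => FF R u x.2 := mF.comp measurable_snd
      convert m3.mul (m1.mul m2).ennreal_ofReal using 1
      ext x
      simp only [Pi.mul_apply]
      congr 2
      by_cases hx : Sm z0 r x.2 ∈ KE e <;> simp [hx]
    calc _ ≤ ∫⁻ l in Ioc (0:ℝ) 1, (C * T1 + C * (ENNReal.ofReal r * ∫⁻ z in Qz z0 r, FF R u z * ENNReal.ofReal ((KE e).indicator (fun w => ((e + l - w.2 + ‖w.1‖ ^ 2)⁻¹) ^ 3) (Sm z0 r z)))) :=
          setLIntegral_mono' measurableSet_Ioc fun l hl => hS l hl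
      _ = C * T1 + C * (ENNReal.ofReal r * ∫⁻ l in Ioc (0:ℝ) 1, ∫⁻ z in Qz z0 r, FF R u z * ENNReal.ofReal ((KE e).indicator (fun w => ((e + l - w.2 + ‖w.1‖ ^ 2)⁻¹) ^ 3) (Sm z0 r z))) := by
          have h1 : ∫⁻ _ in Ioc (0:ℝ) 1, C * T1 = C * T1 := by simp
          rw [lintegral_add_left measurable_const, h1, lintegral_const_mul' _ _ hC, lintegral_const_mul' _ _ ENNReal.ofReal_ne_top]
      _ = C * T1 + C * (ENNReal.ofReal r * ∫⁻ z in Qz z0 r, ∫⁻ l in Ioc (0:ℝ) 1, FF R u z * ENNReal.ofReal ((KE e).indicator (fun w => ((e + l - w.2 + ‖w.1‖ ^ 2)⁻¹) ^ 3) (Sm z0 r z))) := by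
          rw [lintegral_lintegral_swap mt.aemeasurable]
      _ ≤ _ := by
          gcongr with z
          have mm : Measurable fun l : ℝ => ENNReal.ofReal ((KE e).indicator (fun w => ((e + l - w.2 + ‖w.1‖ ^ 2)⁻¹) ^ 3) (Sm z0 r z)) := by
            by_cases hx : Sm z0 r z ∈ KE e
            · simp only [indicator_of_mem hx]; fun_prop
            · simp only [indicator_of_notMem hx]; fun_prop
          rw [lintegral_const_mul _ mm]
          gcongr
          exact th_kk he _
  calc _ ≤ (C * T1 + C * (ENNReal.ofReal r * ∫⁻ z in Qz z0 r, FF R u z * kk (Sm z0 r z).1 (Sm z0 r z).2)) + T1 := add_le_add b1 b2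
    _ = (C + 1) * T1 + C * (ENNReal.ofReal r * ∫⁻ z in Qz z0 r, FF R u z * kk (Sm z0 r z).1 (Sm z0 r z).2) := by ring
    _ ≤ _ := by gcongr; exact le_self_add

end ANS

namespace ANS

lemma hf_anti {e : ℝ} (he : 0 < e) : Antitone (hf e) := by
  intro a b h
  unfold hf
  refine Real.smoothTransition.monotone ?_
  have : -b/e ≤ -a/e := by gcongr
  linarith

lemma hf_dn {e : ℝ} (he : 0 < e) (s : ℝ) : deriv (hf e) s ≤ 0 := (hf_anti he).deriv_nonpos

lemma hf_dint {e : ℝ} (he : 0 < e) {r : ℝ} (hr : 0 < r) (t0 : ℝ) :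
    ∫⁻ t in Ioo (t0 - r^2) t0, ‖deriv (hf e) ((r^2)⁻¹ * (t - t0))‖ₑ ≤ ENNReal.ofReal (r^2) := by
  have hr2 : 0 < r^2 := by positivity
  have hs : ContDiff ℝ (⊤ : ℕ∞) (hf e) := hf_smooth e
  have hd : Differentiable ℝ (hf e) := hs.differentiable (by simp)
  have hc : Continuous (deriv (hf e)) := hs.continuous_deriv (by simp)
  have hD : ∀ t, HasDerivAt (fun t => -(r^2) * hf e ((r^2)⁻¹ * (t - t0))) (-deriv (hf e) ((r^2)⁻¹ * (t - t0))) t := by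
    intro t
    have h1 : HasDerivAt (fun t => (r^2)⁻¹ * (t - t0)) ((r^2)⁻¹) t := by
      simpa using ((hasDerivAt_id t).sub_const t0).const_mul ((r^2)⁻¹)
    have h2 := (HasDerivAt.comp t (hd _).hasDerivAt h1).const_mul (-(r^2))
    refine h2.congr_deriv ?_
    field_simp
  have hci : Continuous fun t => -deriv (hf e) ((r^2)⁻¹ * (t - t0)) := by fun_prop
  have h3 := intervalIntegral.integral_eq_sub_of_hasDerivAt (fun t _ => hD t) (hci.intervalIntegrable (t0 - r^2) t0)
  rw [intervalIntegral.integral_of_le (by linarith), integral_Ioc_eq_integral_Ioo] at h3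
  have h4 : ∀ t, ‖deriv (hf e) ((r^2)⁻¹ * (t - t0))‖ₑ = ENNReal.ofReal (-deriv (hf e) ((r^2)⁻¹ * (t - t0))) := by
    intro t
    rw [← Real.enorm_of_nonneg (by linarith [hf_dn he ((r^2)⁻¹ * (t - t0))]), enorm_neg]
  simp_rw [h4]
  rw [← ofReal_integral_eq_lintegral_ofReal, h3]
  · refine ENNReal.ofReal_le_ofReal ?_
    have a := hf_abs e ((r^2)⁻¹ * (t0 - t0))
    have b := hf_abs e ((r^2)⁻¹ * (t0 - r^2 - t0))
    nlinarith [a.1, b.2]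
  · exact hci.continuousOn.integrableOn_Icc.mono_set Ioo_subset_Icc_self
  · exact Eventually.of_forall fun t => by simpa using hf_dn he ((r^2)⁻¹ * (t - t0))

lemma kk_Sm {z0 : ET} {r : ℝ} (hr : 0 < r) (z : ET) :
    kk (Sm z0 r z).1 (Sm z0 r z).2 ≤ ENNReal.ofReal r ^ 4 * kk (z0.1 - z.1) (z0.2 - z.2) := by
  have h0 : ENNReal.ofReal r ≠ 0 := by simpa using hr
  have ht : ENNReal.ofReal r ≠ ∞ := ofReal_ne_top
  unfold kk Sm
  have e1 : ENNReal.ofReal |(r^2)⁻¹ * (z.2 - z0.2)| ^ (-2:ℝ) = ENNReal.ofReal r ^ 4 * ENNReal.ofReal |z0.2 - z.2| ^ (-2:ℝ) := by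
    rw [abs_mul, abs_of_pos (by positivity), ENNReal.ofReal_mul (by positivity), abs_sub_comm,
      ENNReal.ofReal_inv_of_pos (by positivity), ENNReal.ofReal_pow hr.le]
    rw [ENNReal.mul_rpow_of_ne_top (by simp [hr]) ofReal_ne_top]
    congr 1
    rw [ENNReal.rpow_neg, ENNReal.inv_rpow, inv_inv]
    norm_cast
    rw [← pow_mul]
  have e2 : ENNReal.ofReal ‖r⁻¹ • (z.1 - z0.1)‖ ^ (-4:ℝ) = ENNReal.ofReal r ^ 4 * ENNReal.ofReal ‖z0.1 - z.1‖ ^ (-4:ℝ) := by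
    rw [norm_smul, norm_inv, Real.norm_of_nonneg hr.le, norm_sub_rev, ENNReal.ofReal_mul (by positivity),
      ENNReal.ofReal_inv_of_pos (by positivity)]
    rw [ENNReal.mul_rpow_of_ne_top (by simp [hr]) ofReal_ne_top]
    congr 1
    rw [ENNReal.rpow_neg, ENNReal.inv_rpow, inv_inv]
    norm_cast
  simp only [e1, e2]
  rcases le_total (ENNReal.ofReal |z0.2 - z.2| ^ (-2:ℝ)) (ENNReal.ofReal ‖z0.1 - z.1‖ ^ (-4:ℝ)) with h | h
  · rw [min_eq_left h]; exact min_le_left _ _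
  · rw [min_eq_right h]; exact min_le_right _ _

lemma UU_h' {R : ℝ} {u : E3 → ℝ → E3} {P} (sol : SuitableWeakSolution R u P) : ∃ E : ℝ≥0∞, E ≠ ∞ ∧
    ∀ (z0 : ET) (r : ℝ), 0 < r → r ≤ 1 → Qz z0 r ⊆ QQ R → ∀ e : ℝ, 0 < e → ∀ k,
    ∫⁻ z in Qz z0 r, ‖UU R u k z‖ₑ * (1 + ‖(hh' e).1 (Sm z0 r z)‖ₑ) ≤ E := by
  obtain ⟨E0, hE0, h0⟩ := sol_L2 sol
  have hvb : volume (ball (0:E3) R) ≠ ∞ := measure_ball_lt_top.ne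
  refine ⟨(∑ k, ∫⁻ z, ‖UU R u k z‖ₑ) + (volume (ball (0:E3) R) + E0), ?_, ?_⟩
  · refine ENNReal.add_ne_top.2 ⟨?_, ENNReal.add_ne_top.2 ⟨hvb, hE0⟩⟩
    exact ENNReal.sum_ne_top.2 fun k _ => (UU_L1 sol k).2.ne
  intro z0 r hr hr1 hsub e he k
  have hUm : Measurable fun z => ‖UU R u k z‖ₑ := (UU_meas sol k).enorm
  have hhm : Measurable fun t : ℝ => ‖deriv (hf e) ((r^2)⁻¹ * (t - z0.2))‖ₑ := by fun_prop
  have hhm2 : Measurable fun z : ET => ‖deriv (hf e) ((r^2)⁻¹ * (z.2 - z0.2))‖ₑ := hhm.comp measurable_snd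
  have e1 : ∀ z, ‖UU R u k z‖ₑ * (1 + ‖(hh' e).1 (Sm z0 r z)‖ₑ) = ‖UU R u k z‖ₑ + ‖UU R u k z‖ₑ * ‖deriv (hf e) ((r^2)⁻¹ * (z.2 - z0.2))‖ₑ := by
    intro z; rw [mul_add, mul_one]; rfl
  simp_rw [e1]
  rw [lintegral_add_left hUm]
  refine add_le_add ?_ ?_
  · refine (setLIntegral_le_lintegral _ _).trans ?_
    exact Finset.single_le_sum (f := fun k => ∫⁻ z, ‖UU R u k z‖ₑ) (fun _ _ => zero_le) (Finset.mem_univ k)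
  have hfm : Measurable fun z : ET => ‖UU R u k z‖ₑ * ‖deriv (hf e) ((r^2)⁻¹ * (z.2 - z0.2))‖ₑ := hUm.mul hhm2
  have hcomp : ∀ x t, ‖UU R u k (x, t)‖ₑ ≤ 1 + ‖u x t‖ₑ * ‖u x t‖ₑ := by
    intro x t
    have h1 : ‖UU R u k (x,t)‖ₑ ≤ ‖u x t‖ₑ := by
      unfold UU
      refine (enorm_indicator_le_enorm_self _ _).trans ?_
      rw [← ofReal_norm, ← ofReal_norm]
      exact ENNReal.ofReal_le_ofReal (comp_le _ _)
    refine h1.trans ?_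
    rcases le_total ‖u x t‖ₑ 1 with h | h
    · exact h.trans le_self_add
    · refine le_trans ?_ le_add_self
      simpa using mul_le_mul_right h ‖u x t‖ₑ
  have hsl : ∀ᵐ t ∂(volume.restrict (Ioo (z0.2 - r^2) z0.2)), ∫⁻ x in ball z0.1 r, ‖UU R u k (x, t)‖ₑ ≤ volume (ball (0:E3) R) + E0 := by
    have hI : Ioo (z0.2 - r^2) z0.2 ⊆ Ioo (-(R^2)) 0 := by
      intro t ht
      have : ((z0.1, t) : ET) ∈ Qz z0 r := ⟨mem_ball_self hr, ht⟩
      exact (hsub this).2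
    have hr2 : 0 < r^2 := by positivity
    have hBB : ball z0.1 r ⊆ ball (0:E3) R := by
      intro x hx
      have : ((x, z0.2 - r^2/2) : ET) ∈ Qz z0 r := ⟨hx, by constructor <;> simp <;> linarith⟩
      exact (hsub this).1
    filter_upwards [ae_restrict_of_ae_restrict_of_subset hI h0] with t ht
    calc ∫⁻ x in ball z0.1 r, ‖UU R u k (x, t)‖ₑ ≤ ∫⁻ x in ball (0:E3) R, ‖UU R u k (x, t)‖ₑ := lintegral_mono_set hBB
      _ ≤ ∫⁻ x in ball (0:E3) R, (1 + ‖u x t‖ₑ * ‖u x t‖ₑ) := lintegral_mono fun x => hcomp x t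
      _ = volume (ball (0:E3) R) + ∫⁻ x in ball (0:E3) R, ‖u x t‖ₑ * ‖u x t‖ₑ := by
        rw [lintegral_add_left measurable_const]; simp
      _ ≤ _ := by gcongr
  unfold Qz
  rw [Measure.volume_eq_prod, ← Measure.prod_restrict, lintegral_prod_symm _ hfm.aemeasurable]
  calc _ = ∫⁻ t in Ioo (z0.2 - r^2) z0.2, (∫⁻ x in ball z0.1 r, ‖UU R u k (x, t)‖ₑ) * ‖deriv (hf e) ((r^2)⁻¹ * (t - z0.2))‖ₑ := by
        refine lintegral_congr fun t => ?_
        have m : Measurable fun x : E3 => ‖UU R u k (x, t)‖ₑ := hUm.comp measurable_prodMk_right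
        exact lintegral_mul_const ‖deriv (hf e) ((r^2)⁻¹ * (t - z0.2))‖ₑ m
    _ ≤ ∫⁻ t in Ioo (z0.2 - r^2) z0.2, (volume (ball (0:E3) R) + E0) * ‖deriv (hf e) ((r^2)⁻¹ * (t - z0.2))‖ₑ := by
        refine lintegral_mono_ae ?_
        filter_upwards [hsl] with t ht
        gcongr
    _ = (volume (ball (0:E3) R) + E0) * ∫⁻ t in Ioo (z0.2 - r^2) z0.2, ‖deriv (hf e) ((r^2)⁻¹ * (t - z0.2))‖ₑ := lintegral_const_mul _ hhm
    _ ≤ (volume (ball (0:E3) R) + E0) * 1 := by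
        gcongr
        refine (hf_dint he hr z0.2).trans ?_
        rw [ENNReal.ofReal_le_one]
        nlinarith
    _ = _ := mul_one _

/-- uniform right-hand side -/
def RS (C E : ℝ≥0∞) (R : ℝ) (u : E3 → ℝ → E3) (r : ℝ) (z0 : ET) : ℝ≥0∞ :=
  C * E + C * (ENNReal.ofReal r ^ 5 * ∫⁻ w in Qz z0 r, kk (z0.1 - w.1) (z0.2 - w.2) * FF R u w)

lemma stepU : ∃ C : ℝ≥0∞, C ≠ ∞ ∧ ∀ (R : ℝ) (u : E3 → ℝ → E3) (P : E3 → ℝ → ℝ), SuitableWeakSolution R u P →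
    ∃ E : ℝ≥0∞, E ≠ ∞ ∧ ∀ (z0 : ET) (r : ℝ), 0 < r → r ≤ 1 → Qz z0 r ⊆ QQ R → ∀ e : ℝ, 0 < e → e ≤ 1/8 → ∀ k,
    ‖∫ z, UU R u k z * Kf e (Sm z0 r z)‖ₑ ≤ RS C E R u r z0 := by
  obtain ⟨C, hC, h⟩ := stepK
  refine ⟨C, hC, fun R u P sol => ?_⟩
  obtain ⟨E, hE, h2⟩ := UU_h' sol
  refine ⟨E, hE, fun z0 r hr hr1 hs e he he1 k => ?_⟩
  refine (h R u P sol z0 r hr hr1 hs e he he1 k).trans ?_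
  unfold RS
  gcongr C * ?_ + C * ?_
  · exact h2 z0 r hr hr1 hs e he k
  · rw [pow_succ' _ 4, mul_assoc]
    refine mul_le_mul_right ?_ _
    rw [← lintegral_const_mul' _ _ (by finiteness)]
    refine lintegral_mono fun z => ?_
    rw [mul_comm, ← mul_assoc]
    gcongr
    exact kk_Sm hr z

end ANS

namespace ANS

def th' (x : ℝ) : ℝ := deriv Real.smoothTransition x

lemma th_smooth : ContDiff ℝ (⊤ : ℕ∞) Real.smoothTransition := Real.smoothTransition.contDiff
lemma th'_cont : Continuous th' := th_smooth.continuous_deriv (by simp)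
lemma th'_nonneg (x : ℝ) : 0 ≤ th' x := Real.smoothTransition.monotone.deriv_nonneg
lemma th'_zero {x : ℝ} (h : ¬ (x ∈ Icc (0:ℝ) 1)) : th' x = 0 := by
  unfold th'
  rcases lt_or_ge x 0 with h0 | h0
  · have : Real.smoothTransition =ᶠ[nhds x] fun _ => 0 := by
      filter_upwards [Iio_mem_nhds h0] with y hy
      exact Real.smoothTransition.zero_of_nonpos hy.le
    rw [this.deriv_eq]; simp
  · have h1 : 1 < x := by
      by_contra h1
      exact h ⟨h0, not_lt.1 h1⟩
    have : Real.smoothTransition =ᶠ[nhds x] fun _ => 1 := by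
      filter_upwards [Ioi_mem_nhds h1] with y hy
      exact Real.smoothTransition.one_of_one_le hy.le
    rw [this.deriv_eq]; simp
lemma th'_bdd : ∃ M : ℝ, 0 ≤ M ∧ ∀ x, th' x ≤ M := by
  obtain ⟨M, hM⟩ := (isCompact_Icc (a := (0:ℝ)) (b := 1)).bddAbove_image th'_cont.continuousOn
  refine ⟨max M 0, le_max_right _ _, fun x => ?_⟩
  by_cases h : x ∈ Icc (0:ℝ) 1
  · exact (hM (mem_image_of_mem _ h)).trans (le_max_left _ _)
  · rw [th'_zero h]; exact le_max_right _ _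
lemma th'_pos : ∃ x, th' x ≠ 0 := by
  obtain ⟨c, -, hc⟩ := exists_deriv_eq_slope Real.smoothTransition (a := 0) (b := 1) (by norm_num)
    th_smooth.continuous.continuousOn (th_smooth.differentiable (by simp)).differentiableOn
  refine ⟨c, ?_⟩
  unfold th'
  rw [hc]
  simp

/-- limit kernel -/
def WK (w : ET) : ℝ := th' (-w.2 - 1) * Gf (1 - w.2) ‖w.1‖

lemma Gf_pos (s n : ℝ) : 0 < Gf s n := Real.exp_pos _
lemma WK_nonneg (w : ET) : 0 ≤ WK w := mul_nonneg (th'_nonneg _) (Gf_pos _ _).le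
lemma WK_meas : Measurable WK := by
  have h : Measurable fun w : ET => th' (-w.2 - 1) := th'_cont.measurable.comp (by fun_prop)
  exact h.mul (Gf_meas (by fun_prop) (by fun_prop))

lemma WK_bd : ∃ M : ℝ, 0 ≤ M ∧ ∀ w, WK w ≤ Real.exp (-(1/12) * ‖w.1‖ ^ 2) * (Icc (-2:ℝ) (-1)).indicator (fun _ => M) w.2 := by
  obtain ⟨M, hM0, hM⟩ := th'_bdd
  refine ⟨M, hM0, fun w => ?_⟩
  unfold WK
  by_cases h : w.2 ∈ Icc (-2:ℝ) (-1)
  · rw [indicator_of_mem h, mul_comm]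
    refine mul_le_mul ?_ (hM _) (th'_nonneg _) (Real.exp_pos _).le
    unfold Gf
    rw [Real.exp_le_exp]
    have h1 := Real.log_nonneg (x := 1 - w.2) (by linarith [h.2])
    have h2 : (6:ℝ)⁻¹ ≤ (2 * (1 - w.2))⁻¹ := by
      apply inv_anti₀ <;> linarith [h.1, h.2]
    have h3 : ‖w.1‖^2 * (6:ℝ)⁻¹ ≤ ‖w.1‖^2 * (2 * (1 - w.2))⁻¹ := by gcongr
    linarith
  · rw [indicator_of_notMem h, th'_zero]; · simp
    intro h'; exact h ⟨by linarith [h'.2], by linarith [h'.1]⟩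

lemma exp_int : Integrable fun x : E3 => Real.exp (-(1/12) * ‖x‖ ^ 2) := by
  have := (GaussianFourier.integrable_cexp_neg_mul_sq_norm_add (V := E3) (b := (1/12:ℝ)) (by norm_num) 0 0).norm
  refine this.congr (ae_of_all _ fun x => ?_)
  simp only [Complex.norm_exp]
  congr 1
  norm_cast
  simp

lemma WK_int : Integrable WK := by
  obtain ⟨M, hM0, hM⟩ := WK_bd
  have h2 : Integrable ((Icc (-2:ℝ) (-1)).indicator (fun _ => M)) := by
    rw [integrable_indicator_iff measurableSet_Icc]
    exact integrableOn_const (by simp)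
  refine (exp_int.mul_prod h2).mono' WK_meas.aestronglyMeasurable (ae_of_all _ fun w => ?_)
  rw [Real.norm_of_nonneg (WK_nonneg w)]
  exact hM w

lemma WK_le : ∃ M : ℝ, 0 ≤ M ∧ ∀ w, WK w ≤ M := by
  obtain ⟨M, hM0, hM⟩ := WK_bd
  refine ⟨M, hM0, fun w => (hM w).trans ?_⟩
  have h1 : Real.exp (-(1/12) * ‖w.1‖ ^ 2) ≤ 1 := by
    rw [Real.exp_le_one_iff]; nlinarith [sq_nonneg ‖w.1‖]
  have h2 : (Icc (-2:ℝ) (-1)).indicator (fun _ => M) w.2 ≤ M := indicator_apply_le' (fun _ => le_rfl) (fun _ => hM0)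
  calc _ ≤ 1 * M := mul_le_mul h1 h2 (indicator_nonneg (fun _ _ => hM0) _) zero_le_one
    _ = M := one_mul M

lemma WK_pos : 0 < ∫ w, WK w := by
  rw [integral_pos_iff_support_of_nonneg WK_nonneg WK_int]
  have : Function.support WK = (fun w : ET => th' (-w.2 - 1)) ⁻¹' {0}ᶜ := by
    ext w
    simp only [Function.mem_support, WK, mem_preimage, mem_compl_iff, mem_singleton_iff, ne_eq, mul_eq_zero, (Gf_pos _ _).ne', or_false]
  rw [this]
  have ho : IsOpen ((fun w : ET => th' (-w.2 - 1)) ⁻¹' {0}ᶜ) :=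
    isOpen_compl_singleton.preimage (th'_cont.comp (by fun_prop))
  obtain ⟨x, hx⟩ := th'_pos
  exact ho.measure_pos volume ⟨(0, -x - 1), by simpa using hx⟩

lemma hf_deriv {e : ℝ} (he : 0 < e) (x : ℝ) : deriv (hf e) (e * x) = -(e⁻¹) * th' (-x - 1) := by
  have h1 : HasDerivAt (fun s : ℝ => -s / e - 1) (-(e⁻¹)) (e * x) := by
    have := (((hasDerivAt_id (e * x)).neg).div_const e).sub_const 1
    refine this.congr_deriv ?_
    simp [neg_div]
  have h2 : HasDerivAt Real.smoothTransition (th' (-(e*x)/e - 1)) (-(e*x)/e - 1) :=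
    (th_smooth.differentiable (by simp) _).hasDerivAt
  have h3 := HasDerivAt.comp (e * x) h2 h1
  have h4 : -(e*x)/e - 1 = -x - 1 := by field_simp
  rw [h4] at h3
  have : hf e = Real.smoothTransition ∘ fun s => -s / e - 1 := rfl
  rw [this, h3.deriv]; ring

/-- parabolic dilation -/
def Dl (a : ℝ) (w : ET) : ET := (a • w.1, a ^ 2 * w.2)

lemma Kf_Dl {a : ℝ} (ha : 0 < a) (w : ET) : Kf (a^2) (Dl a w) = (a^5)⁻¹ * (XX.1 (Dl a w) * WK w) := by
  have h1 : (hh' (a^2)).1 (Dl a w) = deriv (hf (a^2)) (a^2 * w.2) := rfl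
  unfold Kf WK
  rw [h1, hf_deriv (by positivity)]
  by_cases h : -w.2 - 1 ∈ Icc (0:ℝ) 1
  · have h2 : 0 < 1 - w.2 := by linarith [h.1]
    have h3 : Gf (a^2 - (Dl a w).2) ‖(Dl a w).1‖ = (a^3)⁻¹ * Gf (1 - w.2) ‖w.1‖ := by
      unfold Gf Dl
      simp only
      rw [show a^2 - a^2 * w.2 = a^2 * (1 - w.2) by ring, Real.log_mul (by positivity) h2.ne', norm_smul, Real.norm_of_nonneg ha.le, Real.log_pow]
      have h5 : (a^3)⁻¹ = Real.exp (-3 * Real.log a) := by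
        rw [neg_mul, Real.exp_neg, mul_comm, Real.exp_mul, Real.exp_log ha]; norm_cast
      rw [h5, ← Real.exp_add]
      congr 1
      push_cast
      field_simp
      ring
    rw [h3]
    field_simp
  · rw [th'_zero h]; simp

lemma Dl_cont : Continuous fun z : ℝ × ET => Dl z.1 z.2 := by unfold Dl; fun_prop

lemma Kf_meas {e : ℝ} : Measurable (Kf e) := by
  unfold Kf
  have h1 : Measurable (hh' e).1 := (con _).measurable
  have h2 : Measurable XX.1 := (con _).measurable
  exact h1.neg.mul (h2.mul (Gf_meas (by fun_prop) (by fun_prop)))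

lemma Dl_Dl {a b : ℝ} (w : ET) : Dl a (Dl b w) = Dl (a * b) w := by
  unfold Dl; ext1 <;> simp [smul_smul]; ring

lemma Kf_le {a : ℝ} (ha : 0 < a) : ∃ M : ℝ, ∀ w, ‖Kf (a^2) w‖ ≤ M := by
  obtain ⟨M, hM0, hM⟩ := WK_le
  refine ⟨(a^5)⁻¹ * M, fun w => ?_⟩
  have h : w = Dl a (Dl a⁻¹ w) := by
    rw [Dl_Dl, mul_inv_cancel₀ ha.ne']; unfold Dl; simp
  rw [h, Kf_Dl ha, norm_mul, Real.norm_of_nonneg (by positivity)]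
  gcongr
  have := XX_abs (Dl a (Dl a⁻¹ w))
  rw [Real.norm_of_nonneg (mul_nonneg this.1 (WK_nonneg _))]
  nlinarith [hM (Dl a⁻¹ w), WK_nonneg (Dl a⁻¹ w)]

instance : (volume : Measure ET).IsAddHaarMeasure :=
  Measure.prod.instIsAddHaarMeasure (volume : Measure E3) (volume : Measure ℝ)

lemma Dl_change {a : ℝ} (ha : 0 < a) (z : ET) (f : ET → ℝ) : ∫ y, f y = a ^ 5 * ∫ w, f (z - Dl a w) := by
  let D : ET →ₗ[ℝ] ET := LinearMap.prodMap (a • LinearMap.id) (a^2 • LinearMap.id)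
  have hD : ∀ w, D w = Dl a w := fun w => by simp [D, Dl]
  have hdet : LinearMap.det D = a ^ 5 := by
    simp only [D]
    rw [LinearMap.det_prodMap, LinearMap.det_smul, LinearMap.det_smul]
    simp; ring
  have hdet0 : LinearMap.det D ≠ 0 := by rw [hdet]; positivity
  have h1 : ∫ y, f y = ∫ y, f (z - y) := (integral_sub_left_eq_self f volume z).symm
  have hm := Measure.map_linearMap_addHaar_eq_smul_addHaar (volume : Measure ET) hdet0
  have he : MeasurableEmbedding D := by
    have : Continuous D := LinearMap.continuous_of_finiteDimensional D
    refine this.measurableEmbedding ?_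
    exact (LinearMap.equivOfDetNeZero D hdet0).injective
  have h2 := he.integral_map (μ := volume) (fun y => f (z - y))
  rw [hm, integral_smul_measure] at h2
  simp only [hD] at h2
  rw [h1, ← h2, hdet, abs_of_pos (by positivity), ENNReal.toReal_ofReal (by positivity), smul_eq_mul]
  field_simp

end ANS

namespace ANS

def c0 : ℝ := ∫ w, WK w
def an (n : ℕ) : ℝ := 1 / ((n:ℝ) + 1 + 3)
lemma an_pos (n : ℕ) : 0 < an n := by unfold an; positivity
lemma an_le (n : ℕ) : an n ^ 2 ≤ 1/8 := by
  have : an n ≤ 1 / 3 := by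
    unfold an; apply one_div_le_one_div_of_le <;> linarith [Nat.cast_nonneg (α := ℝ) n]
  nlinarith [an_pos n]
lemma an_lim : Tendsto an atTop (nhds 0) := by
  have h := (tendsto_one_div_add_atTop_nhds_zero_nat (𝕜 := ℝ)).comp (tendsto_add_atTop_nat 3)
  refine h.congr fun n => ?_
  simp [an]; ring

def JJ (B : Set ET) (r a : ℝ) (z : ET) : ℝ := ∫ z0, B.indicator (fun _ => (1:ℝ)) z0 * Kf (a^2) (Sm z0 r z)

lemma JJ_eq {B : Set ET} {r a : ℝ} (hr : 0 < r) (ha : 0 < a) (z : ET) :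
    JJ B r a z = r ^ 5 * ∫ w, B.indicator (fun _ => (1:ℝ)) (z - Dl (r * a) w) * (XX.1 (Dl a w) * WK w) := by
  unfold JJ
  rw [Dl_change (a := r * a) (by positivity) z]
  have : ∀ w, Sm (z - Dl (r * a) w) r z = Dl a w := by
    intro w
    unfold Sm Dl
    ext1
    · simp only [Prod.fst_sub]
      rw [show z.1 - (z.1 - (r * a) • w.1) = (r * a) • w.1 by abel, smul_smul]
      congr 1; field_simp
    · simp only [Prod.snd_sub]
      field_simp; ring
  simp_rw [this, Kf_Dl ha]
  rw [← integral_const_mul, ← integral_const_mul]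
  refine integral_congr_ae (ae_of_all _ fun w => ?_)
  simp only
  field_simp

lemma ind_abs (B : Set ET) (z : ET) : 0 ≤ B.indicator (fun _ => (1:ℝ)) z ∧ B.indicator (fun _ => (1:ℝ)) z ≤ 1 := by
  by_cases h : z ∈ B <;> simp [h]

lemma ing_bd (B : Set ET) (z y w : ET) : ‖B.indicator (fun _ => (1:ℝ)) z * (XX.1 y * WK w)‖ ≤ WK w := by
  have h1 := ind_abs B z
  have h2 := XX_abs y
  have h3 := WK_nonneg w
  have h4 : 0 ≤ XX.1 y * WK w := mul_nonneg h2.1 h3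
  rw [Real.norm_of_nonneg (mul_nonneg h1.1 h4)]
  calc _ ≤ 1 * (1 * WK w) := by
        refine mul_le_mul h1.2 ?_ h4 zero_le_one
        exact mul_le_mul_of_nonneg_right h2.2 h3
    _ = _ := by ring

lemma JJ_bd {B : Set ET} {r a : ℝ} (hr : 0 < r) (ha : 0 < a) (z : ET) : ‖JJ B r a z‖ ≤ r ^ 5 * c0 := by
  rw [JJ_eq hr ha, norm_mul, Real.norm_of_nonneg (by positivity)]
  gcongr
  exact norm_integral_le_of_norm_le WK_int (ae_of_all _ fun w => ing_bd _ _ _ _)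

lemma Dl_meas (a : ℝ) : Measurable (Dl a) := by unfold Dl; fun_prop

lemma Dl_lim {b : ℕ → ℝ} (hb : Tendsto b atTop (nhds 0)) (w : ET) : Tendsto (fun n => Dl (b n) w) atTop (nhds 0) := by
  have h : Continuous fun a : ℝ => Dl a w := by unfold Dl; fun_prop
  have := (h.tendsto 0).comp hb
  have h0 : Dl 0 w = 0 := by simp [Dl]
  rwa [h0] at this

lemma JJ_lim {B : Set ET} (hBm : MeasurableSet B) {r : ℝ} (hr : 0 < r) {z : ET} (hz : z ∉ frontier B) :
    Tendsto (fun n => JJ B r (an n) z) atTop (nhds (r ^ 5 * (B.indicator (fun _ => (1:ℝ)) z * c0))) := by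
  have h : ∀ n, JJ B r (an n) z = _ := fun n => JJ_eq hr (an_pos n) z
  simp_rw [h]
  refine Tendsto.const_mul _ ?_
  have hc : B.indicator (fun _ => (1:ℝ)) z * c0 = ∫ w, B.indicator (fun _ => (1:ℝ)) z * (1 * WK w) := by
    rw [integral_const_mul]; simp [c0]
  rw [hc]
  refine tendsto_integral_of_dominated_convergence WK ?_ WK_int (fun n => ae_of_all _ fun w => ing_bd _ _ _ _) (ae_of_all _ fun w => ?_)
  · intro n
    have m1 : Measurable fun w => B.indicator (fun _ => (1:ℝ)) (z - Dl (r * an n) w) :=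
      (measurable_const.indicator hBm).comp ((Dl_meas _).const_sub z)
    have m2 : Measurable fun w => XX.1 (Dl (an n) w) := (con XX).measurable.comp (Dl_meas _)
    exact (m1.mul (m2.mul WK_meas)).aestronglyMeasurable
  · refine Tendsto.mul ?_ (Tendsto.mul ?_ tendsto_const_nhds)
    · have hra : Tendsto (fun n => r * an n) atTop (nhds 0) := by simpa using an_lim.const_mul r
      have h1 : Tendsto (fun n => z - Dl (r * an n) w) atTop (nhds z) := by
        simpa using (Dl_lim hra w).const_sub z
      have h2 : ContinuousAt (B.indicator (fun _ => (1:ℝ))) z :=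
        (continuous_const.continuousOn).continuousAt_indicator hz
      exact h2.tendsto.comp h1
    · have h1 := ((con XX).tendsto 0).comp (Dl_lim an_lim w)
      rwa [XX_one (by simp) (by simp)] at h1

lemma JJ_meas {B : Set ET} (hBm : MeasurableSet B) (r a : ℝ) : Measurable (JJ B r a) := by
  have m : Measurable fun q : ET × ET => B.indicator (fun _ => (1:ℝ)) q.2 * Kf (a^2) (Sm q.2 r q.1) := by
    refine ((measurable_const.indicator hBm).comp measurable_snd).mul (Kf_meas.comp ?_)
    unfold Sm; fun_prop
  have : StronglyMeasurable fun z => ∫ z0, B.indicator (fun _ => (1:ℝ)) z0 * Kf (a^2) (Sm z0 r z) :=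
    StronglyMeasurable.integral_prod_right' (f := fun q : ET × ET => B.indicator (fun _ => (1:ℝ)) q.2 * Kf (a^2) (Sm q.2 r q.1)) m.stronglyMeasurable
  exact this.measurable

lemma swapI {B : Set ET} (hBm : MeasurableSet B) (hB : volume B ≠ ∞) (r : ℝ) {a : ℝ} (ha : 0 < a) {U : ET → ℝ} (hU : Integrable U) :
    ∫ z0 in B, ∫ z, U z * Kf (a^2) (Sm z0 r z) = ∫ z, U z * JJ B r a z := by
  obtain ⟨M, hM⟩ := Kf_le ha
  have hind : Integrable (B.indicator (fun _ => (1:ℝ))) := by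
    rw [integrable_indicator_iff hBm]; exact integrableOn_const hB
  have m : Measurable fun q : ET × ET => Kf (a^2) (Sm q.1 r q.2) := by
    refine (Kf_meas.comp ?_)
    unfold Sm; fun_prop
  have hi : Integrable (fun q : ET × ET => (B.indicator (fun _ => (1:ℝ)) q.1 * U q.2) * Kf (a^2) (Sm q.1 r q.2)) (volume.prod volume) :=
    (hind.mul_prod hU).mul_bdd (c := M) m.aestronglyMeasurable (ae_of_all _ fun q => hM _)
  rw [← integral_indicator hBm]
  calc _ = ∫ z0, ∫ z, (B.indicator (fun _ => (1:ℝ)) z0 * U z) * Kf (a^2) (Sm z0 r z) := by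
        refine integral_congr_ae (ae_of_all _ fun z0 => ?_)
        by_cases h : z0 ∈ B <;> simp [h]
    _ = ∫ z, ∫ z0, (B.indicator (fun _ => (1:ℝ)) z0 * U z) * Kf (a^2) (Sm z0 r z) := integral_integral_swap hi
    _ = _ := by
        refine integral_congr_ae (ae_of_all _ fun z => ?_)
        simp only
        unfold JJ
        rw [← integral_const_mul]
        refine integral_congr_ae (ae_of_all _ fun z0 => ?_)
        simp only; ring

lemma limI {B : Set ET} (hBm : MeasurableSet B) (hB : volume B ≠ ∞) (hfr : volume (frontier B) = 0) {r : ℝ} (hr : 0 < r) {U : ET → ℝ} (hU : Integrable U) :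
    Tendsto (fun n => ∫ z0 in B, ∫ z, U z * Kf (an n^2) (Sm z0 r z)) atTop (nhds (r^5 * c0 * ∫ z in B, U z)) := by
  simp_rw [fun n => swapI hBm hB r (an_pos n) hU]
  have hc : r^5 * c0 * ∫ z in B, U z = ∫ z, U z * (r^5 * (B.indicator (fun _ => (1:ℝ)) z * c0)) := by
    rw [← integral_indicator hBm, ← integral_const_mul]
    refine integral_congr_ae (ae_of_all _ fun z => ?_)
    by_cases h : z ∈ B <;> simp [h]; ring
  rw [hc]
  refine tendsto_integral_of_dominated_convergence (fun z => ‖U z‖ * (r^5 * c0)) ?_ (hU.norm.mul_const _) ?_ ?_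
  · exact fun n => hU.aestronglyMeasurable.mul (JJ_meas hBm _ _).aestronglyMeasurable
  · refine fun n => ae_of_all _ fun z => ?_
    rw [norm_mul]
    gcongr
    exact JJ_bd hr (an_pos n) z
  · have : ∀ᵐ z : ET, z ∉ frontier B := measure_eq_zero_iff_ae_notMem.1 hfr
    filter_upwards [this] with z hz
    exact (JJ_lim hBm hr hz).const_mul _

/-- Lebesgue differentiation comparison -/
lemma LD {f g : ET → ℝ} (hf : LocallyIntegrable f) (hg : LocallyIntegrable g) {O : Set ET} (hO : IsOpen O)
    (h : ∀ z δ, 0 < δ → closedBall z δ ⊆ O → |∫ y in closedBall z δ, f y| ≤ ∫ y in closedBall z δ, g y) :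
    ∀ᵐ z, z ∈ O → |f z| ≤ g z := by
  filter_upwards [IsUnifLocDoublingMeasure.ae_tendsto_average volume hf 1, IsUnifLocDoublingMeasure.ae_tendsto_average volume hg 1] with z h1 h2 hz
  have hd : Tendsto an atTop (nhdsWithin 0 (Ioi 0)) :=
    tendsto_nhdsWithin_iff.2 ⟨an_lim, Eventually.of_forall fun n => an_pos n⟩
  have hm : ∀ᶠ j : ℕ in atTop, z ∈ closedBall z (1 * an j) :=
    Eventually.of_forall fun j => mem_closedBall_self (by linarith [an_pos j])
  have t1 := (h1 (fun _ : ℕ => z) an hd hm).abs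
  have t2 := h2 (fun _ : ℕ => z) an hd hm
  refine le_of_tendsto_of_tendsto t1 t2 ?_
  obtain ⟨ε, hε, hs⟩ := Metric.isOpen_iff.1 hO z hz
  filter_upwards [an_lim.eventually (gt_mem_nhds hε)] with n hn
  have := h z (an n) (an_pos n) ((closedBall_subset_ball hn).trans hs)
  rw [setAverage_eq, setAverage_eq, smul_eq_mul, smul_eq_mul, abs_mul, abs_of_nonneg (by positivity)]
  gcongr

end ANS

namespace ANS

def TS (R : ℝ) (u : E3 → ℝ → E3) (r : ℝ) (z0 : ET) : ℝ≥0∞ :=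
  ∫⁻ w in Qz z0 r, kk (z0.1 - w.1) (z0.2 - w.2) * FF R u w

variable {R : ℝ} {u : E3 → ℝ → E3} {P : E3 → ℝ → ℝ}

lemma Qz_meas (z : ET) (r : ℝ) : MeasurableSet (Qz z r) := measurableSet_ball.prod measurableSet_Ioo

lemma TS_meas (sol : SuitableWeakSolution R u P) (r : ℝ) : Measurable (TS R u r) := by
  have hF := FF_meas sol
  have hS : MeasurableSet {q : ET × ET | q.2 ∈ Qz q.1 r} := by
    have : {q : ET × ET | q.2 ∈ Qz q.1 r} = {q | dist q.2.1 q.1.1 < r} ∩ ({q | q.1.2 - r^2 < q.2.2} ∩ {q | q.2.2 < q.1.2}) := by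
      ext q; rfl
    rw [this]
    refine (measurableSet_lt (by fun_prop) (by fun_prop)).inter ((measurableSet_lt (by fun_prop) (by fun_prop)).inter (measurableSet_lt (by fun_prop) (by fun_prop)))
  have mk : Measurable fun q : ET × ET => kk (q.1.1 - q.2.1) (q.1.2 - q.2.2) := kkm (by fun_prop) (by fun_prop)
  have mF : Measurable fun q : ET × ET => FF R u q.2 := hF.comp measurable_snd
  have m := (mk.mul mF).indicator hS
  have h := m.lintegral_prod_right' (ν := volume)
  convert h using 1
  ext z0
  unfold TS
  rw [← lintegral_indicator (Qz_meas z0 r)]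
  rfl

lemma FF_fin (sol : SuitableWeakSolution R u P) : ∫⁻ z, FF R u z ≠ ∞ := by
  unfold FF
  rw [lintegral_indicator (QQ_meas R)]
  exact sol_F sol

lemma TS_fin (sol : SuitableWeakSolution R u P) (r : ℝ) (z : ET) (δ : ℝ) : ∫⁻ z0 in closedBall z δ, TS R u r z0 ≠ ∞ := by
  obtain ⟨C, hC, hk⟩ := kk_mass
  have hF := FF_meas sol
  set A := (ENNReal.ofReal (2 / (1-1/2)) + 1) * (volume (closedBall z.2 δ)) ^ (1 - 1/2 : ℝ) with hA
  have hAf : A ≠ ∞ := by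
    refine ENNReal.mul_ne_top (by finiteness) (ENNReal.rpow_ne_top_of_nonneg (by norm_num) measure_closedBall_lt_top.ne)
  have mk : Measurable fun q : ET × ET => kk (q.1.1 - q.2.1) (q.1.2 - q.2.2) := kkm (by fun_prop) (by fun_prop)
  have mF : Measurable fun q : ET × ET => FF R u q.2 := hF.comp measurable_snd
  have hb : ∀ w : ET, ∫⁻ z0 in closedBall z δ, kk (z0.1 - w.1) (z0.2 - w.2) ≤ C * A := by
    intro w
    have mk2 : Measurable fun z0 : ET => kk (z0.1 - w.1) (z0.2 - w.2) := kkm (by fun_prop) (by fun_prop)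
    rw [← Prod.eta z, ← closedBall_prod_same]
    rw [Measure.volume_eq_prod, ← Measure.prod_restrict, lintegral_prod_symm _ mk2.aemeasurable]
    calc _ ≤ ∫⁻ t in closedBall z.2 δ, C * rk (1/2) (w.2 - t) := by
          refine lintegral_mono_ae ?_
          filter_upwards [ae_restrict_of_ae (ae_ne w.2)] with t ht
          refine (setLIntegral_le_lintegral _ _).trans ?_
          refine le_trans (le_of_eq ?_) (hk w.1 (w.2 - t) ht)
          refine lintegral_congr fun x => ?_
          rw [← kk_neg]; simp
      _ = C * ∫⁻ t in closedBall z.2 δ, rk (1/2) (w.2 - t) := lintegral_const_mul' _ _ hC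
      _ ≤ C * A := by
          gcongr
          exact hls_set (by norm_num) (by norm_num) _ _
  refine ne_of_lt ?_
  calc ∫⁻ z0 in closedBall z δ, TS R u r z0 ≤ ∫⁻ z0 in closedBall z δ, ∫⁻ w, kk (z0.1 - w.1) (z0.2 - w.2) * FF R u w :=
        lintegral_mono fun z0 => setLIntegral_le_lintegral _ _
    _ = ∫⁻ w, ∫⁻ z0 in closedBall z δ, kk (z0.1 - w.1) (z0.2 - w.2) * FF R u w :=
        lintegral_lintegral_swap (mk.mul mF).aemeasurable
    _ ≤ ∫⁻ w, (C * A) * FF R u w := by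
        refine lintegral_mono fun w => ?_
        have mk2 : Measurable fun z0 : ET => kk (z0.1 - w.1) (z0.2 - w.2) := kkm (by fun_prop) (by fun_prop)
        rw [lintegral_mul_const _ mk2]
        gcongr
        exact hb w
    _ = (C * A) * ∫⁻ w, FF R u w := lintegral_const_mul _ hF
    _ < ∞ := (ENNReal.mul_ne_top (ENNReal.mul_ne_top hC hAf) (FF_fin sol)).lt_top

lemma RS_meas (sol : SuitableWeakSolution R u P) (C E : ℝ≥0∞) (r : ℝ) : Measurable (RS C E R u r) :=
  (((TS_meas sol r).const_mul _).const_mul _).const_add _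

lemma RS_fin (sol : SuitableWeakSolution R u P) {C E : ℝ≥0∞} (hC : C ≠ ∞) (hE : E ≠ ∞) (r : ℝ) (z : ET) (δ : ℝ) :
    ∫⁻ z0 in closedBall z δ, RS C E R u r z0 ≠ ∞ := by
  have hT := TS_meas sol r
  have : ∀ z0, RS C E R u r z0 = C * E + (C * ENNReal.ofReal r ^ 5) * TS R u r z0 := fun z0 => by
    unfold RS TS; rw [mul_assoc]
  simp_rw [this]
  rw [lintegral_add_left measurable_const, lintegral_const_mul _ hT, setLIntegral_const]
  refine ENNReal.add_ne_top.2 ⟨ENNReal.mul_ne_top (ENNReal.mul_ne_top hC hE) measure_closedBall_lt_top.ne, ENNReal.mul_ne_top (ENNReal.mul_ne_top hC (by finiteness)) (TS_fin sol r z δ)⟩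

lemma RS_loc (sol : SuitableWeakSolution R u P) {C E : ℝ≥0∞} (hC : C ≠ ∞) (hE : E ≠ ∞) (r : ℝ) :
    LocallyIntegrable fun z => (RS C E R u r z).toReal := by
  intro z
  refine ⟨closedBall z 1, closedBall_mem_nhds z one_pos, ?_⟩
  exact integrable_toReal_of_lintegral_ne_top (RS_meas sol C E r).aemeasurable (RS_fin sol hC hE r z 1)

def Adm (R r : ℝ) : Set ET := {z | Qz z r ⊆ QQ R}

lemma Adm_convex (R r : ℝ) : Convex ℝ (Adm R r) := by
  have hQ : Convex ℝ (QQ R) := (convex_ball _ _).prod (convex_Ioo _ _)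
  intro z hz z' hz' a b ha hb hab w hw
  have h1 : w - (a • z + b • z') + z ∈ QQ R := by
    refine hz ⟨?_, ?_⟩
    · have := hw.1; simp only [mem_ball, dist_eq_norm] at this ⊢
      simpa using this
    · have := hw.2
      simp only [mem_Ioo, Prod.snd_add, Prod.snd_sub] at this ⊢
      constructor <;> linarith [this.1, this.2]
  have h2 : w - (a • z + b • z') + z' ∈ QQ R := by
    refine hz' ⟨?_, ?_⟩
    · have := hw.1; simp only [mem_ball, dist_eq_norm] at this ⊢
      simpa using this
    · have := hw.2
      simp only [mem_Ioo, Prod.snd_add, Prod.snd_sub] at this ⊢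
      constructor <;> linarith [this.1, this.2]
  have h3 := hQ h1 h2 ha hb hab
  convert h3 using 1
  have : w = (a + b) • w := by rw [hab, one_smul]
  have h5 : a • z + b • z' = (a + b) • (a • z + b • z') := by rw [hab, one_smul]
  calc w = (a + b) • w - (a + b) • (a • z + b • z') + (a • z + b • z') := by rw [← this, ← h5]; abel
    _ = _ := by module

lemma Adm_ae (R r : ℝ) : ∀ᵐ z : ET, Qz z r ⊆ QQ R → z ∈ interior (Adm R r) := by
  have h := measure_eq_zero_iff_ae_notMem.1 ((Adm_convex R r).addHaar_frontier volume)
  filter_upwards [h] with z hz hs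
  by_contra hi
  exact hz ⟨subset_closure hs, hi⟩

lemma Adm_int {r : ℝ} (hr : 0 < r) {z : ET} (hz : z ∈ interior (Adm R r)) : z ∈ QQ R := by
  obtain ⟨ε, hε, hs⟩ := Metric.isOpen_iff.1 isOpen_interior z hz
  set η := min (ε/2) (r^2/2) with hη
  have hr2 : 0 < r^2 := by positivity
  have hη0 : 0 < η := lt_min (by linarith) (by linarith)
  have h1 : ((z.1, z.2 + η) : ET) ∈ ball z ε := by
    rw [mem_ball, Prod.dist_eq]
    simp only [dist_self, dist_self_add_left, Real.norm_of_nonneg hη0.le]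
    rw [max_eq_right hη0.le]
    linarith [min_le_left (ε/2) (r^2/2)]
  have h2 : Qz (z.1, z.2 + η) r ⊆ QQ R := interior_subset (hs h1)
  refine h2 ⟨mem_ball_self hr, ?_, ?_⟩
  · simp only; linarith [min_le_right (ε/2) (r^2/2)]
  · simp only; linarith

lemma c0_pos : 0 < c0 := WK_pos

lemma stepL : ∃ C : ℝ≥0∞, C ≠ ∞ ∧ ∀ (R : ℝ) (u : E3 → ℝ → E3) (P : E3 → ℝ → ℝ), SuitableWeakSolution R u P →
    ∃ E : ℝ≥0∞, E ≠ ∞ ∧ ∀ (r : ℝ), 0 < r → r ≤ 1 → ∀ k, ∀ᵐ z : ET, z ∈ interior (Adm R r) →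
    ENNReal.ofReal (r^5 * c0) * ‖UU R u k z‖ₑ ≤ RS C E R u r z := by
  obtain ⟨C, hC, h⟩ := stepU
  refine ⟨C, hC, fun R u P sol => ?_⟩
  obtain ⟨E, hE, h⟩ := h R u P sol
  refine ⟨E, hE, fun r hr hr1 k => ?_⟩
  have hc := c0_pos
  have hU := UU_L1 sol k
  have key := LD (f := fun z => r^5 * c0 * UU R u k z) (g := fun z => (RS C E R u r z).toReal)
    (hU.const_mul _).locallyIntegrable (RS_loc sol hC hE r) (isOpen_interior (s := Adm R r)) ?_
  · filter_upwards [key] with z hz hzI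
    have h1 := ENNReal.ofReal_le_ofReal (hz hzI)
    rw [abs_mul, abs_of_pos (by positivity), ENNReal.ofReal_mul (by positivity)] at h1
    rw [← Real.enorm_eq_ofReal_abs] at h1
    exact h1.trans ENNReal.ofReal_toReal_le
  intro z δ hδ hs
  set B := closedBall z δ with hB
  have hBm : MeasurableSet B := measurableSet_closedBall
  have hBf : volume B ≠ ∞ := measure_closedBall_lt_top.ne
  have hl := limI hBm hBf ((convex_closedBall z δ).addHaar_frontier volume) hr hU
  rw [integral_const_mul]
  have hfin := RS_fin sol hC hE r z δ
  rw [integral_toReal (RS_meas sol C E r).aemeasurable (ae_lt_top (RS_meas sol C E r) hfin)]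
  refine le_of_tendsto hl.abs (Eventually.of_forall fun n => ?_)
  rw [← ENNReal.ofReal_le_iff_le_toReal hfin, ← Real.enorm_eq_ofReal_abs]
  refine (enorm_integral_le_lintegral_enorm _).trans ?_
  refine setLIntegral_mono (RS_meas sol C E r) fun z0 hz0 => ?_
  exact h z0 r hr hr1 (interior_subset (hs hz0)) _ (by have := an_pos n; positivity) (an_le n) k

lemma norm_sum (x : E3) : ‖x‖ₑ ≤ ∑ k, ‖x k‖ₑ := by
  have h : x = ∑ k, x k • (EuclideanSpace.single k (1:ℝ) : E3) := by
    ext i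
    simp [Finset.sum_apply, Pi.single_apply]
  conv_lhs => rw [h]
  refine (enorm_sum_le _ _).trans (Finset.sum_le_sum fun k _ => ?_)
  rw [enorm_smul]
  have : ‖(EuclideanSpace.single k (1:ℝ) : E3)‖ₑ = 1 := by
    rw [← ofReal_norm]; simp
  rw [this, mul_one]

lemma stepPB (sol : SuitableWeakSolution R u P) : ∃ C E : ℝ≥0∞, C ≠ ∞ ∧ E ≠ ∞ ∧ PB (fun x t => ‖u x t‖ₑ) R C 5 E := by
  obtain ⟨C, hC, h⟩ := stepL
  obtain ⟨E, hE, h⟩ := h R u P sol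
  have hc := c0_pos
  have hc1 : ENNReal.ofReal c0 ≠ 0 := by simpa using hc
  refine ⟨3 * ((ENNReal.ofReal c0)⁻¹ * C), E, ENNReal.mul_ne_top (by simp) (ENNReal.mul_ne_top (by simpa using hc) hC), hE, ?_⟩
  intro r hr hr1
  have hr0 : ENNReal.ofReal r ≠ 0 := by simpa using hr
  filter_upwards [Adm_ae R r, ae_all_iff.2 (h r hr hr1)] with z h1 h2 hs
  have hI := h1 hs
  have hQ := Adm_int hr hI
  have hT : TS R u r z = ∫⁻ w in Qz z r, kk (z.1 - w.1) (z.2 - w.2) * (‖u w.1 w.2‖ₑ * ‖u w.1 w.2‖ₑ) := by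
    refine setLIntegral_congr_fun (Qz_meas z r) fun w hw => ?_
    simp only [FF, indicator_of_mem (hs hw)]
  rw [← hT]
  have hk : ∀ k, ‖u z.1 z.2 k‖ₑ ≤ (ENNReal.ofReal c0)⁻¹ * C * (TS R u r z + (ENNReal.ofReal r)⁻¹ ^ 5 * E) := by
    intro k
    have h3 := h2 k hI
    simp only [UU, indicator_of_mem hQ] at h3
    rw [ENNReal.ofReal_mul (by positivity), ENNReal.ofReal_pow hr.le] at h3
    have h5 : RS C E R u r z = ENNReal.ofReal r ^ 5 * (C * (TS R u r z + (ENNReal.ofReal r)⁻¹ ^ 5 * E)) := by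
      have h6 : ENNReal.ofReal r ^ 5 * (ENNReal.ofReal r)⁻¹ ^ 5 = 1 := by
        rw [← mul_pow, ENNReal.mul_inv_cancel hr0 ofReal_ne_top, one_pow]
      change C * E + C * (ENNReal.ofReal r ^ 5 * TS R u r z) = _
      calc _ = C * ((ENNReal.ofReal r ^ 5 * (ENNReal.ofReal r)⁻¹ ^ 5) * E) + C * (ENNReal.ofReal r ^ 5 * TS R u r z) := by rw [h6, one_mul]
        _ = _ := by ring
    rw [h5, mul_assoc] at h3
    have h7 := (ENNReal.mul_le_mul_iff_right (pow_ne_zero 5 hr0) (by finiteness)).1 h3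
    rw [mul_assoc, ← ENNReal.div_eq_inv_mul, ENNReal.le_div_iff_mul_le (Or.inl hc1) (Or.inl ofReal_ne_top), mul_comm]
    exact h7
  refine (norm_sum _).trans ?_
  refine (Finset.sum_le_sum fun k _ => hk k).trans (le_of_eq ?_)
  simp only [Finset.sum_const, Finset.card_univ, Fintype.card_fin, nsmul_eq_mul]
  push_cast
  ring

theorem final (p : ℝ) (q1 q2 q3 : ℝ) (hp : 1 ≤ p)
    (hq1 : 1 < q1) (hq2 : 1 < q2) (hq3 : 1 < q3)
    (hpq : 2 / p + (1/q1 + 1/q2 + 1/q3) = 1)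
    (ϱ : ℝ) (hϱ : 0 < ϱ) (u : E3 → ℝ → E3) (P : E3 → ℝ → ℝ)
    (sol : SuitableWeakSolution ϱ u P)
    (hu : mixedNorm (ENNReal.ofReal p) q1 q2 q3 ϱ (fun x t => ‖u x t‖) < ∞) :
    RegularPoint u := by
  have hp0 : 0 < p := by linarith
  have hp2 : 2 < p := by
    have a1 : 0 < 1/q1 := by positivity
    have a2 : 0 < 1/q2 := by positivity
    have a3 : 0 < 1/q3 := by positivity
    have : 2 / p < 1 := by linarith
    rwa [div_lt_one hp0] at this
  obtain ⟨C, E, hC, hE, hPB⟩ := stepPB sol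
  obtain ⟨E0, hE0, hL2⟩ := sol_L2 sol
  have hm : Measurable (Function.uncurry fun x t => ‖u x t‖ₑ) := by
    have : Measurable fun z : ET => ‖u z.1 z.2‖ₑ := (sol_meas sol).enorm
    exact this
  have hn : ∫⁻ t in Ioo (-(ϱ^2)) 0, (An q1 q2 q3 ((ball (0:E3) ϱ).indicator (fun x => ‖u x t‖ₑ))) ^ p ≠ ∞ := by
    unfold mixedNorm at hu
    rw [if_neg ofReal_ne_top, ENNReal.toReal_ofReal hp0.le] at hu
    have h1 := (ENNReal.rpow_lt_top_iff_of_pos (by positivity : 0 < 1/p)).1 hu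
    refine ne_of_eq_of_ne ?_ h1.ne
    refine lintegral_congr fun t => ?_
    congr 1
    unfold An anisoNorm
    have : ∀ x, (ball (0:E3) ϱ).indicator (fun x => ‖u x t‖ₑ) x = ENNReal.ofReal |(ball (0:E3) ϱ).indicator (fun x => ‖u x t‖) x| := by
      intro x
      by_cases h : x ∈ ball (0:E3) ϱ
      · rw [indicator_of_mem h, indicator_of_mem h, abs_norm, ofReal_norm]
      · rw [indicator_of_notMem h, indicator_of_notMem h]; simp
    simp_rw [this]
  obtain ⟨r, hr, M, hM, h⟩ := partC hp2 hq1 hq2 hq3 hpq hm hϱ hC hE hE0 hPB hL2 hn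
  refine ⟨r, hr, M.toReal, ?_⟩
  filter_upwards [h] with z hz
  rw [← ENNReal.ofReal_le_iff_le_toReal hM, ofReal_norm]
  exact hz

end ANS

/-- Corollary 1.2 (1): if `u ∈ L^p_t L^{q⃗}_x(Q(ϱ))` with `2/p + 1/q̄ = 1`, `p ∈ [1,∞)`,
`q_j > 1`, then `(0,0)` is a regular point. -/
theorem regularity_aniso_serrin
    (p : ℝ) (q1 q2 q3 : ℝ) (hp : 1 ≤ p)
    (hq1 : 1 < q1) (hq2 : 1 < q2) (hq3 : 1 < q3)
    (hpq : 2 / p + (1/q1 + 1/q2 + 1/q3) = 1)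
    (ϱ : ℝ) (hϱ : 0 < ϱ) (u : E3 → ℝ → E3) (P : E3 → ℝ → ℝ)
    (sol : SuitableWeakSolution ϱ u P)
    (hu : mixedNorm (ENNReal.ofReal p) q1 q2 q3 ϱ (fun x t => ‖u x t‖) < ∞) :
    RegularPoint u := by
  exact ANS.final p q1 q2 q3 hp hq1 hq2 hq3 hpq ϱ hϱ u P sol hu
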